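/- Let n = 2m ≥ 4 be an even integer and c_n = 2^{n-2}((n-2)/2)! π^{n/2}. Let u : ℝⁿ → ℝ be smooth with (-Δ)^m u = 2 Q e^{nu}, f := Q e^{nu} ∈ L¹(ℝⁿ), suppose for every δ > 0 there is R_δ with Q(x) ≥ e^{-δ|x|²} for |x| ≥ R_δ, and suppose ∫₀^∞ e^{u(rθ)} dr = +∞ for every unit vector θ. Let ū(r) = ⨍_{∂B_r(0)} u dσ, viewed as a radial function on ℝⁿ, and define Q̄(r) = (1/2) e^{-n ū(r)} (-Δ)^m ū. Then: (i) ∫₀^∞ e^{ū(r)} dr = +∞; (ii) for every δ > 0 there are C₀ > 0 and R such that Q̄(r) ≥ C₀ e^{-δ r²} for r ≥ R; (iii) Q̄ e^{n ū} ∈ L¹(ℝⁿ) and ∫_{ℝⁿ} Q̄(|x|) e^{n ū(|x|)} dx = ∫_{ℝⁿ} Q(x) e^{nu(x)} dx. -/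

import Mathlib

open MeasureTheory Real Filter Metric
open scoped ENNReal Topology

/-- The constant `c_n = 2^(n-2) * ((n-2)/2)! * pi^(n/2)`. -/
noncomputable def cconst (n : ℕ) : ℝ :=
  2 ^ (n - 2) * (Nat.factorial ((n - 2) / 2)) * Real.pi ^ (n / 2)

/-- The logarithmic potential `v x = (1/c_n) * ∫ log (|x-y|/|y|) f y dy`. -/
noncomputable def logPot (n : ℕ) (f : EuclideanSpace ℝ (Fin n) → ℝ)
    (x : EuclideanSpace ℝ (Fin n)) : ℝ :=
  (1 / cconst n) * ∫ y, Real.log (‖x - y‖ / ‖y‖) * f y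

/-- The Laplacian of `f : ℝ^n → ℝ`, as the trace of the second derivative. -/
noncomputable def laplacian {n : ℕ} (f : EuclideanSpace ℝ (Fin n) → ℝ)
    (x : EuclideanSpace ℝ (Fin n)) : ℝ :=
  ∑ i, iteratedFDeriv ℝ 2 f x ![EuclideanSpace.single i 1, EuclideanSpace.single i 1]

/-- The m-th iterate `(-Δ)^m` of the negative Laplacian. -/
noncomputable def negLapIter {n : ℕ} (m : ℕ) (f : EuclideanSpace ℝ (Fin n) → ℝ) :
    EuclideanSpace ℝ (Fin n) → ℝ :=
  (fun (g : EuclideanSpace ℝ (Fin n) → ℝ) x => -laplacian g x)^[m] f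

/-- The surface measure on the unit sphere of `ℝ^n`, obtained from the polar decomposition of
the Lebesgue measure. -/
noncomputable def sphereMeasure (n : ℕ) :
    MeasureTheory.Measure (Metric.sphere (0 : EuclideanSpace ℝ (Fin n)) 1) :=
  (volume : MeasureTheory.Measure (EuclideanSpace ℝ (Fin n))).toSphere

/-- `ω_{n-1}`, the total surface measure of the unit sphere in `ℝ^n`. -/
noncomputable def omegaN (n : ℕ) : ℝ := (sphereMeasure n Set.univ).toReal

/-- The surface integral `∫_{∂B_s(0)} g dσ`, written in polar coordinates as
`s^{n-1} ∫_{S^{n-1}} g(sθ) dθ`. -/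
noncomputable def sphereIntegral (n : ℕ) (g : EuclideanSpace ℝ (Fin n) → ℝ) (s : ℝ) : ℝ :=
  s ^ (n - 1) * ∫ θ, g (s • (θ : EuclideanSpace ℝ (Fin n))) ∂(sphereMeasure n)

/-- The spherical average `⨍_{∂B_s(0)} g dσ = (1/ω_{n-1}) ∫_{S^{n-1}} g(sθ) dθ`. -/
noncomputable def sphereAvg (n : ℕ) (g : EuclideanSpace ℝ (Fin n) → ℝ) (s : ℝ) : ℝ :=
  (∫ θ, g (s • (θ : EuclideanSpace ℝ (Fin n))) ∂(sphereMeasure n)) / omegaN n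

section
set_option linter.all false
open MeasureTheory Real Filter Metric
open scoped ENNReal Topology

abbrev EE (n : ℕ) := EuclideanSpace ℝ (Fin n)

lemma two_le_top' : (2 : WithTop ℕ∞) ≤ ((⊤ : ℕ∞) : WithTop ℕ∞) := by
  have h : (((2 : ℕ∞)) : WithTop ℕ∞) ≤ ((⊤ : ℕ∞) : WithTop ℕ∞) := WithTop.coe_le_coe.2 le_top
  exact h

lemma lap_eq_sum {n : ℕ} (f : EE n → ℝ) (x : EE n) :
    laplacian f x = ∑ i, fderiv ℝ (fderiv ℝ f) x (EuclideanSpace.single i 1)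
      (EuclideanSpace.single i 1) := by
  unfold laplacian
  simp [iteratedFDeriv_two_apply]

lemma lap_eq_mathlib {n : ℕ} (f : EE n → ℝ) : laplacian f = Laplacian.laplacian f := by
  funext x
  rw [InnerProductSpace.laplacian_eq_iteratedFDeriv_orthonormalBasis f
    (EuclideanSpace.basisFun (Fin n) ℝ)]
  simp [laplacian]

lemma lap_eq_sum' {n : ℕ} {f : EE n → ℝ} (hf : ContDiff ℝ 2 f) (x : EE n) :
    laplacian f x = ∑ i, fderiv ℝ (fun y => fderiv ℝ f y (EuclideanSpace.single i 1)) x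
      (EuclideanSpace.single i 1) := by
  rw [lap_eq_sum]
  refine Finset.sum_congr rfl fun i _ => ?_
  have h1 : DifferentiableAt ℝ (fderiv ℝ f) x :=
    ((hf.fderiv_right (m := 1) (by norm_num)).differentiable (by norm_num)) x
  rw [fderiv_clm_apply h1 (differentiableAt_const _)]
  simp

lemma contDiff_lap {n : ℕ} {f : EE n → ℝ} (hf : ContDiff ℝ (⊤ : ℕ∞) f) :
    ContDiff ℝ (⊤ : ℕ∞) (laplacian f) := by
  have : laplacian f = fun x => ∑ i, fderiv ℝ (fderiv ℝ f) x (EuclideanSpace.single i 1)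
      (EuclideanSpace.single i 1) := funext (lap_eq_sum f)
  rw [this]
  have h1 : ContDiff ℝ (⊤ : ℕ∞) (fderiv ℝ (fderiv ℝ f)) :=
    (hf.fderiv_right (m := (⊤ : ℕ∞)) (by simp)).fderiv_right (by simp)
  refine ContDiff.sum fun i _ => ?_
  exact (h1.clm_apply contDiff_const).clm_apply contDiff_const

lemma negLapIter_zero {n : ℕ} (f : EE n → ℝ) : negLapIter 0 f = f := rfl

lemma negLapIter_succ {n : ℕ} (m : ℕ) (f : EE n → ℝ) :
    negLapIter (m + 1) f = fun x => - laplacian (negLapIter m f) x := by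
  unfold negLapIter
  rw [Function.iterate_succ_apply']

lemma negLapIter_succ' {n : ℕ} (m : ℕ) (f : EE n → ℝ) :
    negLapIter (m + 1) f = negLapIter m (fun x => - laplacian f x) := by
  unfold negLapIter
  rw [Function.iterate_succ_apply]

lemma contDiff_negLapIter {n : ℕ} {f : EE n → ℝ} (hf : ContDiff ℝ (⊤ : ℕ∞) f) (m : ℕ) :
    ContDiff ℝ (⊤ : ℕ∞) (negLapIter m f) := by
  induction m with
  | zero => exact hf
  | succ k ih => rw [negLapIter_succ]; exact (contDiff_lap ih).neg

lemma fderiv_affine {n : ℕ} {F : Type*} [NormedAddCommGroup F] [NormedSpace ℝ F] (f : EE n → F)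
    (hf : Differentiable ℝ f) (x : EE n) (R : ℝ) :
    fderiv ℝ (fun z => f (x + R • z)) = fun z => R • fderiv ℝ f (x + R • z) := by
  funext z
  have h1 : HasFDerivAt (fun z : EE n => x + R • z) (R • ContinuousLinearMap.id ℝ (EE n)) z :=
    ((hasFDerivAt_id z).const_smul R).const_add x
  have := ((hf (x + R • z)).hasFDerivAt.comp z h1).fderiv
  rw [show (fun z => f (x + R • z)) = f ∘ (fun z : EE n => x + R • z) from rfl, this]
  ext v
  simp

lemma lap_affine {n : ℕ} {f : EE n → ℝ} (hf : ContDiff ℝ 2 f) (x : EE n) (R : ℝ) (z : EE n) :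
    laplacian (fun z => f (x + R • z)) z = R ^ 2 * laplacian f (x + R • z) := by
  have h1 : Differentiable ℝ (fderiv ℝ f) :=
    (hf.fderiv_right (m := 1) (by norm_num)).differentiable (by norm_num)
  rw [lap_eq_sum, lap_eq_sum, fderiv_affine f (hf.differentiable (by norm_num)), Finset.mul_sum]
  refine Finset.sum_congr rfl fun i _ => ?_
  have : fderiv ℝ (fun z => R • fderiv ℝ f (x + R • z)) z
      = R • (R • fderiv ℝ (fderiv ℝ f) (x + R • z)) := by
    have h2 := congrFun (fderiv_affine (fderiv ℝ f) h1 x R) z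
    rw [← h2]
    have h3 : Differentiable ℝ (fun z : EE n => x + R • z) := by fun_prop
    exact fderiv_fun_const_smul ((h1.comp h3) z) R
  rw [this]
  simp
  ring

lemma lap_neg {n : ℕ} (f : EE n → ℝ) (x : EE n) : laplacian (fun y => - f y) x = - laplacian f x := by
  rw [lap_eq_sum, lap_eq_sum]
  have h1 : fderiv ℝ (fun y => - f y) = fun y => - fderiv ℝ f y := by
    funext y; exact fderiv_fun_neg
  have h2 : fderiv ℝ (fun y => - fderiv ℝ f y) x = - fderiv ℝ (fderiv ℝ f) x := fderiv_fun_neg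
  rw [h1, h2]
  simp

lemma lap_const_mul {n : ℕ} {f : EE n → ℝ} (hf : ContDiff ℝ 2 f) (c : ℝ) (x : EE n) :
    laplacian (fun y => c * f y) x = c * laplacian f x := by
  have h1 : Differentiable ℝ (fderiv ℝ f) :=
    (hf.fderiv_right (m := 1) (by norm_num)).differentiable (by norm_num)
  rw [lap_eq_sum, lap_eq_sum]
  have h1' : fderiv ℝ (fun y => c * f y) = fun y => c • fderiv ℝ f y := by
    funext y; exact fderiv_const_mul (hf.differentiable (by norm_num) y) c
  have h2 : fderiv ℝ (fun y => c • fderiv ℝ f y) x = c • fderiv ℝ (fderiv ℝ f) x :=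
    fderiv_fun_const_smul (h1 x) c
  rw [h1', h2, Finset.mul_sum]
  simp

lemma negLapIter_affine {n : ℕ} {f : EE n → ℝ} (hf : ContDiff ℝ (⊤ : ℕ∞) f) (m : ℕ) (x : EE n)
    (R : ℝ) (z : EE n) :
    negLapIter m (fun z => f (x + R • z)) z = R ^ (2 * m) * negLapIter m f (x + R • z) := by
  induction m generalizing z with
  | zero => simp [negLapIter_zero]
  | succ k ih =>
    have h0 : ContDiff ℝ 2 (negLapIter k f) := (contDiff_negLapIter hf k).of_le two_le_top'
    have h0' : ContDiff ℝ 2 (fun z : EE n => negLapIter k f (x + R • z)) := by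
      exact h0.comp (by fun_prop)
    rw [negLapIter_succ, negLapIter_succ, funext ih]
    simp only
    rw [lap_const_mul h0', lap_affine h0]
    ring

lemma hcs_lap {n : ℕ} {f : EE n → ℝ} (hc : HasCompactSupport f) :
    HasCompactSupport (laplacian f) := by
  have h2 : HasCompactSupport (fderiv ℝ (fderiv ℝ f)) := (hc.fderiv ℝ).fderiv ℝ
  refine h2.mono ?_
  intro x hx hx'
  apply hx
  rw [lap_eq_sum, hx']
  simp

lemma hcs_negLapIter {n : ℕ} {f : EE n → ℝ} (hc : HasCompactSupport f) (m : ℕ) :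
    HasCompactSupport (negLapIter m f) := by
  induction m with
  | zero => exact hc
  | succ k ih => rw [negLapIter_succ]; exact (hcs_lap ih).neg

lemma ibp1 {n : ℕ} {K g : EE n → ℝ} (hK : ContDiff ℝ 1 K) (hc : HasCompactSupport K)
    (hg : ContDiff ℝ 1 g) (v : EE n) :
    ∫ x, K x * fderiv ℝ g x v = - ∫ x, fderiv ℝ K x v * g x := by
  have hK' : Continuous (fun x => fderiv ℝ K x v) :=
    (hK.continuous_fderiv (by norm_num)).clm_apply continuous_const
  have hg' : Continuous (fun x => fderiv ℝ g x v) :=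
    (hg.continuous_fderiv (by norm_num)).clm_apply continuous_const
  refine integral_mul_fderiv_eq_neg_fderiv_mul_of_integrable ?_ ?_ ?_ ?_ ?_
  · refine (hK'.mul hg.continuous).integrable_of_hasCompactSupport ?_
    exact ((hc.fderiv ℝ).comp_left (g := fun L : EE n →L[ℝ] ℝ => L v) (by simp)).mul_right
  · exact (hK.continuous.mul hg').integrable_of_hasCompactSupport hc.mul_right
  · exact (hK.continuous.mul hg.continuous).integrable_of_hasCompactSupport hc.mul_right
  · exact fun x _ => hK.differentiable (by norm_num) x
  · exact fun x _ => hg.differentiable (by norm_num) x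

lemma integrable_mul_cs {n : ℕ} {K g : EE n → ℝ} (hK : Continuous K) (hc : HasCompactSupport K)
    (hg : Continuous g) : Integrable (fun x => K x * g x) :=
  (hK.mul hg).integrable_of_hasCompactSupport hc.mul_right

lemma ibp_lap {n : ℕ} {K g : EE n → ℝ} (hK : ContDiff ℝ (⊤ : ℕ∞) K) (hc : HasCompactSupport K)
    (hg : ContDiff ℝ (⊤ : ℕ∞) g) :
    ∫ x, K x * laplacian g x = ∫ x, laplacian K x * g x := by
  have d1 : ∀ (h : EE n → ℝ) (hh : ContDiff ℝ (⊤ : ℕ∞) h) (v : EE n),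
      ContDiff ℝ (⊤ : ℕ∞) (fun y => fderiv ℝ h y v) := fun h hh v =>
    (hh.fderiv_right (m := (⊤ : ℕ∞)) (by simp)).clm_apply contDiff_const
  have o1 : ∀ (h : EE n → ℝ) (hh : ContDiff ℝ (⊤ : ℕ∞) h), ContDiff ℝ 1 h := fun h hh =>
    hh.of_le (by exact_mod_cast le_top)
  have cs1 : ∀ (h : EE n → ℝ) (hh : HasCompactSupport h) (v : EE n),
      HasCompactSupport (fun y => fderiv ℝ h y v) := fun h hh v =>
    (hh.fderiv ℝ).comp_left (g := fun L : EE n →L[ℝ] ℝ => L v) (by simp)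
  have hK2 : ContDiff ℝ 2 K := hK.of_le two_le_top'
  have hg2 : ContDiff ℝ 2 g := hg.of_le two_le_top'
  simp_rw [lap_eq_sum' hK2, lap_eq_sum' hg2, Finset.mul_sum, Finset.sum_mul]
  rw [integral_finsetSum, integral_finsetSum]
  · refine Finset.sum_congr rfl fun i _ => ?_
    set e : EE n := EuclideanSpace.single i 1
    rw [ibp1 (o1 _ hK) hc (o1 _ (d1 _ hg e))]
    have := ibp1 (o1 _ (d1 _ hK e)) (cs1 _ hc e) (o1 _ hg) e
    rw [this, neg_neg]
  · intro i _
    exact integrable_mul_cs (d1 _ (d1 _ hK _) _).continuous (cs1 _ (cs1 _ hc _) _) hg.continuous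
  · intro i _
    exact integrable_mul_cs hK.continuous hc (d1 _ (d1 _ hg _) _).continuous

lemma ibp_iter {n : ℕ} {K g : EE n → ℝ} (hK : ContDiff ℝ (⊤ : ℕ∞) K) (hc : HasCompactSupport K)
    (hg : ContDiff ℝ (⊤ : ℕ∞) g) (m : ℕ) :
    ∫ x, K x * negLapIter m g x = ∫ x, negLapIter m K x * g x := by
  induction m generalizing K with
  | zero => rfl
  | succ k ih =>
    have h1 := ibp_lap hK hc (contDiff_negLapIter hg k)
    have h2 := ih (contDiff_lap hK).neg (hcs_lap hc).neg
    rw [negLapIter_succ, negLapIter_succ']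
    simp only [mul_neg, integral_neg, h1]
    rw [show (fun x => - laplacian K x) = -laplacian K from rfl]
    refine Eq.trans ?_ h2
    simp [integral_neg]

end

section
open MeasureTheory Real Filter Metric
open scoped ENNReal Topology

section genavg
variable {G : Type*} [TopologicalSpace G] [CompactSpace G] [MeasurableSpace G] [BorelSpace G]
  [SecondCountableTopology G]

lemma cont_int_compact {V : Type*} [NormedAddCommGroup V] (μ : Measure G) [IsFiniteMeasure μ]
    {f : G → V} (hf : Continuous f) : Integrable f μ :=
  hf.integrable_of_hasCompactSupport (HasCompactSupport.of_compactSpace _)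

lemma hasFDerivAt_gint {n : ℕ} {V : Type*} [NormedAddCommGroup V] [NormedSpace ℝ V]
    (μ : Measure G) [IsFiniteMeasure μ]
    (F : EE n → G → V) (F' : EE n → G → (EE n →L[ℝ] V))
    (hF : Continuous (fun p : EE n × G => F p.1 p.2))
    (hF' : Continuous (fun p : EE n × G => F' p.1 p.2))
    (h : ∀ x g, HasFDerivAt (fun y => F y g) (F' x g) x) (x : EE n) :
    HasFDerivAt (fun y => ∫ g, F y g ∂μ) (∫ g, F' x g ∂μ) x := by
  have hcomp : IsCompact (closedBall x 1 ×ˢ (Set.univ : Set G)) :=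
    (isCompact_closedBall x 1).prod isCompact_univ
  obtain ⟨C, hC⟩ := hcomp.exists_bound_of_continuousOn hF'.continuousOn
  have c1 : ∀ y, Continuous (F y) := fun y => hF.comp (Continuous.prodMk_right y)
  have c2 : ∀ y, Continuous (F' y) := fun y => hF'.comp (Continuous.prodMk_right y)
  refine hasFDerivAt_integral_of_dominated_of_fderiv_le (bound := fun _ => C)
    (ball_mem_nhds x one_pos) ?_ ?_ ?_ ?_ ?_ ?_
  · exact Eventually.of_forall fun y => (c1 y).aestronglyMeasurable
  · exact cont_int_compact μ (c1 x)
  · exact (c2 x).aestronglyMeasurable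
  · refine Eventually.of_forall fun g y hy => hC (y, g) ⟨ball_subset_closedBall hy, trivial⟩
  · exact integrable_const _
  · exact Eventually.of_forall fun g y _ => h y g

lemma clm_int_apply {V W : Type*} [NormedAddCommGroup V] [NormedSpace ℝ V]
    [NormedAddCommGroup W] [NormedSpace ℝ W]
    (μ : Measure G) [IsFiniteMeasure μ] {L : G → V →L[ℝ] W} (hL : Continuous L) (v : V) :
    (∫ g, L g ∂μ) v = ∫ g, L g v ∂μ :=
  ContinuousLinearMap.integral_apply (cont_int_compact μ hL) v

lemma lap_gavg {n : ℕ} (μ : Measure G) [IsFiniteMeasure μ] (A : G → (EE n →L[ℝ] EE n))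
    (hA : Continuous A) (hiso : ∀ g, ∃ e : EE n ≃ₗᵢ[ℝ] EE n, ∀ x, A g x = e x)
    {u : EE n → ℝ} (hu : ContDiff ℝ 2 u) (x : EE n) :
    laplacian (fun y => ∫ g, u (A g y) ∂μ) x = ∫ g, laplacian u (A g x) ∂μ := by
  have cu1 : Continuous (fderiv ℝ u) := hu.continuous_fderiv (by norm_num)
  have hu1 : ContDiff ℝ 1 (fderiv ℝ u) := hu.fderiv_right (by norm_num)
  have cu2 : Continuous (fderiv ℝ (fderiv ℝ u)) := hu1.continuous_fderiv (by norm_num)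
  have cA : Continuous (fun p : EE n × G => A p.2 p.1) := by fun_prop
  have cA2 : Continuous (fun p : EE n × G => A p.2) := by fun_prop
  have H1 : ∀ x, HasFDerivAt (fun y => ∫ g, u (A g y) ∂μ)
      (∫ g, (fderiv ℝ u (A g x)).comp (A g) ∂μ) x := by
    intro x
    refine hasFDerivAt_gint μ (fun y g => u (A g y)) (fun x g => (fderiv ℝ u (A g x)).comp (A g))
      ?_ ?_ ?_ x
    · exact hu.continuous.comp cA
    · exact (cu1.comp cA).clm_comp cA2
    · intro x g
      exact ((hu.differentiable (by norm_num)) _).hasFDerivAt.comp x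
        (ContinuousLinearMap.hasFDerivAt _)
  have H1' : fderiv ℝ (fun y => ∫ g, u (A g y) ∂μ) =
      fun x => ∫ g, (fderiv ℝ u (A g x)).comp (A g) ∂μ := funext fun x => (H1 x).fderiv
  set T : EE n → G → (EE n →L[ℝ] EE n →L[ℝ] ℝ) := fun x g =>
    ((ContinuousLinearMap.compL ℝ (EE n) (EE n) ℝ).flip (A g)).comp
      ((fderiv ℝ (fderiv ℝ u) (A g x)).comp (A g)) with hT
  have cT : Continuous (fun p : EE n × G => T p.1 p.2) := by
    refine Continuous.clm_comp (by fun_prop) ?_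
    exact (cu2.comp cA).clm_comp cA2
  have H2 : HasFDerivAt (fderiv ℝ (fun y => ∫ g, u (A g y) ∂μ)) (∫ g, T x g ∂μ) x := by
    rw [H1']
    refine hasFDerivAt_gint μ (fun y g => (fderiv ℝ u (A g y)).comp (A g)) T ?_ cT ?_ x
    · exact (cu1.comp cA).clm_comp cA2
    · intro x g
      have h1 : HasFDerivAt (fun y => fderiv ℝ u (A g y))
        ((fderiv ℝ (fderiv ℝ u) (A g x)).comp (A g)) x :=
        ((hu1.differentiable (by norm_num)) _).hasFDerivAt.comp x
          (ContinuousLinearMap.hasFDerivAt _)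
      exact (((ContinuousLinearMap.compL ℝ (EE n) (EE n) ℝ).flip (A g)).hasFDerivAt).comp x h1
  rw [lap_eq_sum, H2.fderiv]
  have cTx : Continuous (T x) := cT.comp (Continuous.prodMk_right x)
  have cTv : ∀ v, Continuous (fun g => T x g v) := fun v => cTx.clm_apply continuous_const
  have e1 : ∀ v : EE n, (∫ g, T x g ∂μ) v v = ∫ g, T x g v v ∂μ := by
    intro v
    exact (congrArg (fun w : EE n →L[ℝ] ℝ => w v) (clm_int_apply μ cTx v)).trans
      (clm_int_apply μ (cTv v) v)
  simp_rw [e1]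
  rw [← integral_finsetSum]
  · refine integral_congr_ae (Eventually.of_forall fun g => ?_)
    obtain ⟨e, he⟩ := hiso g
    simp only
    rw [lap_eq_mathlib, InnerProductSpace.laplacian_eq_iteratedFDeriv_orthonormalBasis u
      ((EuclideanSpace.basisFun (Fin n) ℝ).map e)]
    simp [iteratedFDeriv_two_apply, hT, he]
  · intro i _
    exact cont_int_compact μ ((cTv _).clm_apply continuous_const)

lemma negLapIter_gavg {n : ℕ} (μ : Measure G) [IsFiniteMeasure μ] (A : G → (EE n →L[ℝ] EE n))
    (hA : Continuous A) (hiso : ∀ g, ∃ e : EE n ≃ₗᵢ[ℝ] EE n, ∀ x, A g x = e x)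
    {u : EE n → ℝ} (hu : ContDiff ℝ (⊤ : ℕ∞) u) (m : ℕ) :
    negLapIter m (fun y => ∫ g, u (A g y) ∂μ) = fun x => ∫ g, negLapIter m u (A g x) ∂μ := by
  induction m with
  | zero => rfl
  | succ k ih =>
    rw [negLapIter_succ, ih, negLapIter_succ]
    funext x
    rw [lap_gavg μ A hA hiso ((contDiff_negLapIter hu k).of_le two_le_top'), integral_neg]

end genavg

end

section
open MeasureTheory Real Filter Metric
open scoped ENNReal Topology

instance instCStarEE (n : ℕ) : ContinuousStar (EE n →L[ℝ] EE n) :=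
  ⟨(ContinuousLinearMap.adjoint (𝕜 := ℝ) (E := EE n) (F := EE n)).continuous⟩

noncomputable abbrev GG (n : ℕ) : Type := ↥(unitary (EE n →L[ℝ] EE n))

noncomputable instance (n : ℕ) : MeasurableSpace (GG n) := borel _
instance (n : ℕ) : BorelSpace (GG n) := ⟨rfl⟩

lemma GG_norm_le {n : ℕ} (g : GG n) : ‖(g : EE n →L[ℝ] EE n)‖ ≤ 1 :=
  ContinuousLinearMap.opNorm_le_bound _ zero_le_one fun x => by
    rw [one_mul]; exact (ContinuousLinearMap.norm_map_of_mem_unitary g.2 x).le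

instance GG_compact (n : ℕ) : CompactSpace (GG n) := by
  have : IsCompact ((unitary (EE n →L[ℝ] EE n) : Set (EE n →L[ℝ] EE n))) := by
    refine Metric.isCompact_of_isClosed_isBounded isClosed_unitary ?_
    refine (Metric.isBounded_closedBall (x := (0 : EE n →L[ℝ] EE n)) (r := 1)).subset ?_
    intro g hg
    simpa using GG_norm_le ⟨g, hg⟩
  exact isCompact_iff_compactSpace.1 this

instance (n : ℕ) : SecondCountableTopology (EE n →L[ℝ] EE n) :=
  secondCountable_of_proper

instance instTGGG (n : ℕ) : IsTopologicalGroup (GG n) where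
  continuous_mul := by
    refine Continuous.subtype_mk ?_ _
    exact (continuous_subtype_val.comp continuous_fst).mul
      (continuous_subtype_val.comp continuous_snd)
  continuous_inv := by
    refine Continuous.subtype_mk ?_ _
    exact continuous_star.comp continuous_subtype_val

noncomputable def gmeas (n : ℕ) : Measure (GG n) := Measure.haarMeasure ⊤

instance (n : ℕ) : IsProbabilityMeasure (gmeas n) :=
  ⟨by
    have := Measure.haarMeasure_self (K₀ := (⊤ : TopologicalSpace.PositiveCompacts (GG n)))
    simpa [gmeas] using this⟩

instance (n : ℕ) : (gmeas n).IsMulLeftInvariant := by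
  unfold gmeas; infer_instance

noncomputable def gA {n : ℕ} (g : GG n) : EE n →L[ℝ] EE n := ((g⁻¹ : GG n) : EE n →L[ℝ] EE n)

lemma gA_cont (n : ℕ) : Continuous (gA : GG n → _) := by
  unfold gA
  exact continuous_subtype_val.comp (ContinuousInv.continuous_inv)

lemma gA_iso {n : ℕ} (g : GG n) : ∃ e : EE n ≃ₗᵢ[ℝ] EE n, ∀ x, gA g x = e x :=
  ⟨Unitary.linearIsometryEquiv (g⁻¹), fun x => rfl⟩

noncomputable def gAvg {n : ℕ} (u : EE n → ℝ) (x : EE n) : ℝ :=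
  ∫ g, u (gA g x) ∂(gmeas n)

lemma negLapIter_gAvg {n : ℕ} {u : EE n → ℝ} (hu : ContDiff ℝ (⊤ : ℕ∞) u) (m : ℕ) :
    negLapIter m (gAvg u) = gAvg (negLapIter m u) :=
  negLapIter_gavg (gmeas n) gA (gA_cont n) gA_iso hu m

lemma gAvg_eq_of_norm {n : ℕ} (u : EE n → ℝ) {x y : EE n} (h : ‖x‖ = ‖y‖) :
    gAvg u x = gAvg u y := by
  set e : EE n ≃ₗᵢ[ℝ] EE n := (Submodule.span ℝ {x - y})ᗮ.reflection
  have he : e x = y := Submodule.reflection_sub h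
  set k : GG n := Unitary.linearIsometryEquiv.symm e with hk
  have hkx : (k : EE n →L[ℝ] EE n) x = y := he
  unfold gAvg
  rw [← integral_mul_left_eq_self (μ := gmeas n) (fun g => u (gA g y)) k]
  refine integral_congr_ae (Eventually.of_forall fun g => ?_)
  simp only [gA, mul_inv_rev]
  rw [← hkx]
  have : ((g⁻¹ * k⁻¹ : GG n) : EE n →L[ℝ] EE n) ((k : EE n →L[ℝ] EE n) x) =
      ((g⁻¹ * k⁻¹ * k : GG n) : EE n →L[ℝ] EE n) x := rfl
  rw [this]
  simp

end

section
set_option linter.all false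
open MeasureTheory Real Filter Metric
open scoped ENNReal Topology Pointwise

lemma sphere_inv {n : ℕ} (e : EE n ≃ₗᵢ[ℝ] EE n) (F : EE n → ℝ) (hF : Continuous F) :
    ∫ θ, F (e (θ : EE n)) ∂(sphereMeasure n) = ∫ θ, F (θ : EE n) ∂(sphereMeasure n) := by
  set es : sphere (0 : EE n) 1 → sphere (0 : EE n) 1 :=
    fun θ => ⟨e θ, by simpa using θ.2⟩ with hes
  have ces : Continuous es := by
    refine Continuous.subtype_mk ?_ _
    exact e.continuous.comp continuous_subtype_val
  have hmap : Measure.map es (sphereMeasure n) = sphereMeasure n := by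
    ext s hs
    rw [Measure.map_apply ces.measurable hs, sphereMeasure,
      Measure.toSphere_apply' _ hs, Measure.toSphere_apply' _ (ces.measurable hs)]
    congr 1
    rw [← (e.measurePreserving).measure_preimage_equiv (f := e.toMeasurableEquiv)
      (Set.Ioo (0 : ℝ) 1 • (Subtype.val '' s))]
    congr 1
    change _ = e ⁻¹' _
    ext x
    simp only [Set.mem_smul, Set.mem_image, Set.mem_preimage]
    constructor
    · rintro ⟨a, ha, _, ⟨θ, hθ, rfl⟩, rfl⟩
      refine ⟨a, ha, _, ⟨es θ, hθ, rfl⟩, ?_⟩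
      simp [es]
    · rintro ⟨a, ha, _, ⟨θ, hθ, rfl⟩, hx⟩
      refine ⟨a, ha, _, ⟨⟨e.symm θ, by simpa using θ.2⟩, ?_, rfl⟩, ?_⟩
      · simpa [es] using hθ
      · apply e.injective
        simpa using hx
  have := integral_map (μ := sphereMeasure n) ces.measurable.aemeasurable
    (f := fun θ : sphere (0 : EE n) 1 => F θ) (hF.comp continuous_subtype_val).aestronglyMeasurable
  rw [hmap] at this
  exact this.symm

instance (n : ℕ) : IsFiniteMeasure (sphereMeasure n) := by
  unfold sphereMeasure; infer_instance

lemma omegaN_pos {n : ℕ} (hn : 1 ≤ n) : 0 < omegaN n := by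
  haveI : Nonempty (Fin n) := ⟨⟨0, hn⟩⟩
  haveI : Nontrivial (EE n) := inferInstance
  unfold omegaN sphereMeasure
  refine ENNReal.toReal_pos ?_ (measure_ne_top _ _)
  rw [Measure.toSphere_apply_univ]
  have h1 : (Module.finrank ℝ (EE n) : ℝ≥0∞) ≠ 0 := by
    simp; omega
  exact mul_ne_zero h1 (measure_ball_pos _ _ one_pos).ne'

lemma cont_gA_app {n : ℕ} : Continuous (fun p : EE n × GG n => gA p.2 p.1) :=
  ((gA_cont n).comp continuous_snd).clm_apply continuous_fst

lemma gint_cont {n : ℕ} {φ : GG n → ℝ} (h : Continuous φ) : Integrable φ (gmeas n) :=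
  cont_int_compact _ h

lemma gint_cont2 {n : ℕ} {φ : sphere (0 : EE n) 1 × GG n → ℝ} (h : Continuous φ) :
    Integrable φ ((sphereMeasure n).prod (gmeas n)) :=
  cont_int_compact _ h

lemma cont_gA_x {n : ℕ} (x : EE n) : Continuous (fun g : GG n => gA g x) :=
  (gA_cont n).clm_apply continuous_const

lemma gA_norm {n : ℕ} (g : GG n) (x : EE n) : ‖gA g x‖ = ‖x‖ := by
  obtain ⟨e, he⟩ := gA_iso g
  rw [he]; simp

lemma gAvg_affine {n : ℕ} {u : EE n → ℝ} (hu : Continuous u) (a b : ℝ) (x : EE n) :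
    gAvg (fun y => a * u y + b) x = a * gAvg u x + b := by
  have hi : Integrable (fun g => u (gA g x)) (gmeas n) :=
    gint_cont (hu.comp (cont_gA_x x))
  unfold gAvg
  rw [integral_add (hi.const_mul a) (integrable_const b), integral_const_mul]
  simp

lemma gAvg_mono {n : ℕ} {u v : EE n → ℝ} (hu : Continuous u) (hv : Continuous v) (x : EE n)
    (h : ∀ y, ‖y‖ = ‖x‖ → u y ≤ v y) : gAvg u x ≤ gAvg v x := by
  unfold gAvg
  exact integral_mono (gint_cont (hu.comp (cont_gA_x x))) (gint_cont (hv.comp (cont_gA_x x)))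
    (fun g => h _ (gA_norm g x))

lemma sphereAvg_eq_gAvg {n : ℕ} (hn : 1 ≤ n) {u : EE n → ℝ} (hu : Continuous u) (x : EE n) :
    sphereAvg n u ‖x‖ = gAvg u x := by
  unfold sphereAvg
  rw [div_eq_iff (omegaN_pos hn).ne']
  have h1 : ∫ θ, gAvg u (‖x‖ • (θ : EE n)) ∂(sphereMeasure n) = gAvg u x * omegaN n := by
    have : ∀ θ : sphere (0 : EE n) 1, gAvg u (‖x‖ • (θ : EE n)) = gAvg u x := by
      intro θ
      apply gAvg_eq_of_norm
      simp [norm_smul]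
    simp_rw [this]
    rw [integral_const, smul_eq_mul, mul_comm]
    rfl
  rw [← h1]
  unfold gAvg
  rw [integral_integral_swap]
  · have : ∀ g : GG n, ∫ θ, u (gA g (‖x‖ • (θ : EE n))) ∂(sphereMeasure n) =
        ∫ θ, u (‖x‖ • (θ : EE n)) ∂(sphereMeasure n) := by
      intro g
      obtain ⟨e, he⟩ := gA_iso g
      simp_rw [he, map_smul]
      exact sphere_inv e (fun y => u (‖x‖ • y)) (by fun_prop)
    simp_rw [this]
    simp
  · have hh : Continuous (fun p : sphere (0 : EE n) 1 × GG n =>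
        gA p.2 (‖x‖ • (p.1 : EE n))) :=
      ((gA_cont n).comp continuous_snd).clm_apply
        ((continuous_subtype_val.comp continuous_fst).const_smul ‖x‖)
    exact gint_cont2 (hu.comp hh)

lemma gAvg_integrable {n : ℕ} {f : EE n → ℝ} (hc : Continuous f) (hf : Integrable f) :
    Integrable (gAvg f) ∧ ∫ x, gAvg f x = ∫ x, f x := by
  have hcc : Continuous (fun p : EE n × GG n => f (gA p.2 p.1)) := hc.comp cont_gA_app
  have key : ∀ (g : GG n), Integrable (fun x => f (gA g x)) ∧
      ∀ φ : EE n → ℝ, ∫ x, φ (gA g x) = ∫ x, φ x := by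
    intro g
    obtain ⟨e, he⟩ := gA_iso g
    simp_rw [he]
    refine ⟨(e.measurePreserving.integrable_comp_emb e.toMeasurableEquiv.measurableEmbedding).2 hf,
      fun φ => e.measurePreserving.integral_comp e.toMeasurableEquiv.measurableEmbedding φ⟩
  have hI : Integrable (fun p : EE n × GG n => f (gA p.2 p.1)) (volume.prod (gmeas n)) := by
    rw [integrable_prod_iff' hcc.aestronglyMeasurable]
    refine ⟨Eventually.of_forall fun g => (key g).1, ?_⟩
    have : ∀ g : GG n, ∫ x, ‖f (gA g x)‖ = ∫ x, ‖f x‖ := fun g => (key g).2 (fun x => ‖f x‖)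
    simp_rw [this]
    exact integrable_const _
  refine ⟨hI.integral_prod_left, ?_⟩
  unfold gAvg
  rw [integral_integral_swap hI]
  simp_rw [(key _).2 f]
  simp

/-- Parts (ii) and (iii). -/
lemma parts_ii_iii (m n : ℕ) (hm : 2 ≤ m) (hn : n = 2 * m)
    (u Q : EuclideanSpace ℝ (Fin n) → ℝ) (hu : ContDiff ℝ (⊤ : ℕ∞) u)
    (hPDE : ∀ x, negLapIter m u x = 2 * Q x * Real.exp (n * u x))
    (hf : MeasureTheory.Integrable (fun y => Q y * Real.exp (n * u y)))
    (hQ : ∀ δ > (0 : ℝ), ∃ Rδ : ℝ, ∀ x : EuclideanSpace ℝ (Fin n), Rδ ≤ ‖x‖ →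
      Real.exp (-δ * ‖x‖ ^ 2) ≤ Q x)
    (ubar : EuclideanSpace ℝ (Fin n) → ℝ) (hubar : ∀ x, ubar x = sphereAvg n u ‖x‖)
    (Qbar : EuclideanSpace ℝ (Fin n) → ℝ)
    (hQbar : ∀ x, Qbar x = 1 / 2 * Real.exp (-(n : ℝ) * ubar x) * negLapIter m ubar x) :
    (∀ δ > (0 : ℝ), ∃ C₀ > (0 : ℝ), ∃ R : ℝ, ∀ x : EuclideanSpace ℝ (Fin n), R ≤ ‖x‖ →
      C₀ * Real.exp (-δ * ‖x‖ ^ 2) ≤ Qbar x) ∧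
    MeasureTheory.Integrable (fun x => Qbar x * Real.exp (n * ubar x)) ∧
    (∫ x, Qbar x * Real.exp (n * ubar x)) = ∫ x, Q x * Real.exp (n * u x) := by
  have hn1 : 1 ≤ n := by omega
  have hub : ubar = gAvg u := funext fun x => by
    rw [hubar, sphereAvg_eq_gAvg hn1 hu.continuous]
  have hfe : (fun y => Q y * Real.exp (n * u y)) = fun y => 1 / 2 * negLapIter m u y := by
    funext y; rw [hPDE]; ring
  have hfc : Continuous (fun y => Q y * Real.exp (n * u y)) := by
    rw [hfe]; exact continuous_const.mul (contDiff_negLapIter hu m).continuous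
  have hL : ∀ x, 1 / 2 * negLapIter m ubar x = gAvg (fun y => Q y * Real.exp (n * u y)) x := by
    intro x
    rw [hub, negLapIter_gAvg hu, hfe]
    unfold gAvg
    rw [integral_const_mul]
  have hprod : (fun x => Qbar x * Real.exp (n * ubar x)) =
      gAvg (fun y => Q y * Real.exp (n * u y)) := by
    funext x
    rw [← hL, hQbar]
    have : Real.exp (-(n : ℝ) * ubar x) * Real.exp (n * ubar x) = 1 := by
      rw [← Real.exp_add]; simp
    linear_combination (1 / 2 * negLapIter m ubar x) * this
  refine ⟨?_, ?_⟩
  · intro δ hδ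
    obtain ⟨R, hR⟩ := hQ δ hδ
    refine ⟨1, one_pos, R, fun x hx => ?_⟩
    have hq : Qbar x = Real.exp (-(n : ℝ) * ubar x) *
        gAvg (fun y => Q y * Real.exp (n * u y)) x := by
      rw [← hL, hQbar]; ring
    have low : gAvg (fun y => Q y * Real.exp (n * u y)) x ≥
        Real.exp (-δ * ‖x‖ ^ 2) * Real.exp (n * ubar x) := by
      set a : ℝ := Real.exp (-δ * ‖x‖ ^ 2) * Real.exp (n * ubar x) with ha
      have h1 : gAvg (fun y => (a * n) * u y + a * (1 - n * ubar x)) x = a := by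
        rw [gAvg_affine hu.continuous, ← hub]; ring
      rw [ge_iff_le]
      nth_rewrite 1 [← h1]
      refine gAvg_mono (by have := hu.continuous; fun_prop) hfc x fun y hy => ?_
      have hg : Real.exp (-δ * ‖x‖ ^ 2) ≤ Q y := by
        have := hR y (by rwa [hy])
        rwa [hy] at this
      have he : Real.exp (n * ubar x) * (1 + (n * u y - n * ubar x)) ≤
          Real.exp (n * u y) := by
        have h2 : Real.exp (n * u y) = Real.exp (n * ubar x) *
            Real.exp (n * u y - n * ubar x) := by rw [← Real.exp_add]; ring_nf
        rw [h2]
        refine mul_le_mul_of_nonneg_left ?_ (Real.exp_pos _).le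
        linarith [Real.add_one_le_exp (n * u y - n * ubar x)]
      refine le_trans (le_of_eq ?_) ((mul_le_mul_of_nonneg_left he (Real.exp_pos (-δ * ‖x‖ ^ 2)).le).trans
        (mul_le_mul_of_nonneg_right hg (Real.exp_pos _).le))
      rw [ha]; ring
    rw [hq, one_mul]
    have h3 : Real.exp (-δ * ‖x‖ ^ 2) = Real.exp (-(n : ℝ) * ubar x) *
        (Real.exp (-δ * ‖x‖ ^ 2) * Real.exp (n * ubar x)) := by
      rw [← Real.exp_add, ← Real.exp_add]; ring_nf
    rw [h3]
    exact mul_le_mul_of_nonneg_left low (Real.exp_pos _).le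
  · rw [hprod]
    exact gAvg_integrable hfc hf

end

section
set_option linter.all false
open MeasureTheory Real Filter Metric
open scoped ENNReal Topology

lemma sum_inner_sq {n : ℕ} (z : EE n) :
    ∑ i, (inner ℝ z (EuclideanSpace.single i (1 : ℝ))) ^ 2 = ‖z‖ ^ 2 := by
  rw [EuclideanSpace.norm_sq_eq]
  refine Finset.sum_congr rfl fun i _ => ?_
  simp [EuclideanSpace.inner_single_right]

/-- log of the regularised squared norm -/
noncomputable def Lg {n : ℕ} (ε : ℝ) (z : EE n) : ℝ := Real.log (‖z‖ ^ 2 + ε ^ 2)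

lemma rho_pos {n : ℕ} {ε : ℝ} (hε : ε ≠ 0) (z : EE n) : 0 < ‖z‖ ^ 2 + ε ^ 2 := by positivity

lemma Lg_contDiff {n : ℕ} {ε : ℝ} (hε : ε ≠ 0) : ContDiff ℝ (⊤ : ℕ∞) (Lg (n := n) ε) := by
  unfold Lg
  refine ContDiff.log ?_ fun z => (rho_pos hε z).ne'
  exact (contDiff_norm_sq ℝ).add contDiff_const

lemma hasFDerivAt_rho {n : ℕ} (ε : ℝ) (z : EE n) :
    HasFDerivAt (fun z : EE n => ‖z‖ ^ 2 + ε ^ 2) (2 • innerSL ℝ z) z :=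
  (hasStrictFDerivAt_norm_sq z).hasFDerivAt.add_const _

lemma lap_radial {n : ℕ} {φ : ℝ → ℝ} (hφ : ContDiff ℝ (⊤ : ℕ∞) φ) {ε : ℝ} (hε : ε ≠ 0) (z : EE n) :
    laplacian (fun z : EE n => φ (Lg ε z)) z =
      Real.exp (-Lg ε z) * (4 * deriv (deriv φ) (Lg ε z) + (2 * n - 4) * deriv φ (Lg ε z)) +
      ε ^ 2 * (Real.exp (-Lg ε z)) ^ 2 *
        (4 * deriv φ (Lg ε z) - 4 * deriv (deriv φ) (Lg ε z)) := by
  have hL := Lg_contDiff (n := n) hε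
  have hφ1 : ContDiff ℝ (⊤ : ℕ∞) (deriv φ) := by
    exact ((contDiff_infty_iff_deriv (𝕜 := ℝ)).1 hφ).2
  have d0 : ∀ t, HasDerivAt φ (deriv φ t) t := fun t =>
    ((hφ.differentiable (by simp)) t).hasDerivAt
  have d1 : ∀ t, HasDerivAt (deriv φ) (deriv (deriv φ) t) t := fun t =>
    ((hφ1.differentiable (by simp)) t).hasDerivAt
  have hLd : ∀ y : EE n, HasFDerivAt (Lg ε) ((‖y‖ ^ 2 + ε ^ 2)⁻¹ • (2 • innerSL ℝ y)) y := fun y =>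
    (hasFDerivAt_rho ε y).log (rho_pos hε y).ne'
  have hcd : ContDiff ℝ 2 (fun z : EE n => φ (Lg ε z)) := (hφ.comp hL).of_le two_le_top'
  rw [lap_eq_sum' hcd]
  have key : ∀ i : Fin n, fderiv ℝ (fun y => fderiv ℝ (fun z : EE n => φ (Lg ε z)) y
      (EuclideanSpace.single i 1)) z (EuclideanSpace.single i 1) =
      deriv (deriv φ) (Lg ε z) * (2 * inner ℝ z (EuclideanSpace.single i (1 : ℝ)) *
        (‖z‖ ^ 2 + ε ^ 2)⁻¹) ^ 2 +
      deriv φ (Lg ε z) * (2 * (‖z‖ ^ 2 + ε ^ 2)⁻¹ -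
        4 * (inner ℝ z (EuclideanSpace.single i (1 : ℝ))) ^ 2 * ((‖z‖ ^ 2 + ε ^ 2)⁻¹) ^ 2) := by
    intro i
    set v : EE n := EuclideanSpace.single i 1 with hv
    have e1 : (fun y => fderiv ℝ (fun z : EE n => φ (Lg ε z)) y v) =
        fun y => deriv φ (Lg ε y) * ((‖y‖ ^ 2 + ε ^ 2)⁻¹ * (2 * inner ℝ y v)) := by
      funext y
      have := ((d0 (Lg ε y)).comp_hasFDerivAt y (hLd y)).fderiv
      rw [show (fun z : EE n => φ (Lg ε z)) = φ ∘ Lg ε from rfl, this]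
      simp
    rw [e1]
    have g1 : HasFDerivAt (fun y : EE n => deriv φ (Lg ε y)) _ z :=
      (d1 (Lg ε z)).comp_hasFDerivAt z (hLd z)
    have g2 : HasFDerivAt (fun y : EE n => (‖y‖ ^ 2 + ε ^ 2)⁻¹) _ z :=
      (hasDerivAt_inv (rho_pos hε z).ne').comp_hasFDerivAt z (hasFDerivAt_rho ε z)
    have g3 : HasFDerivAt (fun y : EE n => 2 * inner ℝ y v) ((2 : ℝ) • innerSL ℝ v) z := by
      have : HasFDerivAt (fun y : EE n => (innerSL ℝ v) y) (innerSL ℝ v) z :=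
        (innerSL ℝ v).hasFDerivAt
      have h := this.const_mul (2 : ℝ)
      refine h.congr_of_eventuallyEq (Eventually.of_forall fun y => ?_)
      simp [real_inner_comm]
    have hvv : inner ℝ v v = (1 : ℝ) := by
      simp [hv]
    have g4 : HasFDerivAt (fun y : EE n => deriv φ (Lg ε y) *
        ((‖y‖ ^ 2 + ε ^ 2)⁻¹ * (2 * inner ℝ y v))) _ z := g1.mul (g2.mul g3)
    rw [g4.fderiv]
    simp only [ContinuousLinearMap.add_apply, ContinuousLinearMap.smul_apply, innerSL_apply_apply,
      smul_eq_mul, hvv, nsmul_eq_mul, ContinuousLinearMap.coe_smul', Pi.smul_apply]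
    have hne := (rho_pos hε z).ne'
    push_cast
    field_simp
    ring
  rw [Finset.sum_congr rfl fun i _ => key i]
  have hne := (rho_pos hε z).ne'
  have hexp : Real.exp (-Lg ε z) = (‖z‖ ^ 2 + ε ^ 2)⁻¹ := by
    rw [Real.exp_neg, Lg, Real.exp_log (rho_pos hε z)]
  rw [hexp]
  simp only [mul_pow, Finset.sum_add_distrib, ← Finset.mul_sum, ← Finset.sum_mul,
    Finset.sum_sub_distrib, sum_inner_sq]
  simp only [Finset.sum_const, Finset.card_univ, Fintype.card_fin, nsmul_eq_mul]
  field_simp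
  ring

/-- basic operators on profiles -/
noncomputable def opT (m : ℕ) (φ : ℝ → ℝ) (τ : ℝ) : ℝ :=
  -(Real.exp (-τ) * (4 * deriv (deriv φ) τ + (4 * m - 4) * deriv φ τ))

noncomputable def opS (φ : ℝ → ℝ) (τ : ℝ) : ℝ :=
  (Real.exp (-τ)) ^ 2 * (4 * deriv (deriv φ) τ - 4 * deriv φ τ)

lemma cd_deriv {φ : ℝ → ℝ} (hφ : ContDiff ℝ (⊤ : ℕ∞) φ) : ContDiff ℝ (⊤ : ℕ∞) (deriv φ) :=
  ((contDiff_infty_iff_deriv (𝕜 := ℝ)).1 hφ).2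

lemma opT_cd (m : ℕ) {φ : ℝ → ℝ} (hφ : ContDiff ℝ (⊤ : ℕ∞) φ) :
    ContDiff ℝ (⊤ : ℕ∞) (opT m φ) := by
  have h1 := cd_deriv hφ
  have h2 := cd_deriv h1
  unfold opT
  fun_prop

lemma opS_cd {φ : ℝ → ℝ} (hφ : ContDiff ℝ (⊤ : ℕ∞) φ) :
    ContDiff ℝ (⊤ : ℕ∞) (opS φ) := by
  have h1 := cd_deriv hφ
  have h2 := cd_deriv h1
  unfold opS
  fun_prop

noncomputable def kap (τ : ℝ) : ℝ := -τ / 2 * Real.smoothTransition (1 - τ)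

lemma kap_cd : ContDiff ℝ (⊤ : ℕ∞) kap := by
  unfold kap
  have : ContDiff ℝ (⊤ : ℕ∞) (fun τ : ℝ => Real.smoothTransition (1 - τ)) :=
    Real.smoothTransition.contDiff.comp (contDiff_const.sub contDiff_id)
  fun_prop

lemma kap_neg {τ : ℝ} (h : τ ≤ 0) : kap τ = -τ / 2 := by
  unfold kap
  rw [Real.smoothTransition.one_of_one_le (by linarith), mul_one]

lemma kap_big {τ : ℝ} (h : 1 ≤ τ) : kap τ = 0 := by
  unfold kap
  rw [Real.smoothTransition.zero_of_nonpos (by linarith), mul_zero]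

noncomputable def phi (m : ℕ) : ℕ → ℕ → ℝ → ℝ
  | 0, 0 => kap
  | 0, _ + 1 => fun _ => 0
  | i + 1, 0 => opT m (phi m i 0)
  | i + 1, j + 1 => fun τ => opT m (phi m i (j + 1)) τ + opS (phi m i j) τ

lemma phi_ss (m i j : ℕ) (τ : ℝ) : phi m (i + 1) (j + 1) τ =
    opT m (phi m i (j + 1)) τ + opS (phi m i j) τ := by rw [phi]

lemma phi_cd (m i j : ℕ) : ContDiff ℝ (⊤ : ℕ∞) (phi m i j) := by
  induction i generalizing j with
  | zero => cases j with
    | zero => rw [phi]; exact kap_cd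
    | succ j => rw [phi]; exact contDiff_const
  | succ i ih => cases j with
    | zero => rw [phi]; exact opT_cd m (ih 0)
    | succ j => rw [phi]; exact (opT_cd m (ih (j + 1))).add (opS_cd (ih j))

lemma ev_deriv {φ ψ : ℝ → ℝ} {s : Set ℝ} (hs : IsOpen s) (h : ∀ τ ∈ s, φ τ = ψ τ) :
    ∀ τ ∈ s, deriv φ τ = deriv ψ τ := by
  intro τ hτ
  apply Filter.EventuallyEq.deriv_eq
  filter_upwards [hs.mem_nhds hτ] with x hx using h x hx

lemma opT_congr (m : ℕ) {φ ψ : ℝ → ℝ} {s : Set ℝ} (hs : IsOpen s) (h : ∀ τ ∈ s, φ τ = ψ τ) :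
    ∀ τ ∈ s, opT m φ τ = opT m ψ τ := by
  intro τ hτ
  have h1 := ev_deriv hs h
  have h2 := ev_deriv hs h1
  unfold opT
  rw [h1 τ hτ, h2 τ hτ]

lemma opS_congr {φ ψ : ℝ → ℝ} {s : Set ℝ} (hs : IsOpen s) (h : ∀ τ ∈ s, φ τ = ψ τ) :
    ∀ τ ∈ s, opS φ τ = opS ψ τ := by
  intro τ hτ
  have h1 := ev_deriv hs h
  have h2 := ev_deriv hs h1
  unfold opS
  rw [h1 τ hτ, h2 τ hτ]

lemma opT_zero (m : ℕ) (τ : ℝ) : opT m (fun _ => 0) τ = 0 := by simp [opT]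
lemma opS_zero (τ : ℝ) : opS (fun _ => 0) τ = 0 := by simp [opS]

lemma phi_gt (m i j : ℕ) (h : i < j) : phi m i j = fun _ => 0 := by
  induction i generalizing j with
  | zero => cases j with
    | zero => omega
    | succ j => rw [phi]
  | succ i ih => cases j with
    | zero => omega
    | succ j =>
      rw [phi, ih (j + 1) (by omega), ih j (by omega)]
      funext τ
      rw [opT_zero, opS_zero, add_zero]

lemma phi_big (m i j : ℕ) : ∀ τ ∈ Set.Ioi (1 : ℝ), phi m i j τ = 0 := by
  induction i generalizing j with
  | zero => cases j with
    | zero => intro τ hτ; rw [phi]; exact kap_big (le_of_lt hτ)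
    | succ j => intro τ hτ; rw [phi]
  | succ i ih => cases j with
    | zero =>
      intro τ hτ; rw [phi, opT_congr m isOpen_Ioi (ih 0) τ hτ, opT_zero]
    | succ j =>
      intro τ hτ
      rw [phi_ss, opT_congr m isOpen_Ioi (ih (j+1)) τ hτ, opT_zero,
        opS_congr isOpen_Ioi (ih j) τ hτ, opS_zero, add_zero]

lemma deriv_exp_lin (c a τ : ℝ) : deriv (fun τ : ℝ => c * Real.exp (a * τ)) τ =
    (c * a) * Real.exp (a * τ) := by
  have h := (((hasDerivAt_id τ).const_mul a).exp).const_mul c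
  have h2 := h.deriv
  simp only [id] at h2
  rw [h2]; ring

lemma opT_exp (m : ℕ) (c a τ : ℝ) : opT m (fun τ => c * Real.exp (a * τ)) τ =
    (-4 * c * a * (a + m - 1)) * Real.exp ((a - 1) * τ) := by
  unfold opT
  have h1 : deriv (fun τ : ℝ => c * Real.exp (a * τ)) = fun τ => (c * a) * Real.exp (a * τ) :=
    funext (deriv_exp_lin c a)
  rw [h1, deriv_exp_lin]
  have : Real.exp ((a - 1) * τ) = Real.exp (-τ) * Real.exp (a * τ) := by
    rw [← Real.exp_add]; ring_nf
  rw [this]; ring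

lemma opS_exp (c a τ : ℝ) : opS (fun τ => c * Real.exp (a * τ)) τ =
    (4 * c * a * (a - 1)) * Real.exp ((a - 2) * τ) := by
  unfold opS
  have h1 : deriv (fun τ : ℝ => c * Real.exp (a * τ)) = fun τ => (c * a) * Real.exp (a * τ) :=
    funext (deriv_exp_lin c a)
  rw [h1, deriv_exp_lin]
  have : Real.exp ((a - 2) * τ) = Real.exp (-τ) ^ 2 * Real.exp (a * τ) := by
    rw [← Real.exp_nat_mul, ← Real.exp_add]; ring_nf
  rw [this]; ring

/-- closed-form coefficients -/
noncomputable def Acoef (m i j : ℕ) : ℝ :=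
  (Nat.choose i j) * (Nat.factorial (i + j - 1)) *
    ∏ l ∈ Finset.Ico (j + 1) (i + 1), ((m : ℝ) - l)

lemma phi_neg (m i j : ℕ) : ∀ τ ∈ Set.Iio (0 : ℝ), phi m (i + 1) j τ =
    (1 / 2 * 4 ^ (i + 1) * Acoef m (i + 1) j) * Real.exp ((-((i : ℝ) + 1 + j)) * τ) := by
  have hk : ∀ τ ∈ Set.Iio (0 : ℝ), kap τ = (-1/2) * τ := fun τ hτ => by
    rw [kap_neg (le_of_lt hτ)]; ring
  have hd1 : deriv (fun τ : ℝ => (-1/2) * τ) = fun _ => (-1/2 : ℝ) := by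
    funext τ; simpa using ((hasDerivAt_id τ).const_mul (-1/2 : ℝ)).deriv
  induction i generalizing j with
  | zero =>
    match j with
    | 0 =>
      intro τ hτ
      rw [phi, phi, opT_congr m isOpen_Iio hk τ hτ]
      simp only [opT, hd1]
      simp [Acoef]; ring
    | 1 =>
      intro τ hτ
      rw [phi_ss, phi, phi, opS_congr isOpen_Iio hk τ hτ, opT_zero]
      simp only [opS, hd1]
      rw [← Real.exp_nat_mul]
      simp [Acoef]; norm_num; ring
    | j + 2 =>
      intro τ hτ
      rw [phi_gt _ _ _ (by omega)]
      simp [Acoef, Nat.choose_eq_zero_of_lt]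
  | succ i ih =>
    cases j with
    | zero =>
      intro τ hτ
      rw [phi, opT_congr m isOpen_Iio (ih 0) τ hτ, opT_exp]
      have e : (-((i : ℝ) + 1 + (0 : ℕ)) - 1) = (-(((i + 1 : ℕ) : ℝ) + 1 + (0 : ℕ))) := by
        push_cast; ring
      rw [e]
      congr 1
      unfold Acoef
      rw [Finset.prod_Ico_succ_top (by omega : 0 + 1 ≤ i + 1 + 1)]
      have f1 : i + 1 + 0 - 1 = i := by omega
      have f2 : i + 1 + 1 + 0 - 1 = i + 1 := by omega
      rw [f1, f2, Nat.factorial_succ]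
      simp only [Nat.choose_zero_right]
      push_cast
      ring
    | succ j =>
      intro τ hτ
      rw [phi_ss, opT_congr m isOpen_Iio (ih (j+1)) τ hτ, opT_exp,
        opS_congr isOpen_Iio (ih j) τ hτ, opS_exp]
      have e : (-((i : ℝ) + 1 + (j + 1 : ℕ)) - 1) = (-(((i + 1 : ℕ) : ℝ) + 1 + (j + 1 : ℕ))) := by
        push_cast; ring
      have e' : (-((i : ℝ) + 1 + (j : ℕ)) - 2) = (-(((i + 1 : ℕ) : ℝ) + 1 + (j + 1 : ℕ))) := by
        push_cast; ring
      rw [e, e', ← add_mul]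
      congr 1
      rcases lt_or_ge (i + 1) (j + 1) with hlt | hge
      · rcases Nat.lt_or_ge (i + 1 + 1) (j + 1) with h2 | h2
        · unfold Acoef
          rw [Nat.choose_eq_zero_of_lt (by omega : i + 1 < j + 1),
            Nat.choose_eq_zero_of_lt (by omega : i + 1 < j),
            Nat.choose_eq_zero_of_lt (by omega : i + 1 + 1 < j + 1)]
          simp
        · obtain rfl : j = i + 1 := by omega
          unfold Acoef
          rw [Nat.choose_eq_zero_of_lt (by omega : i + 1 < i + 1 + 1), Nat.choose_self,
            Nat.choose_self]
          have f1 : i + 1 + (i + 1) - 1 = 2 * i + 1 := by omega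
          have f2 : i + 1 + 1 + (i + 1 + 1) - 1 = 2 * i + 1 + 1 + 1 := by omega
          rw [f1, f2, Nat.factorial_succ (2 * i + 1 + 1), Nat.factorial_succ (2 * i + 1)]
          simp
          ring
      · unfold Acoef
        rw [Finset.prod_Ico_succ_top (by omega : j + 1 + 1 ≤ i + 1 + 1),
          Finset.prod_eq_prod_Ico_succ_bot (by omega : j + 1 < i + 1 + 1)]
        have f1 : i + 1 + (j + 1) - 1 = i + j + 1 := by omega
        have f2 : i + 1 + j - 1 = i + j := by omega
        have f3 : i + 1 + 1 + (j + 1) - 1 = i + j + 1 + 1 := by omega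
        rw [f1, f2, f3, Nat.factorial_succ (i + j + 1), Nat.factorial_succ (i + j)]
        have c1 : ((Nat.choose (i + 1 + 1) (j + 1) : ℕ) : ℝ) =
            Nat.choose (i + 1) j + Nat.choose (i + 1) (j + 1) := by
          rw [Nat.choose_succ_succ]; push_cast; ring
        have c2 : ((Nat.choose (i + 1) (j + 1) : ℕ) : ℝ) * (j + 1) =
            Nat.choose (i + 1) j * ((i : ℝ) + 1 - j) := by
          have := Nat.choose_succ_right_eq (i + 1) j
          have h3 : ((i + 1 - j : ℕ) : ℝ) = (i : ℝ) + 1 - j := by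
            rw [Nat.cast_sub (by omega)]; push_cast; ring
          rw [← h3]
          exact_mod_cast this
        rw [c1]
        push_cast
        generalize (∏ l ∈ Finset.Ico (j + 1 + 1) (i + 1 + 1), ((m : ℝ) - l)) = P
        generalize ((Nat.choose (i + 1) (j + 1) : ℕ) : ℝ) = a at *
        generalize ((Nat.choose (i + 1) j : ℕ) : ℝ) = b at *
        generalize ((Nat.factorial (i + j) : ℕ) : ℝ) = fa
        linear_combination (-(1 / 2 * 4 ^ (i + 2) * fa * (i + j + 1) * (i + j + 2) * P)) * c2

end

section
set_option linter.all false
open MeasureTheory Real Filter Metric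
open scoped ENNReal Topology

lemma deriv_lin_sum (N : ℕ) (c : ℕ → ℝ) (φ : ℕ → ℝ → ℝ) (h : ∀ j, ContDiff ℝ (⊤ : ℕ∞) (φ j)) :
    deriv (fun τ => ∑ j ∈ Finset.range N, c j * φ j τ) =
      fun τ => ∑ j ∈ Finset.range N, c j * deriv (φ j) τ := by
  funext τ
  have : HasDerivAt (fun τ => ∑ j ∈ Finset.range N, c j * φ j τ)
      (∑ j ∈ Finset.range N, c j * deriv (φ j) τ) τ := by
    refine HasDerivAt.fun_sum fun j _ => ?_
    exact (((h j).differentiable (by simp)) τ).hasDerivAt.const_mul (c j)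
  exact this.deriv

lemma negLapIter_radial {n m : ℕ} (hn : n = 2 * m) {ε : ℝ} (hε : ε ≠ 0) (i : ℕ) :
    negLapIter i (fun z : EE n => kap (Lg ε z)) = fun z =>
      ∑ j ∈ Finset.range (i + 1), ε ^ (2 * j) * phi m i j (Lg ε z) := by
  induction i with
  | zero =>
    rw [negLapIter_zero]; funext z; simp [phi]
  | succ i ih =>
    rw [negLapIter_succ, ih]
    funext z
    have hs : ContDiff ℝ (⊤ : ℕ∞)
        (fun τ => ∑ j ∈ Finset.range (i + 1), ε ^ (2 * j) * phi m i j τ) :=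
      ContDiff.sum fun j _ => contDiff_const.mul (phi_cd m i j)
    rw [lap_radial hs hε, deriv_lin_sum _ _ _ (phi_cd m i),
      deriv_lin_sum _ _ _ (fun j => cd_deriv (phi_cd m i j))]
    rw [Finset.sum_range_succ' _ (i + 1)]
    simp_rw [phi_ss, mul_add (ε ^ _), Finset.sum_add_distrib]
    have h0 : ∑ j ∈ Finset.range (i + 1), ε ^ (2 * (j + 1)) * opT m (phi m i (j + 1)) (Lg ε z) +
        ε ^ (2 * 0) * phi m (i + 1) 0 (Lg ε z) =
        ∑ j ∈ Finset.range (i + 1), ε ^ (2 * j) * opT m (phi m i j) (Lg ε z) := by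
      have := Finset.sum_range_succ' (fun j => ε ^ (2 * j) * opT m (phi m i j) (Lg ε z)) (i + 1)
      rw [phi, ← this, Finset.sum_range_succ, phi_gt m i (i + 1) (by omega), opT_zero]
      simp
    rw [add_right_comm (∑ j ∈ Finset.range (i + 1), ε ^ (2 * (j + 1)) * opT m (phi m i (j + 1)) (Lg ε z)), h0]
    simp only [opT, opS, hn]
    push_cast
    simp only [Finset.mul_sum, ← Finset.sum_sub_distrib, ← Finset.sum_add_distrib,
      ← Finset.sum_neg_distrib]
    refine Finset.sum_congr rfl fun j _ => ?_
    ring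

lemma kap_abs_le {τ : ℝ} (σ : ℝ) (h : σ ≤ τ) : |kap τ| ≤ |σ| + 1 := by
  rcases le_or_gt 1 τ with h1 | h1
  · rw [kap_big h1, abs_zero]; positivity
  · unfold kap
    rw [abs_mul, abs_of_nonneg (Real.smoothTransition.nonneg _)]
    have h2 := Real.smoothTransition.le_one (1 - τ)
    have h3 : |(-τ / 2)| ≤ |σ| + 1 := by
      rw [abs_le]; constructor
      · linarith [abs_nonneg σ]
      · linarith [neg_abs_le σ, abs_nonneg σ]
    calc |(-τ / 2)| * Real.smoothTransition (1 - τ) ≤ |(-τ / 2)| * 1 :=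
          mul_le_mul_of_nonneg_left h2 (abs_nonneg _)
      _ ≤ _ := by linarith

lemma phi_top_lt (m j : ℕ) (hm : 1 ≤ m) (h : j < m) : ∀ τ ≤ 0, phi m m j τ = 0 := by
  obtain ⟨i, rfl⟩ : ∃ i, m = i + 1 := ⟨m - 1, by omega⟩
  have h0 : ∀ τ ∈ Set.Iio (0 : ℝ), phi (i + 1) (i + 1) j τ = 0 := by
    intro τ hτ
    rw [phi_neg _ _ _ τ hτ]
    have : Acoef (i + 1) (i + 1) j = 0 := by
      unfold Acoef
      have : ∏ l ∈ Finset.Ico (j + 1) (i + 1 + 1), (((i + 1 : ℕ) : ℝ) - l) = 0 :=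
        Finset.prod_eq_zero (i := i + 1) (by simp; omega) (by simp)
      rw [this, mul_zero]
    rw [this]; simp
  intro τ hτ
  have hc : IsClosed {τ : ℝ | phi (i + 1) (i + 1) j τ = 0} :=
    isClosed_eq (phi_cd _ _ _).continuous continuous_const
  have hsub : Set.Iic (0 : ℝ) ⊆ {τ : ℝ | phi (i + 1) (i + 1) j τ = 0} := by
    rw [← closure_Iio]
    exact hc.closure_subset_iff.2 h0
  exact hsub hτ

noncomputable def Bc (m : ℕ) : ℝ := 1 / 2 * 4 ^ m * (Nat.factorial (2 * m - 1))

lemma phi_top_eq (m : ℕ) (hm : 1 ≤ m) : ∀ τ < 0, phi m m m τ = Bc m * Real.exp (-(2 * m) * τ) := by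
  obtain ⟨i, rfl⟩ : ∃ i, m = i + 1 := ⟨m - 1, by omega⟩
  intro τ hτ
  rw [phi_neg _ _ _ τ hτ]
  have : Acoef (i + 1) (i + 1) (i + 1) = (Nat.factorial (2 * (i + 1) - 1)) := by
    unfold Acoef
    have h : i + 1 + (i + 1) - 1 = 2 * (i + 1) - 1 := by omega
    rw [h]; simp
  rw [this, Bc]
  congr 2
  push_cast; ring

lemma phi_top_bound (m : ℕ) (hm : 1 ≤ m) : ∃ C : ℝ, 0 ≤ C ∧ ∀ τ, |phi m m m τ| ≤
    C * Real.exp (-(2 * m) * τ) := by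
  obtain ⟨C, hC⟩ := (isCompact_Icc (a := (0 : ℝ)) (b := 1)).exists_bound_of_continuousOn
    (phi_cd m m m).continuous.continuousOn
  have hC0 : 0 ≤ C := (norm_nonneg _).trans (hC 0 (by simp))
  have hB : 0 ≤ Bc m := by unfold Bc; positivity
  refine ⟨Bc m + C * Real.exp (2 * m), by positivity, fun τ => ?_⟩
  rcases lt_or_ge τ 0 with h | h
  · rw [phi_top_eq m hm τ h, abs_of_nonneg (by positivity)]
    refine mul_le_mul_of_nonneg_right ?_ (Real.exp_pos _).le
    have : 0 ≤ C * Real.exp (2 * m) := by positivity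
    linarith
  · rcases le_or_gt τ 1 with h1 | h1
    · have := hC τ ⟨h, h1⟩
      rw [Real.norm_eq_abs] at this
      refine this.trans ?_
      rw [add_mul, mul_assoc, ← Real.exp_add]
      have e1 : 1 ≤ Real.exp (2 * m + -(2 * m) * τ) := by
        apply Real.one_le_exp
        have : (m : ℝ) * τ ≤ m := by
          have : (0 : ℝ) ≤ m := by positivity
          nlinarith
        linarith
      have e2 : 0 ≤ Bc m * Real.exp (-(2 * m) * τ) := by positivity
      nlinarith
    · rw [phi_big m m m τ h1, abs_zero]
      positivity

lemma phi_bdd (m j : ℕ) (hm : 1 ≤ m) (h : j < m) : ∃ C : ℝ, 0 ≤ C ∧ ∀ τ, |phi m m j τ| ≤ C := by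
  obtain ⟨C, hC⟩ := (isCompact_Icc (a := (0 : ℝ)) (b := 1)).exists_bound_of_continuousOn
    (phi_cd m m j).continuous.continuousOn
  have hC0 : 0 ≤ C := (norm_nonneg _).trans (hC 0 (by simp))
  refine ⟨C, hC0, fun τ => ?_⟩
  rcases le_or_gt τ 0 with h0 | h0
  · rw [phi_top_lt m j hm h τ h0, abs_zero]; exact hC0
  · rcases le_or_gt τ 1 with h1 | h1
    · exact hC τ ⟨h0.le, h1⟩
    · rw [phi_big m m j τ h1, abs_zero]; exact hC0

/-- `1/‖z‖` and `log‖z‖` are integrable on balls. -/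
lemma inv_norm_intOn {n : ℕ} (hn : 2 ≤ n) (R : ℝ) :
    IntegrableOn (fun z : EE n => ‖z‖⁻¹) (ball 0 R) := by
  have : Nonempty (Fin n) := ⟨⟨0, by omega⟩⟩
  refine (integrableOn_fun_norm_addHaar (volume : Measure (EE n)) (f := fun r : ℝ => r⁻¹)).2 ?_
  have h1 : IntegrableOn (fun y : ℝ => y ^ (n - 2)) (Set.Ioo 0 R) :=
    ((continuous_pow (n - 2)).integrableOn_Icc (a := 0) (b := R)).mono_set Set.Ioo_subset_Icc_self
  refine h1.congr_fun ?_ measurableSet_Ioo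
  intro y hy
  have hy0 : y ≠ 0 := hy.1.ne'
  have : n - 1 = (n - 2) + 1 := by omega
  simp only [finrank_euclideanSpace, Fintype.card_fin, smul_eq_mul]
  rw [this, pow_succ]
  field_simp

lemma abs_log_le_add_inv {t : ℝ} (ht : 0 < t) : |Real.log t| ≤ t + t⁻¹ := by
  have h1 := Real.log_le_sub_one_of_pos ht
  have h2 := Real.log_le_sub_one_of_pos (inv_pos.2 ht)
  rw [Real.log_inv] at h2
  have : 0 < t⁻¹ := inv_pos.2 ht
  rw [abs_le]; constructor <;> linarith

lemma norm_intOn {n : ℕ} (R : ℝ) : IntegrableOn (fun z : EE n => ‖z‖) (ball 0 R) :=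
  (continuous_norm.continuousOn.integrableOn_compact (isCompact_closedBall (0 : EE n) R)).mono_set
    ball_subset_closedBall

lemma ae_ne_zero {n : ℕ} (hn : 2 ≤ n) : ∀ᵐ z : EE n, z ≠ 0 := by
  have : Nonempty (Fin n) := ⟨⟨0, by omega⟩⟩
  exact Measure.ae_ne volume 0

lemma log_norm_intOn {n : ℕ} (hn : 2 ≤ n) (R : ℝ) :
    IntegrableOn (fun z : EE n => |Real.log (‖z‖ ^ 2)|) (ball 0 R) := by
  have h := ((norm_intOn (n := n) R).add (inv_norm_intOn hn R)).const_mul 2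
  refine Integrable.mono' h ?_ ?_
  · have : Measurable (fun z : EE n => |Real.log (‖z‖ ^ 2)|) := by fun_prop
    exact this.aestronglyMeasurable
  · filter_upwards [ae_restrict_of_ae (ae_ne_zero hn)] with z hz
    have := abs_log_le_add_inv (norm_pos_iff.2 hz)
    rw [Real.norm_eq_abs, abs_abs, Real.log_pow, abs_mul]
    simp only [Nat.cast_ofNat, Nat.abs_ofNat, Pi.add_apply]
    linarith

lemma Lg_big {n : ℕ} (ε : ℝ) {z : EE n} (hz : 2 ≤ ‖z‖) : 1 < Lg ε z := by
  unfold Lg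
  rw [Real.lt_log_iff_exp_lt (by positivity)]
  have := Real.exp_one_lt_d9
  nlinarith [sq_nonneg ε]

lemma Lg_ge {n : ℕ} (ε : ℝ) {z : EE n} (hz : z ≠ 0) : Real.log (‖z‖ ^ 2) ≤ Lg ε z := by
  unfold Lg
  have := norm_pos_iff.2 hz
  exact Real.log_le_log (by positivity) (by nlinarith [sq_nonneg ε])

lemma Lg_tendsto {n : ℕ} {z : EE n} (hz : z ≠ 0) :
    Tendsto (fun ε : ℝ => Lg ε z) (𝓝[>] 0) (𝓝 (Lg 0 z)) := by
  have := norm_pos_iff.2 hz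
  refine tendsto_nhdsWithin_of_tendsto_nhds ?_
  have : ContinuousAt (fun ε : ℝ => Lg ε z) 0 := by
    unfold Lg
    refine ContinuousAt.log (by fun_prop) ?_
    positivity
  exact this

lemma Lg_measurable {n : ℕ} (ε : ℝ) : Measurable (Lg (n := n) ε) := by
  unfold Lg; fun_prop

lemma bdd_on_ball {n : ℕ} {g : EE n → ℝ} (hg : Continuous g) (R : ℝ) :
    ∃ M, 0 ≤ M ∧ ∀ z, ‖z‖ ≤ R → |g z| ≤ M := by
  obtain ⟨M, hM⟩ := (isCompact_closedBall (0 : EE n) R).exists_bound_of_continuousOn hg.continuousOn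
  refine ⟨max M 0, le_max_right _ _, fun z hz => (hM z (by simpa using hz)).trans (le_max_left _ _)⟩

lemma lim_A {n : ℕ} (hn : 2 ≤ n) {G : EE n → ℝ} (hG : Continuous G) :
    Tendsto (fun ε : ℝ => ∫ z, kap (Lg ε z) * G z) (𝓝[>] 0) (𝓝 (∫ z, kap (Lg 0 z) * G z)) := by
  obtain ⟨M, hM0, hM⟩ := bdd_on_ball hG 2
  refine tendsto_integral_filter_of_dominated_convergence
    ((ball 0 2).indicator fun z => (|Real.log (‖z‖ ^ 2)| + 1) * M) ?_ ?_ ?_ ?_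
  · refine Eventually.of_forall fun ε => ?_
    exact ((kap_cd.continuous.measurable.comp (Lg_measurable ε)).mul
      hG.measurable).aestronglyMeasurable
  · refine Eventually.of_forall fun ε => ?_
    filter_upwards [ae_ne_zero hn] with z hz
    by_cases h : z ∈ ball (0 : EE n) 2
    · rw [Set.indicator_of_mem h, norm_mul]
      have h2 : ‖z‖ < 2 := by simpa using h
      exact mul_le_mul (kap_abs_le _ (Lg_ge ε hz)) (hM z h2.le) (abs_nonneg _) (by positivity)
    · rw [Set.indicator_of_notMem h]
      have h2 : 2 ≤ ‖z‖ := by simpa using h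
      rw [kap_big (Lg_big ε h2).le]; simp
  · rw [integrable_indicator_iff measurableSet_ball]
    refine Integrable.mul_const ?_ _
    exact (log_norm_intOn hn 2).add (integrableOn_const (by finiteness))
  · filter_upwards [ae_ne_zero hn] with z hz
    exact ((kap_cd.continuous.tendsto _).comp (Lg_tendsto hz)).mul_const _

lemma lim_B {n m : ℕ} (hn : 2 ≤ n) (hm : 1 ≤ m) (j : ℕ) (hj : j < m) {G : EE n → ℝ}
    (hG : Continuous G) :
    Tendsto (fun ε : ℝ => ∫ z, ε ^ (2 * j) * phi m m j (Lg ε z) * G z) (𝓝[>] 0)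
      (𝓝 (∫ z, 0 ^ (2 * j) * phi m m j (Lg 0 z) * G z)) := by
  obtain ⟨M, hM0, hM⟩ := bdd_on_ball hG 2
  obtain ⟨C, hC0, hC⟩ := phi_bdd m j hm hj
  refine tendsto_integral_filter_of_dominated_convergence
    ((ball 0 2).indicator fun z => C * M) ?_ ?_ ?_ ?_
  · refine Eventually.of_forall fun ε => ?_
    exact ((((phi_cd m m j).continuous.measurable.comp (Lg_measurable ε)).const_mul _).mul
      hG.measurable).aestronglyMeasurable
  · filter_upwards [Ioo_mem_nhdsGT (zero_lt_one' ℝ)] with ε hε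
    filter_upwards with z
    by_cases h : z ∈ ball (0 : EE n) 2
    · rw [Set.indicator_of_mem h, norm_mul, norm_mul]
      have h2 : ‖z‖ < 2 := by simpa using h
      refine mul_le_mul ?_ (hM z h2.le) (abs_nonneg _) (by positivity)
      have h3 : ‖ε ^ (2 * j)‖ ≤ 1 := by
        rw [norm_pow, Real.norm_eq_abs, abs_of_pos hε.1]
        exact pow_le_one₀ hε.1.le hε.2.le
      calc _ ≤ 1 * C := mul_le_mul h3 (hC _) (abs_nonneg _) zero_le_one
        _ = C := one_mul C
    · rw [Set.indicator_of_notMem h]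
      have h2 : 2 ≤ ‖z‖ := by simpa using h
      rw [phi_big _ _ _ _ (Lg_big ε h2)]; simp
  · rw [integrable_indicator_iff measurableSet_ball]
    exact integrableOn_const (by finiteness)
  · filter_upwards [ae_ne_zero hn] with z hz
    refine Tendsto.mul_const _ (Tendsto.mul ?_ (((phi_cd m m j).continuous.tendsto _).comp
      (Lg_tendsto hz)))
    exact tendsto_nhdsWithin_of_tendsto_nhds ((continuous_pow (2 * j)).tendsto 0)

/-- the bubble integral -/
noncomputable def bub (m n : ℕ) : ℝ := ∫ w : EE n, (1 + ‖w‖ ^ 2) ^ (-(4 * m : ℝ) / 2)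

lemma bub_int {n m : ℕ} (hn : n = 2 * m) (hm : 1 ≤ m) :
    Integrable (fun w : EE n => (1 + ‖w‖ ^ 2) ^ (-(4 * m : ℝ) / 2)) := by
  refine integrable_rpow_neg_one_add_norm_sq ?_
  simp [hn]
  have : (1 : ℝ) ≤ m := by exact_mod_cast hm
  linarith

lemma bub_pos {n m : ℕ} (hn : n = 2 * m) (hm : 1 ≤ m) : 0 < bub m n := by
  unfold bub
  rw [integral_pos_iff_support_of_nonneg (fun w => by positivity) (bub_int hn hm)]
  have : Function.support (fun w : EE n => (1 + ‖w‖ ^ 2) ^ (-(4 * m : ℝ) / 2)) = Set.univ := by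
    ext w; simp only [Function.mem_support, Set.mem_univ, iff_true]; positivity
  rw [this]
  exact Measure.measure_univ_pos.2 (NeZero.ne _)

lemma lim_C {n m : ℕ} (hn : n = 2 * m) (hm : 1 ≤ m) {G : EE n → ℝ} (hG : Continuous G) :
    Tendsto (fun ε : ℝ => ∫ z, ε ^ (2 * m) * phi m m m (Lg ε z) * G z) (𝓝[>] 0)
      (𝓝 (Bc m * bub m n * G 0)) := by
  obtain ⟨M, hM0, hM⟩ := bdd_on_ball hG 2
  obtain ⟨C, hC0, hC⟩ := phi_top_bound m hm
  have hb := bub_int hn hm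
  have hexp : ∀ (w : EE n) (ε : ℝ), 0 < ε → Real.exp (-(2 * m) * Lg ε (ε • w)) * ε ^ (4 * m) =
      (1 + ‖w‖ ^ 2) ^ (-(4 * m : ℝ) / 2) := by
    intro w ε hε
    have h1 : Lg ε (ε • w) = Real.log (ε ^ 2) + Real.log (1 + ‖w‖ ^ 2) := by
      rw [← Real.log_mul (by positivity) (by positivity), Lg, norm_smul, Real.norm_eq_abs,
        abs_of_pos hε]
      congr 1; ring
    rw [h1, Real.rpow_def_of_pos (by positivity), Real.log_pow]
    have h2 : ε ^ (4 * m) = Real.exp (4 * m * Real.log ε) := by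
      rw [← Real.exp_log hε, ← Real.exp_nat_mul, Real.log_exp]; push_cast; ring_nf
    rw [h2, ← Real.exp_add]
    congr 1; push_cast; ring
  have hch : ∀ ε : ℝ, 0 < ε → ∫ z, ε ^ (2 * m) * phi m m m (Lg ε z) * G z =
      ∫ w : EE n, ε ^ (4 * m) * phi m m m (Lg ε (ε • w)) * G (ε • w) := by
    intro ε hε
    have := Measure.integral_comp_smul (volume : Measure (EE n))
      (fun z => ε ^ (4 * m) * phi m m m (Lg ε z) * G z) ε
    rw [this]
    have hfr : Module.finrank ℝ (EE n) = 2 * m := by simp [hn]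
    rw [hfr, ← integral_smul]
    congr 1; funext z
    rw [abs_of_pos (by positivity), smul_eq_mul]
    have : ε ^ (4 * m) = ε ^ (2 * m) * ε ^ (2 * m) := by rw [← pow_add]; ring_nf
    rw [this]; field_simp
  have hlim : Tendsto (fun ε : ℝ => ∫ w : EE n, ε ^ (4 * m) * phi m m m (Lg ε (ε • w)) * G (ε • w))
      (𝓝[>] 0) (𝓝 (∫ w : EE n, Bc m * (1 + ‖w‖ ^ 2) ^ (-(4 * m : ℝ) / 2) * G 0)) := by
    refine tendsto_integral_filter_of_dominated_convergence
      (fun w => C * (1 + ‖w‖ ^ 2) ^ (-(4 * m : ℝ) / 2) * M) ?_ ?_ ((hb.const_mul C).mul_const M) ?_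
    · refine Eventually.of_forall fun ε => ?_
      have hs : Measurable (fun w : EE n => ε • w) := (continuous_const_smul ε).measurable
      exact ((((phi_cd m m m).continuous.measurable.comp ((Lg_measurable ε).comp hs)).const_mul
        _).mul (hG.measurable.comp hs)).aestronglyMeasurable
    · filter_upwards [self_mem_nhdsWithin] with ε hε
      filter_upwards with w
      have hε' : 0 < ε := hε
      rcases le_or_gt 2 ‖ε • w‖ with h | h
      · rw [phi_big _ _ _ _ (Lg_big ε h)]; simp; positivity
      · rw [norm_mul]
        refine mul_le_mul ?_ (hM _ h.le) (abs_nonneg _) (by positivity)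
        rw [norm_mul, Real.norm_eq_abs, Real.norm_eq_abs, abs_of_pos (by positivity : 0 < ε ^ (4 * m)),
          ← hexp w ε hε']
        calc ε ^ (4 * m) * |phi m m m (Lg ε (ε • w))| ≤
            ε ^ (4 * m) * (C * Real.exp (-(2 * m) * Lg ε (ε • w))) :=
              mul_le_mul_of_nonneg_left (hC _) (by positivity)
          _ = _ := by ring
    · filter_upwards with w
      have hsm : Tendsto (fun ε : ℝ => ε • w) (𝓝[>] 0) (𝓝 0) := by
        have : Continuous (fun ε : ℝ => ε • w) := by fun_prop
        have h := this.tendsto 0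
        rw [zero_smul] at h
        exact tendsto_nhdsWithin_of_tendsto_nhds h
      have hGt := (hG.tendsto 0).comp hsm
      refine Tendsto.mul ?_ hGt
      have hev : ∀ᶠ ε : ℝ in 𝓝[>] 0, ε ^ 2 * (1 + ‖w‖ ^ 2) < 1 := by
        have : Continuous (fun ε : ℝ => ε ^ 2 * (1 + ‖w‖ ^ 2)) := by fun_prop
        have h := this.tendsto 0
        refine (tendsto_nhdsWithin_of_tendsto_nhds h).eventually_lt_const ?_
        simp
      refine Tendsto.congr' ?_ tendsto_const_nhds
      filter_upwards [hev, self_mem_nhdsWithin] with ε h1 h2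
      have hε' : 0 < ε := h2
      have hneg : Lg ε (ε • w) < 0 := by
        unfold Lg
        apply Real.log_neg
        · positivity
        · rw [norm_smul, Real.norm_eq_abs, abs_of_pos hε']; linarith [h1]
      rw [phi_top_eq m hm _ hneg, ← hexp w ε hε']; ring
  rw [show Bc m * bub m n * G 0 = ∫ w : EE n, Bc m * (1 + ‖w‖ ^ 2) ^ (-(4 * m : ℝ) / 2) * G 0 by
    rw [integral_mul_const, integral_const_mul]; rfl]
  refine hlim.congr' ?_
  filter_upwards [self_mem_nhdsWithin] with ε hε using (hch ε hε).symm

/-- The smooth kernel -/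
noncomputable def PhiK (m n : ℕ) (z : EE n) : ℝ := - phi m m 0 (Lg 0 z)

lemma PhiK_supp {m n : ℕ} {z : EE n} (hz : 2 ≤ ‖z‖) : PhiK m n z = 0 := by
  unfold PhiK; rw [phi_big _ _ _ _ (Lg_big 0 hz), neg_zero]

lemma PhiK_hcs (m n : ℕ) : HasCompactSupport (PhiK m n) := by
  refine HasCompactSupport.of_support_subset_isCompact (isCompact_closedBall (0 : EE n) 2) ?_
  intro z hz
  by_contra h
  have : 2 ≤ ‖z‖ := by
    have : 2 < ‖z‖ := by simpa using h
    exact this.le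
  exact hz (PhiK_supp this)

lemma PhiK_cd {m n : ℕ} (hm : 1 ≤ m) : ContDiff ℝ (⊤ : ℕ∞) (PhiK m n) := by
  rw [contDiff_iff_contDiffAt]
  intro z
  by_cases hz : z = 0
  · have : PhiK m n =ᶠ[𝓝 z] fun _ => 0 := by
      subst hz
      filter_upwards [ball_mem_nhds (0 : EE n) one_pos] with y hy
      have hy1 : ‖y‖ < 1 := by simpa using hy
      unfold PhiK
      rw [phi_top_lt m 0 hm (by omega), neg_zero]
      unfold Lg
      apply Real.log_nonpos <;> nlinarith [norm_nonneg y]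
    exact contDiffAt_const.congr_of_eventuallyEq this
  · have h0 := norm_pos_iff.2 hz
    unfold PhiK Lg
    refine ContDiffAt.neg ((phi_cd m m 0).contDiffAt.comp z (ContDiffAt.log ?_ ?_))
    · exact ((contDiff_norm_sq ℝ).add contDiff_const).contDiffAt
    · positivity

lemma hcs_Lg {n : ℕ} (ε : ℝ) (φ : ℝ → ℝ) (h : ∀ τ ∈ Set.Ioi (1 : ℝ), φ τ = 0) :
    HasCompactSupport (fun z : EE n => φ (Lg ε z)) := by
  refine HasCompactSupport.of_support_subset_isCompact (isCompact_closedBall (0 : EE n) 2) ?_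
  intro z hz
  by_contra h'
  have : 2 ≤ ‖z‖ := by
    have : 2 < ‖z‖ := by simpa using h'
    exact this.le
  exact hz (h _ (Lg_big ε this))

lemma repr0 {n m : ℕ} (hn : n = 2 * m) (hm : 1 ≤ m) {g : EE n → ℝ} (hg : ContDiff ℝ (⊤ : ℕ∞) g) :
    Bc m * bub m n * g 0 = (∫ z, PhiK m n z * g z) + ∫ z, kap (Lg 0 z) * negLapIter m g z := by
  have hn2 : 2 ≤ n := by omega
  have hA := lim_A hn2 (contDiff_negLapIter hg m).continuous
  have hB := tendsto_finset_sum (Finset.range m) (fun j hj =>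
    lim_B hn2 hm j (Finset.mem_range.1 hj) hg.continuous)
  have hC := lim_C hn hm hg.continuous
  have hsum := hB.add hC
  have heq : ∀ ε : ℝ, ε ≠ 0 → ∫ z, kap (Lg ε z) * negLapIter m g z =
      ∑ j ∈ Finset.range m, (∫ z, ε ^ (2 * j) * phi m m j (Lg ε z) * g z) +
        ∫ z, ε ^ (2 * m) * phi m m m (Lg ε z) * g z := by
    intro ε hε
    have hKc : HasCompactSupport (fun z : EE n => kap (Lg ε z)) :=
      hcs_Lg ε kap fun τ hτ => kap_big (le_of_lt hτ)
    have hKs : ContDiff ℝ (⊤ : ℕ∞) (fun z : EE n => kap (Lg ε z)) :=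
      kap_cd.comp (Lg_contDiff hε)
    rw [ibp_iter hKs hKc hg m, negLapIter_radial hn hε]
    rw [← Finset.sum_range_succ (fun j => ∫ z, ε ^ (2 * j) * phi m m j (Lg ε z) * g z),
      ← integral_finsetSum]
    · congr 1; funext z; rw [Finset.sum_mul]
    · intro j _
      have h1 : HasCompactSupport (fun z : EE n => phi m m j (Lg ε z)) :=
        hcs_Lg ε _ (phi_big m m j)
      have h2 : Continuous (fun z : EE n => phi m m j (Lg ε z)) :=
        ((phi_cd m m j).comp (Lg_contDiff hε)).continuous
      have := (integrable_mul_cs h2 h1 hg.continuous).const_mul (ε ^ (2 * j))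
      refine this.congr (Eventually.of_forall fun z => ?_)
      simp only; ring
  have hA' := hA.congr' (f₂ := fun ε => ∑ j ∈ Finset.range m,
      (∫ z, ε ^ (2 * j) * phi m m j (Lg ε z) * g z) +
        ∫ z, ε ^ (2 * m) * phi m m m (Lg ε z) * g z) (by
    filter_upwards [self_mem_nhdsWithin] with ε hε using heq ε (ne_of_gt hε))
  have huniq := tendsto_nhds_unique hA' hsum
  rw [huniq]
  have hS : ∑ j ∈ Finset.range m, ∫ z, 0 ^ (2 * j) * phi m m j (Lg 0 z) * g z =
      - ∫ z, PhiK m n z * g z := by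
    rw [Finset.sum_eq_single 0]
    · rw [← integral_neg]; congr 1; funext z; simp [PhiK]
    · intro j _ hj
      simp [hj]
    · intro h; simp at h; omega
  rw [hS]; ring

end

section
set_option linter.all false
open MeasureTheory Real Filter Metric
open scoped ENNReal Topology

lemma kap_lip : ∃ K : NNReal, LipschitzWith K kap := by
  have hcd := cd_deriv kap_cd
  obtain ⟨C, hC⟩ := (isCompact_Icc (a := (0 : ℝ)) (b := 1)).exists_bound_of_continuousOn
    hcd.continuous.continuousOn
  have hC0 : 0 ≤ C := (norm_nonneg _).trans (hC 0 (by simp))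
  have h1 : ∀ τ ∈ Set.Iio (0 : ℝ), deriv kap τ = -1 / 2 := by
    intro τ hτ
    rw [ev_deriv isOpen_Iio (ψ := fun τ => (-1 / 2) * τ) (fun τ hτ => by
      rw [kap_neg (le_of_lt hτ)]; ring) τ hτ]
    simpa using ((hasDerivAt_id τ).const_mul (-1/2 : ℝ)).deriv
  have h2 : ∀ τ ∈ Set.Ioi (1 : ℝ), deriv kap τ = 0 := by
    intro τ hτ
    rw [ev_deriv isOpen_Ioi (ψ := fun τ => 0) (fun τ hτ => kap_big (le_of_lt hτ)) τ hτ]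
    simp
  refine ⟨Real.toNNReal (C + 1), lipschitzWith_of_nnnorm_deriv_le (kap_cd.differentiable (by simp)) ?_⟩
  intro τ
  rw [← NNReal.coe_le_coe, coe_nnnorm, Real.coe_toNNReal _ (by linarith)]
  rcases lt_or_ge τ 0 with h | h
  · rw [h1 τ h, Real.norm_eq_abs]; norm_num; linarith
  · rcases le_or_gt τ 1 with h' | h'
    · linarith [hC τ ⟨h, h'⟩]
    · rw [h2 τ h']; simp; linarith

noncomputable def Cm (m n : ℕ) : ℝ := Bc m * bub m n

lemma Cm_pos {n m : ℕ} (hn : n = 2 * m) (hm : 1 ≤ m) : 0 < Cm m n := by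
  have := bub_pos hn hm
  unfold Cm Bc; positivity

noncomputable def HH (m n : ℕ) (u : EE n → ℝ) (R : ℝ) (x : EE n) : ℝ :=
  ∫ z, PhiK m n z * u (x + R • z)

lemma repr1 {n m : ℕ} (hn : n = 2 * m) (hm : 1 ≤ m) {u f : EE n → ℝ} (hu : ContDiff ℝ (⊤ : ℕ∞) u)
    (hf : ∀ x, negLapIter m u x = 2 * f x) {R : ℝ} (hR : 0 < R) (x : EE n) :
    Cm m n * u x = HH m n u R x + 2 * ∫ y, kap (Lg 0 (R⁻¹ • (y - x))) * f y := by
  have hg : ContDiff ℝ (⊤ : ℕ∞) (fun z : EE n => u (x + R • z)) := by fun_prop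
  have h := repr0 hn hm hg
  simp only [smul_zero, add_zero] at h
  unfold Cm HH
  rw [h]
  congr 1
  have hch := Measure.integral_comp_smul (volume : Measure (EE n))
    (fun y => kap (Lg 0 (R⁻¹ • y)) * f (x + y)) R
  have htr : ∫ y, kap (Lg 0 (R⁻¹ • y)) * f (x + y) = ∫ y, kap (Lg 0 (R⁻¹ • (y - x))) * f y := by
    rw [← integral_add_left_eq_self (μ := volume) (fun y => kap (Lg 0 (R⁻¹ • (y - x))) * f y) x]
    simp
  rw [← htr]
  have hfr : Module.finrank ℝ (EE n) = 2 * m := by simp [hn]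
  rw [hfr, abs_of_pos (by positivity), smul_eq_mul] at hch
  have e : ∫ y, kap (Lg 0 (R⁻¹ • y)) * f (x + y) =
      R ^ (2 * m) * ∫ w, kap (Lg 0 (R⁻¹ • R • w)) * f (x + R • w) := by
    rw [hch]; field_simp
  rw [e, ← integral_const_mul, ← integral_const_mul]
  congr 1; funext w
  rw [negLapIter_affine hu, hf, smul_smul, inv_mul_cancel₀ hR.ne', one_smul]
  ring

noncomputable def lpot {n : ℕ} (f : EE n → ℝ) (x : EE n) : ℝ := ∫ y, Real.log (‖y‖ / ‖x - y‖) * f y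

lemma log_intOn {n : ℕ} (hn : 2 ≤ n) (x : EE n) (R : ℝ) :
    IntegrableOn (fun y : EE n => |Real.log ‖x - y‖|) (ball 0 R) := by
  have h0 : IntegrableOn (fun z : EE n => |Real.log ‖z‖|) (ball 0 (R + ‖x‖)) := by
    have := (log_norm_intOn hn (R + ‖x‖)).const_mul (1/2)
    refine this.congr (Eventually.of_forall fun z => ?_)
    simp [Real.log_pow, abs_mul]
  have h1 := (Measure.measurePreserving_sub_left (volume : Measure (EE n)) x).integrableOn_comp_preimage
    (MeasurableEquiv.subLeft x).measurableEmbedding (f := fun z : EE n => |Real.log ‖z‖|)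
    (s := ball 0 (R + ‖x‖))
  have h2 := h1.2 h0
  refine IntegrableOn.mono_set h2 ?_
  intro y hy
  simp only [Set.mem_preimage, mem_ball_zero_iff] at hy ⊢
  linarith [norm_sub_le x y]

lemma log_ratio_bound {n : ℕ} {x y : EE n} (h : 2 * ‖x‖ ≤ ‖y‖) (hy : y ≠ 0) :
    |Real.log (‖y‖ / ‖x - y‖)| ≤ Real.log 2 := by
  have hy0 := norm_pos_iff.2 hy
  have h1 : ‖y‖ / 2 ≤ ‖x - y‖ := by
    have := norm_sub_norm_le y x
    rw [norm_sub_rev] at this; linarith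
  have h2 : ‖x - y‖ ≤ 2 * ‖y‖ := by linarith [norm_sub_le x y, norm_nonneg y]
  have h3 : 0 < ‖x - y‖ := by linarith
  rw [abs_le]
  constructor
  · rw [← Real.log_inv]
    apply Real.log_le_log (by norm_num)
    rw [le_div_iff₀ h3]; linarith
  · apply Real.log_le_log (by positivity)
    rw [div_le_iff₀ h3]; linarith

lemma ae_ne_pt {n : ℕ} (hn : 2 ≤ n) (x : EE n) : ∀ᵐ z : EE n, z ≠ x := by
  have : Nonempty (Fin n) := ⟨⟨0, by omega⟩⟩
  exact Measure.ae_ne volume x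

lemma lp_integrable {n : ℕ} (hn : 2 ≤ n) {f : EE n → ℝ} (fc : Continuous f) (fi : Integrable f)
    (x : EE n) : Integrable (fun y => Real.log (‖y‖ / ‖x - y‖) * f y) := by
  have hmeas : Measurable (fun y : EE n => Real.log (‖y‖ / ‖x - y‖) * f y) := by
    have := fc.measurable
    fun_prop
  rw [← integrableOn_univ, ← Set.union_compl_self (ball (0 : EE n) (2 * ‖x‖)), integrableOn_union]
  constructor
  · obtain ⟨M, hM0, hM⟩ := bdd_on_ball fc (2 * ‖x‖)
    have h0 := log_intOn hn (0 : EE n) (2 * ‖x‖)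
    have h1 := log_intOn hn x (2 * ‖x‖)
    refine Integrable.mono' ((h0.add h1).mul_const M) hmeas.aestronglyMeasurable ?_
    filter_upwards [ae_restrict_mem measurableSet_ball, ae_restrict_of_ae (ae_ne_pt hn 0),
      ae_restrict_of_ae (ae_ne_pt hn x)] with y hy hy0 hyx
    rw [norm_mul]
    have hy' : ‖y‖ < 2 * ‖x‖ := by simpa using hy
    refine mul_le_mul ?_ (hM y hy'.le) (norm_nonneg _) (by simp; positivity)
    rw [Real.log_div (norm_ne_zero_iff.2 hy0) (norm_ne_zero_iff.2 (sub_ne_zero.2 hyx.symm))]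
    simp only [Pi.add_apply, zero_sub, norm_neg]
    exact abs_sub _ _
  · refine Integrable.mono' (fi.norm.const_mul (Real.log 2)).integrableOn
      hmeas.aestronglyMeasurable ?_
    filter_upwards [ae_restrict_mem measurableSet_ball.compl, ae_restrict_of_ae (ae_ne_pt hn 0)]
      with y hy hy0
    rw [norm_mul]
    refine mul_le_mul_of_nonneg_right ?_ (norm_nonneg _)
    exact log_ratio_bound (by simpa using hy) hy0

lemma Lg0 {n : ℕ} {R : ℝ} (hR : 0 < R) {z : EE n} (hz : z ≠ 0) :
    Lg 0 (R⁻¹ • z) = 2 * (Real.log ‖z‖ - Real.log R) := by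
  have := norm_pos_iff.2 hz
  unfold Lg
  rw [norm_smul, norm_inv, Real.norm_eq_abs, abs_of_pos hR]
  simp only [ne_eq, OfNat.ofNat_ne_zero, not_false_eq_true, zero_pow, add_zero]
  rw [Real.log_pow, Real.log_mul (by positivity) this.ne', Real.log_inv]
  push_cast; ring

lemma kker_int {n : ℕ} (hn : 2 ≤ n) {f : EE n → ℝ} (fc : Continuous f) {R : ℝ} (hR : 0 < R)
    (x : EE n) : Integrable (fun y => kap (Lg 0 (R⁻¹ • (y - x))) * f y) := by
  obtain ⟨M, hM0, hM⟩ := bdd_on_ball fc (‖x‖ + 2 * R)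
  have hmeas : Measurable (fun y => kap (Lg 0 (R⁻¹ • (y - x))) * f y) := by
    have h1 : Measurable (fun y : EE n => R⁻¹ • (y - x)) := by fun_prop
    exact (kap_cd.continuous.measurable.comp ((Lg_measurable 0).comp h1)).mul fc.measurable
  have hi := ((((log_intOn hn x (‖x‖ + 2 * R)).const_mul 2).add
    (integrableOn_const (μ := volume) (C := 2 * |Real.log R| + 1) (by finiteness))).mul_const M)
  refine Integrable.mono' ((integrable_indicator_iff measurableSet_ball).2 hi)
    hmeas.aestronglyMeasurable ?_
  filter_upwards [ae_ne_pt hn x] with y hyx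
  have hyx' := sub_ne_zero.2 hyx
  by_cases h : y ∈ ball (0 : EE n) (‖x‖ + 2 * R)
  · rw [Set.indicator_of_mem h, norm_mul]
    have h2 : ‖y‖ < ‖x‖ + 2 * R := by simpa using h
    refine mul_le_mul ?_ (hM y h2.le) (norm_nonneg _) (by simp; positivity)
    have := kap_abs_le _ (le_refl (Lg 0 (R⁻¹ • (y - x))))
    refine this.trans ?_
    rw [Lg0 hR hyx', norm_sub_rev, abs_mul]
    have := abs_sub (Real.log ‖x - y‖) (Real.log R)
    simp only [Nat.abs_ofNat, Pi.add_apply]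
    linarith
  · rw [Set.indicator_of_notMem h]
    have h2 : ‖x‖ + 2 * R ≤ ‖y‖ := by simpa using h
    rw [kap_big (Lg_big 0 ?_).le]; · simp
    rw [norm_smul, norm_inv, Real.norm_eq_abs, abs_of_pos hR]
    have : ‖y‖ - ‖x‖ ≤ ‖y - x‖ := norm_sub_norm_le y x
    rw [inv_mul_eq_div, le_div_iff₀ hR]; linarith

lemma lim_repr {n m : ℕ} (hn : n = 2 * m) (hm : 1 ≤ m) {u f : EE n → ℝ}
    (hu : ContDiff ℝ (⊤ : ℕ∞) u) (hf : ∀ x, negLapIter m u x = 2 * f x) (fc : Continuous f)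
    (fi : Integrable f) (x : EE n) :
    Tendsto (fun R : ℝ => HH m n u R x - HH m n u R 0) atTop
      (𝓝 (Cm m n * (u x - u 0) - 2 * lpot f x)) := by
  have hn2 : 2 ≤ n := by omega
  obtain ⟨K, hK⟩ := kap_lip
  have key : Tendsto (fun R : ℝ => ∫ y, (kap (Lg 0 (R⁻¹ • (y - x))) - kap (Lg 0 (R⁻¹ • (y - 0)))) * f y)
      atTop (𝓝 (lpot f x)) := by
    unfold lpot
    have hli := lp_integrable hn2 fc fi x
    refine tendsto_integral_filter_of_dominated_convergence
      (fun y => (2 * K) * ‖Real.log (‖y‖ / ‖x - y‖) * f y‖) ?_ ?_ (hli.norm.const_mul _) ?_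
    · refine Eventually.of_forall fun R => ?_
      have h1 : ∀ x : EE n, Measurable (fun y : EE n => R⁻¹ • (y - x)) := fun x => by fun_prop
      exact (((kap_cd.continuous.measurable.comp ((Lg_measurable 0).comp (h1 x))).sub
        (kap_cd.continuous.measurable.comp ((Lg_measurable 0).comp (h1 0)))).mul
        fc.measurable).aestronglyMeasurable
    · filter_upwards [eventually_gt_atTop 0] with R hR
      filter_upwards [ae_ne_pt hn2 x, ae_ne_pt hn2 0] with y hyx hy0
      have hyx' := sub_ne_zero.2 hyx
      rw [norm_mul, norm_mul, ← mul_assoc]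
      refine mul_le_mul_of_nonneg_right ?_ (norm_nonneg _)
      have := hK.dist_le_mul (Lg 0 (R⁻¹ • (y - x))) (Lg 0 (R⁻¹ • (y - 0)))
      rw [Real.dist_eq, Real.dist_eq] at this
      rw [Real.norm_eq_abs]
      refine this.trans (le_of_eq ?_)
      rw [sub_zero, Lg0 hR hyx', Lg0 hR hy0, Real.log_div (norm_ne_zero_iff.2 hy0)
        (norm_ne_zero_iff.2 (sub_ne_zero.2 hyx.symm)), norm_sub_rev x y, Real.norm_eq_abs,
        ← mul_sub, abs_mul, abs_sub_comm (Real.log ‖y‖)]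
      simp; ring
    · filter_upwards [ae_ne_pt hn2 x, ae_ne_pt hn2 0] with y hyx hy0
      have hyx' := sub_ne_zero.2 hyx
      refine Tendsto.congr' ?_ tendsto_const_nhds
      filter_upwards [eventually_gt_atTop 0, eventually_ge_atTop ‖y‖, eventually_ge_atTop ‖y - x‖]
        with R hR h1 h2
      have l1 := Real.log_le_log (norm_pos_iff.2 hy0) h1
      have l2 := Real.log_le_log (norm_pos_iff.2 hyx') h2
      rw [sub_zero, Lg0 hR hyx', Lg0 hR hy0, kap_neg (by linarith), kap_neg (by linarith),
        Real.log_div (norm_ne_zero_iff.2 hy0)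
        (norm_ne_zero_iff.2 (sub_ne_zero.2 hyx.symm)), norm_sub_rev x y]
      ring
  have := (key.const_mul 2).const_sub (Cm m n * (u x - u 0))
  refine this.congr' ?_
  filter_upwards [eventually_gt_atTop 0] with R hR
  have e1 := repr1 hn hm hu hf hR x
  have e2 := repr1 hn hm hu hf hR 0
  simp only [sub_mul]
  rw [integral_sub (kker_int hn2 fc hR x) (kker_int hn2 fc hR 0)]
  linarith

end

section
set_option linter.all false
open MeasureTheory Real Filter Metric
open scoped ENNReal Topology

noncomputable def pk (k : ℕ) (t : ℝ) : ℝ := (max 0 t) ^ k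

lemma pk_cont (k : ℕ) : Continuous (pk k) := by unfold pk; fun_prop

lemma pk_deriv {k : ℕ} (hk : 1 ≤ k) (t : ℝ) : HasDerivAt (pk (k + 1)) ((k + 1) * pk k t) t := by
  rcases lt_trichotomy t 0 with h | h | h
  · have : pk (k+1) =ᶠ[𝓝 t] fun _ => 0 := by
      filter_upwards [Iio_mem_nhds h] with s hs
      have hs' : s ≤ 0 := le_of_lt (Set.mem_Iio.1 hs)
      simp [pk, max_eq_left hs']
    have e : ((k : ℝ) + 1) * pk k t = 0 := by
      simp [pk, max_eq_left h.le]; right; omega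
    rw [e]
    exact (hasDerivAt_const t (0:ℝ)).congr_of_eventuallyEq this
  · subst h
    have e : ((k : ℝ) + 1) * pk k 0 = 0 := by
      simp [pk]; right; omega
    rw [e, hasDerivAt_iff_isLittleO_nhds_zero]
    simp only [zero_add, smul_zero, sub_zero]
    have h0 : pk (k+1) 0 = 0 := by simp [pk]
    rw [h0]; simp only [sub_zero]
    have : (fun h : ℝ => pk (k+1) h) = fun h => pk k h * max 0 h := by
      funext h; simp [pk, pow_succ]
    rw [this]
    have l1 : (fun h : ℝ => pk k h) =o[𝓝 0] (fun _ => (1:ℝ)) := by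
      rw [Asymptotics.isLittleO_one_iff]
      have := (pk_cont k).tendsto 0
      have h0 : pk k 0 = 0 := by simp [pk]; omega
      rwa [h0] at this
    have l2 : (fun h : ℝ => max 0 h) =O[𝓝 0] (fun h => h) := by
      refine Asymptotics.IsBigO.of_bound 1 (Eventually.of_forall fun h => ?_)
      rw [one_mul, Real.norm_eq_abs, Real.norm_eq_abs, abs_of_nonneg (le_max_left _ _)]
      exact max_le (abs_nonneg _) (le_abs_self _)
    simpa using l1.mul_isBigO l2
  · have : pk (k+1) =ᶠ[𝓝 t] fun s => s ^ (k+1) := by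
      filter_upwards [Ioi_mem_nhds h] with s hs
      have hs' : 0 ≤ s := le_of_lt (Set.mem_Ioi.1 hs)
      simp [pk, max_eq_right hs']
    have e : ((k : ℝ) + 1) * pk k t = ((k + 1 : ℕ) : ℝ) * t ^ (k + 1 - 1) := by
      simp [pk, max_eq_right h.le]
    rw [e]
    exact (hasDerivAt_pow (k+1) t).congr_of_eventuallyEq this

noncomputable def KK (n k : ℕ) (y : EE n) : ℝ := pk k (10 - ‖y‖ ^ 2)

lemma KK_cont (n k : ℕ) : Continuous (KK n k) := by
  unfold KK; exact (pk_cont k).comp (by fun_prop)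

lemma KK_zero {n k : ℕ} (hk : 1 ≤ k) {y : EE n} (hy : 4 ≤ ‖y‖) : KK n k y = 0 := by
  unfold KK pk
  rw [max_eq_left (by nlinarith)]
  exact zero_pow (by omega)

lemma KK_nonneg (n k : ℕ) (y : EE n) : 0 ≤ KK n k y := by unfold KK pk; positivity

lemma KK_le (n k : ℕ) (y : EE n) : KK n k y ≤ 10 ^ k := by
  unfold KK pk
  gcongr
  exact max_le (by norm_num) (by nlinarith [sq_nonneg ‖y‖])

lemma KK_one {n k : ℕ} {y : EE n} (hy : ‖y‖ ≤ 3) : 1 ≤ KK n k y := by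
  unfold KK pk
  apply one_le_pow₀
  exact le_max_of_le_right (by nlinarith [norm_nonneg y])

lemma KK_hcs {n k : ℕ} (hk : 1 ≤ k) : HasCompactSupport (KK n k) := by
  refine HasCompactSupport.intro (isCompact_closedBall (0 : EE n) 4) fun y hy => KK_zero hk ?_
  have : 4 < ‖y‖ := by simpa using hy
  exact this.le

lemma KK_fderiv {n k : ℕ} (hk : 1 ≤ k) (y : EE n) :
    HasFDerivAt (KK n (k+1)) ((-(2 * (k + 1) * KK n k y)) • innerSL ℝ y) y := by
  have h1 : HasFDerivAt (fun y : EE n => 10 - ‖y‖ ^ 2) (-((2:ℝ) • innerSL ℝ y)) y := by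
    have h0 : HasFDerivAt (fun y : EE n => ‖y‖ ^ 2) ((2:ℝ) • innerSL ℝ y) y := by
      have := (hasStrictFDerivAt_norm_sq y).hasFDerivAt
      rwa [← Nat.cast_smul_eq_nsmul ℝ] at this
    exact h0.const_sub 10
  have h2 := (pk_deriv hk (10 - ‖y‖ ^ 2)).comp_hasFDerivAt y h1
  have h3 : HasFDerivAt (KK n (k+1)) (((k + 1) * pk k (10 - ‖y‖ ^ 2)) • (-((2:ℝ) • innerSL ℝ y))) y := h2
  convert h3 using 1
  ext v
  simp [KK]; ring

lemma KK_cd {n k : ℕ} (hk : 1 ≤ k) : ContDiff ℝ 1 (KK n (k+1)) := by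
  rw [contDiff_one_iff_fderiv]
  refine ⟨fun y => (KK_fderiv hk y).differentiableAt, ?_⟩
  have : fderiv ℝ (KK n (k+1)) = fun y => (-(2 * (k + 1) * KK n k y)) • innerSL ℝ y :=
    funext fun y => (KK_fderiv hk y).fderiv
  rw [this]
  have := KK_cont n k
  fun_prop

noncomputable def AA {n : ℕ} (k : ℕ) (g : EE n → ℝ) (R : ℝ) : ℝ := ∫ y, KK n k y * g (R • y)

lemma AA_ibp {n k : ℕ} (hk : 1 ≤ k) {g : EE n → ℝ} (hg : ContDiff ℝ (⊤ : ℕ∞) g) (R : ℝ) :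
    2 * (k + 1) * ∫ y, KK n k y * fderiv ℝ g (R • y) y = R * AA (k+1) (laplacian g) R := by
  have hg1 : ContDiff ℝ (⊤ : ℕ∞) (fderiv ℝ g) := hg.fderiv_right (by simp)
  have hgi : ∀ i : Fin n, ContDiff ℝ (⊤ : ℕ∞) (fun y => fderiv ℝ g y (EuclideanSpace.single i 1)) :=
    fun i => hg1.clm_apply contDiff_const
  have hGi : ∀ i : Fin n, ContDiff ℝ (⊤ : ℕ∞) (fun y : EE n => fderiv ℝ g (R • y) (EuclideanSpace.single i 1)) :=
    fun i => (hgi i).comp (by fun_prop)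
  have hb := fun i : Fin n => ibp1 (KK_cd (n := n) hk) (KK_hcs (by omega)) ((hGi i).of_le (by simp))
    (EuclideanSpace.single i 1)
  have e1 : ∀ (i : Fin n) (y : EE n), fderiv ℝ (KK n (k+1)) y (EuclideanSpace.single i 1)
      = -(2 * (k + 1) * KK n k y) * y i := by
    intro i y
    rw [(KK_fderiv hk y).fderiv]
    simp [EuclideanSpace.inner_single_right]
  have e2 : ∀ (i : Fin n) (y : EE n),
      fderiv ℝ (fun y : EE n => fderiv ℝ g (R • y) (EuclideanSpace.single i 1)) y (EuclideanSpace.single i 1)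
      = R * fderiv ℝ (fun y : EE n => fderiv ℝ g y (EuclideanSpace.single i 1)) (R • y) (EuclideanSpace.single i 1) := by
    intro i y
    have h1 : HasFDerivAt (fun y : EE n => R • y) (R • ContinuousLinearMap.id ℝ (EE n)) y :=
      (hasFDerivAt_id y).const_smul R
    have h2 := (((hgi i).differentiable (by simp)) (R • y)).hasFDerivAt.comp y h1
    have h3 : HasFDerivAt (fun y : EE n => fderiv ℝ g (R • y) (EuclideanSpace.single i 1)) _ y := h2
    rw [h3.fderiv]
    simp
  have e3 : ∀ y : EE n, fderiv ℝ g (R • y) y = ∑ i, y i * fderiv ℝ g (R • y) (EuclideanSpace.single i 1) := by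
    intro y
    have : y = ∑ i, y i • (EuclideanSpace.single i (1:ℝ) : EE n) := by
      ext j; simp [Finset.sum_apply, Pi.single_apply]
    have h2 := congrArg (fderiv ℝ g (R • y)) this
    rw [map_sum] at h2
    rw [h2]; simp
  have c1 : Continuous (KK n k) := KK_cont n k
  have c2 : Continuous (KK n (k+1)) := KK_cont n (k+1)
  have s1 : 2 * (k + 1) * ∫ y, KK n k y * fderiv ℝ g (R • y) y
      = ∑ i, 2 * (k+1) * ∫ y, KK n k y * (y i * fderiv ℝ g (R • y) (EuclideanSpace.single i 1)) := by
    rw [← Finset.mul_sum, ← integral_finsetSum]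
    · congr 2; funext y; rw [e3, Finset.mul_sum]
    · intro i _
      have := (hGi i).continuous
      exact integrable_mul_cs c1 (KK_hcs hk) (by fun_prop)
  have s2 : R * AA (k+1) (laplacian g) R = ∑ i, ∫ y, KK n (k+1) y *
      fderiv ℝ (fun y : EE n => fderiv ℝ g (R • y) (EuclideanSpace.single i 1)) y (EuclideanSpace.single i 1) := by
    unfold AA
    rw [← integral_finsetSum, ← integral_const_mul]
    · congr 1; funext y
      rw [lap_eq_sum' (hg.of_le two_le_top'), ← Finset.mul_sum]
      simp only [e2]
      rw [← Finset.mul_sum]; ring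
    · intro i _
      exact integrable_mul_cs c2 (KK_hcs (by omega))
        (((hGi i).continuous_fderiv (by simp)).clm_apply continuous_const)
  rw [s1, s2]
  refine Finset.sum_congr rfl fun i _ => ?_
  rw [hb i, ← integral_const_mul, ← integral_neg]
  congr 1; funext y; rw [e1]; ring

lemma AA_deriv {n k : ℕ} (hk : 1 ≤ k) {g : EE n → ℝ} (hg : ContDiff ℝ (⊤ : ℕ∞) g) (R : ℝ) :
    HasDerivAt (AA k g) (R * AA (k+1) (laplacian g) R / (2 * (k + 1))) R := by
  rw [← AA_ibp hk hg R, mul_div_cancel_left₀ _ (by positivity)]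
  have c1 : Continuous (KK n k) := KK_cont n k
  have cg := hg.continuous
  have cg1 : Continuous (fderiv ℝ g) := hg.continuous_fderiv (by simp)
  obtain ⟨M, hM⟩ := (isCompact_closedBall (0 : EE n) ((|R| + 1) * 4)).exists_bound_of_continuousOn
    cg1.continuousOn
  have hc : Continuous (fun y : EE n => fderiv ℝ g (R • y) y) :=
    (cg1.comp (by fun_prop)).clm_apply continuous_id
  refine (hasDerivAt_integral_of_dominated_loc_of_deriv_le (μ := volume) (x₀ := R)
    (F := fun R y => KK n k y * g (R • y)) (F' := fun R y => KK n k y * fderiv ℝ g (R • y) y)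
    (s := ball R 1) (bound := fun y => KK n k y * (M * 4)) (ball_mem_nhds _ one_pos)
    ?_ ?_ ?_ ?_ ?_ ?_).2
  · exact Eventually.of_forall fun R => by
      have : Continuous (fun y => KK n k y * g (R • y)) := by fun_prop
      exact this.aestronglyMeasurable
  · exact integrable_mul_cs c1 (KK_hcs hk) (by fun_prop)
  · exact (c1.mul hc).aestronglyMeasurable
  · refine Eventually.of_forall fun y R' hR' => ?_
    rw [norm_mul, Real.norm_eq_abs, abs_of_nonneg (KK_nonneg n k y)]
    rcases le_or_gt 4 ‖y‖ with h | h
    · rw [KK_zero hk h]; simp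
    · refine mul_le_mul_of_nonneg_left ?_ (KK_nonneg n k y)
      have hR2 : |R'| ≤ |R| + 1 := by
        have : |R' - R| < 1 := by simpa [Real.dist_eq] using hR'
        have := abs_sub_abs_le_abs_sub R' R
        linarith
      have h1 : ‖fderiv ℝ g (R' • y)‖ ≤ M := by
        apply hM
        simp only [mem_closedBall_zero_iff, norm_smul, Real.norm_eq_abs]
        gcongr
      exact (ContinuousLinearMap.le_opNorm _ _).trans
        (mul_le_mul h1 h.le (norm_nonneg _) ((norm_nonneg _).trans h1))
  · exact integrable_mul_cs c1 (KK_hcs hk) continuous_const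
  · refine Eventually.of_forall fun y R' hR' => ?_
    have h1 : HasDerivAt (fun R : ℝ => R • y) ((1:ℝ) • y) R' := (hasDerivAt_id R').smul_const y
    rw [one_smul] at h1
    have h2 := ((hg.differentiable (by simp)) (R' • y)).hasFDerivAt.comp_hasDerivAt R' h1
    exact h2.const_mul _

lemma AA_step {n : ℕ} {g : EE n → ℝ} (hg : ContDiff ℝ (⊤ : ℕ∞) g) (N : ℕ)
    (h : ∀ k, 1 ≤ k → ∃ C, ∀ R : ℝ, 1 ≤ R → |AA k (laplacian g) R| ≤ C * R ^ N) :
    ∀ k, 1 ≤ k → ∃ C, ∀ R : ℝ, 1 ≤ R → |AA k g R| ≤ C * R ^ (N + 2) := by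
  intro k hk
  obtain ⟨C, hC⟩ := h (k+1) (by omega)
  have hC0 : 0 ≤ C := by
    have := (abs_nonneg _).trans (hC 1 le_rfl)
    simpa using this
  refine ⟨|AA k g 1| + C, fun R hR => ?_⟩
  have := Convex.norm_image_sub_le_of_norm_hasDerivWithin_le (f := AA k g)
    (f' := fun R => R * AA (k+1) (laplacian g) R / (2 * (k + 1))) (s := Set.Icc 1 R) (x := 1) (y := R)
    (C := C * R ^ (N + 1)) (fun x hx => (AA_deriv hk hg x).hasDerivWithinAt) ?_ (convex_Icc _ _)
    ⟨le_rfl, hR⟩ ⟨hR, le_rfl⟩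
  · rw [Real.norm_eq_abs, Real.norm_eq_abs, abs_of_nonneg (by linarith : 0 ≤ R - 1)] at this
    have h1 := abs_sub_abs_le_abs_sub (AA k g R) (AA k g 1)
    have h2 : C * R ^ (N+1) * (R - 1) ≤ C * R ^ (N + 2) := by
      have : C * R ^ (N+2) = C * R ^ (N+1) * R := by ring
      rw [this]
      have : 0 ≤ C * R ^ (N+1) := by positivity
      nlinarith
    have h3 : |AA k g 1| ≤ |AA k g 1| * R ^ (N+2) :=
      le_mul_of_one_le_right (abs_nonneg _) (one_le_pow₀ hR)
    nlinarith
  · intro x hx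
    have hx0 : 0 ≤ x := by linarith [hx.1]
    rw [Real.norm_eq_abs, abs_div, abs_mul, abs_of_nonneg hx0, abs_of_pos (by positivity : (0:ℝ) < 2 * (k+1))]
    refine (div_le_self (by positivity) (by have : (0:ℝ) ≤ k := by positivity
                                            linarith)).trans ?_
    calc x * |AA (k+1) (laplacian g) x| ≤ x * (C * x ^ N) := by gcongr; exact hC x hx.1
      _ = C * x ^ (N+1) := by ring
      _ ≤ C * R ^ (N+1) := by gcongr; exact hx.2

lemma AA_iter {n : ℕ} (j : ℕ) : ∀ {g : EE n → ℝ} (hg : ContDiff ℝ (⊤ : ℕ∞) g)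
    (h : ∀ k, 1 ≤ k → ∃ C, ∀ R : ℝ, 1 ≤ R → |AA k (negLapIter j g) R| ≤ C * R ^ 0),
    ∀ k, 1 ≤ k → ∃ C, ∀ R : ℝ, 1 ≤ R → |AA k g R| ≤ C * R ^ (2 * j) := by
  induction j with
  | zero => intro g hg h; simpa [negLapIter] using h
  | succ j ih =>
    intro g hg h
    rw [negLapIter_succ'] at h
    have := ih (contDiff_lap hg).neg h
    refine AA_step hg (2 * j) ?_
    intro k hk
    obtain ⟨C, hC⟩ := this k hk
    refine ⟨C, fun R hR => ?_⟩
    have e := hC R hR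
    have : AA k (fun x => - laplacian g x) R = - AA k (laplacian g) R := by
      unfold AA; rw [← integral_neg]; congr 1; funext y; ring
    rwa [this, abs_neg] at e

lemma int_scale_le {n : ℕ} {f : EE n → ℝ} (fi : Integrable f) {R : ℝ} (hR : 1 ≤ R) (k : ℕ) :
    Integrable (fun y => KK n k y * |f (R • y)|) ∧
    ∫ y, KK n k y * |f (R • y)| ≤ 10 ^ k * ∫ y, |f y| := by
  have hR0 : R ≠ 0 := by positivity
  have h1 : Integrable (fun y => f (R • y)) := fi.comp_smul hR0
  have h2 : Integrable (fun y => 10 ^ k * |f (R • y)|) := h1.abs.const_mul _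
  have h3 : Integrable (fun y => KK n k y * |f (R • y)|) := by
    refine Integrable.mono' h2 ((KK_cont n k).aestronglyMeasurable.mul h1.abs.aestronglyMeasurable) ?_
    refine Eventually.of_forall fun y => ?_
    rw [norm_mul, Real.norm_eq_abs, abs_of_nonneg (KK_nonneg n k y), Real.norm_eq_abs, abs_abs]
    exact mul_le_mul_of_nonneg_right (KK_le n k y) (abs_nonneg _)
  refine ⟨h3, ?_⟩
  calc _ ≤ ∫ y, 10 ^ k * |f (R • y)| := integral_mono h3 h2 fun y =>
        mul_le_mul_of_nonneg_right (KK_le n k y) (abs_nonneg _)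
    _ = 10 ^ k * (|(R ^ Module.finrank ℝ (EE n))⁻¹| * ∫ y, |f y|) := by
        rw [integral_const_mul, Measure.integral_comp_smul volume (fun y => |f y|) R, smul_eq_mul]
    _ ≤ 10 ^ k * (1 * ∫ y, |f y|) := by
        have : 0 ≤ ∫ y, |f y| := integral_nonneg fun y => abs_nonneg (f y)
        gcongr
        · rw [abs_of_nonneg (by positivity)]
          exact inv_le_one_of_one_le₀ (one_le_pow₀ hR)
    _ = _ := by ring

lemma growth {n m : ℕ} {u f : EE n → ℝ} (hu : ContDiff ℝ (⊤ : ℕ∞) u)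
    (hf : ∀ x, negLapIter m u x = 2 * f x) (fc : Continuous f) (fi : Integrable f)
    {M : ℝ} (hM0 : 0 ≤ M) (hM : ∀ x, u x ≤ |f x| + ‖x‖ ^ 2 + M) :
    ∃ C, ∃ N : ℕ, 0 ≤ C ∧ ∀ R : ℝ, 1 ≤ R → ∫ y in closedBall (0 : EE n) 3, |u (R • y)| ≤ C * R ^ N := by
  have hb := AA_iter m hu ?_ 1 le_rfl
  swap
  · intro k hk
    refine ⟨2 * (10 ^ k * ∫ y, |f y|), fun R hR => ?_⟩
    rw [pow_zero, mul_one]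
    obtain ⟨h1, h2⟩ := int_scale_le fi hR k
    unfold AA
    rw [← Real.norm_eq_abs]
    refine (norm_integral_le_integral_norm _).trans ?_
    have : (fun y => ‖KK n k y * negLapIter m u (R • y)‖) = fun y => 2 * (KK n k y * |f (R • y)|) := by
      funext y
      rw [hf, norm_mul, Real.norm_eq_abs, Real.norm_eq_abs, abs_of_nonneg (KK_nonneg n k y), abs_mul]
      simp; ring
    rw [this, integral_const_mul]
    linarith
  obtain ⟨C, hC⟩ := hb
  have hC0 : 0 ≤ C := by
    have := (abs_nonneg _).trans (hC 1 le_rfl)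
    simpa using this
  set I := ∫ y, KK n 1 y with hI
  have hI0 : 0 ≤ I := integral_nonneg (KK_nonneg n 1)
  set F := ∫ y, |f y| with hF
  have hF0 : 0 ≤ F := integral_nonneg fun _ => abs_nonneg _
  refine ⟨2 * (10 * F) + 2 * (16 + M) * I + C, 2 * m + 2, by positivity, fun R hR => ?_⟩
  have cu := hu.continuous
  have c1 := KK_cont n 1
  obtain ⟨h1, h2⟩ := int_scale_le fi hR 1
  have i1 : Integrable (fun y => KK n 1 y * u (R • y)) :=
    integrable_mul_cs c1 (KK_hcs le_rfl) (by fun_prop)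
  have i2 : Integrable (fun y => KK n 1 y * |u (R • y)|) :=
    integrable_mul_cs c1 (KK_hcs le_rfl) (by fun_prop)
  have i3 : Integrable (fun y => KK n 1 y * (16 * R ^ 2 + M)) :=
    integrable_mul_cs c1 (KK_hcs le_rfl) (by fun_prop)
  have ib : Integrable (fun y => 2 * (KK n 1 y * |f (R • y)|) + 2 * (KK n 1 y * (16 * R ^ 2 + M))
      - KK n 1 y * u (R • y)) := ((h1.const_mul 2).add (i3.const_mul 2)).sub i1
  have hcn : Integrable (fun y : EE n => |u (R • y)|) (volume.restrict (closedBall 0 3)) :=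
    ContinuousOn.integrableOn_compact (isCompact_closedBall _ _) (by fun_prop)
  calc ∫ y in closedBall (0 : EE n) 3, |u (R • y)|
      ≤ ∫ y in closedBall (0 : EE n) 3, KK n 1 y * |u (R • y)| := by
        refine setIntegral_mono_on hcn i2.integrableOn measurableSet_closedBall fun y hy => ?_
        exact le_mul_of_one_le_left (abs_nonneg _) (KK_one (by simpa using hy))
    _ ≤ ∫ y, KK n 1 y * |u (R • y)| := setIntegral_le_integral i2
        (Eventually.of_forall fun y => mul_nonneg (KK_nonneg _ _ _) (abs_nonneg _))
    _ ≤ ∫ y, (2 * (KK n 1 y * |f (R • y)|) + 2 * (KK n 1 y * (16 * R ^ 2 + M))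
      - KK n 1 y * u (R • y)) := by
        refine integral_mono i2 ib fun y => ?_
        show KK n 1 y * |u (R • y)| ≤ _
        rcases le_or_gt 4 ‖y‖ with h | h
        · simp [KK_zero le_rfl h]
        · have : 2 * (KK n 1 y * |f (R • y)|) + 2 * (KK n 1 y * (16 * R ^ 2 + M))
            - KK n 1 y * u (R • y) = KK n 1 y * (2 * (|f (R • y)| + 16 * R ^ 2 + M) - u (R • y)) := by ring
          rw [this]
          refine mul_le_mul_of_nonneg_left ?_ (KK_nonneg _ _ _)
          have h3 := hM (R • y)
          rw [norm_smul, Real.norm_eq_abs, mul_pow, sq_abs] at h3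
          have h4 : R ^ 2 * ‖y‖ ^ 2 ≤ 16 * R ^ 2 := by
            have : ‖y‖ ^ 2 ≤ 16 := by nlinarith [norm_nonneg y]
            nlinarith [sq_nonneg R]
          have := abs_nonneg (f (R • y))
          rcases abs_cases (u (R • y)) with h5 | h5
          · rw [h5.1]; linarith
          · rw [h5.1]; nlinarith [sq_nonneg R]
    _ = 2 * (∫ y, KK n 1 y * |f (R • y)|) + 2 * (I * (16 * R ^ 2 + M)) - AA 1 u R := by
        have h3 : Integrable (fun y => 2 * (KK n 1 y * |f (R • y)|) + 2 * (KK n 1 y * (16 * R ^ 2 + M))) :=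
          (h1.const_mul 2).add (i3.const_mul 2)
        rw [integral_sub h3 i1, integral_add (h1.const_mul 2) (i3.const_mul 2), integral_const_mul,
          integral_const_mul, integral_mul_const]
        rfl
    _ ≤ 2 * (10 * F) + 2 * (I * ((16 + M) * R ^ 2)) + C * R ^ (2 * m) := by
        have h5 := neg_le_of_abs_le (hC R hR)
        have h6 : 16 * R ^ 2 + M ≤ (16 + M) * R ^ 2 := by
          have q := mul_le_mul_of_nonneg_left (one_le_pow₀ hR : 1 ≤ R ^ 2) hM0
          linarith
        have h7 := mul_le_mul_of_nonneg_left h6 hI0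
        have h8 : (10:ℝ) ^ 1 = 10 := by norm_num
        rw [h8] at h2
        linarith
    _ ≤ 2 * (10 * F) * R ^ (2 * m + 2) + 2 * (I * ((16 + M) * R ^ (2 * m + 2))) + C * R ^ (2 * m + 2) := by
        have p1 : R ^ 2 ≤ R ^ (2 * m + 2) := pow_le_pow_right₀ hR (by omega)
        have p2 : R ^ (2 * m) ≤ R ^ (2 * m + 2) := pow_le_pow_right₀ hR (by omega)
        have p3 : 2 * (10 * F) ≤ 2 * (10 * F) * R ^ (2 * m + 2) :=
          le_mul_of_one_le_right (by positivity) (one_le_pow₀ hR)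
        gcongr
    _ = _ := by ring

end

section
set_option linter.all false
open MeasureTheory Real Filter Metric
open scoped ENNReal Topology

lemma poly_lim {k : ℕ} (q : ℝ → Polynomial ℝ) (hq : ∀ R, (q R).degree < k) (L : ℝ → ℝ)
    (h : ∀ t, Tendsto (fun R => (q R).eval t) atTop (𝓝 (L t))) :
    ∃ P : Polynomial ℝ, ∀ t, L t = P.eval t := by
  have hinj : Set.InjOn (fun i : ℕ => (i : ℝ)) (Finset.range k : Set ℕ) :=
    fun a _ b _ hab => Nat.cast_injective hab
  refine ⟨Lagrange.interpolate (Finset.range k) (fun i : ℕ => (i : ℝ)) (fun i => L i), fun t => ?_⟩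
  refine tendsto_nhds_unique (h t) ?_
  have e : ∀ R, (q R).eval t = ∑ i ∈ Finset.range k, (q R).eval (i : ℝ) *
      (Lagrange.basis (Finset.range k) (fun i : ℕ => (i : ℝ)) i).eval t := by
    intro R
    conv_lhs => rw [Lagrange.eq_interpolate (f := q R) hinj (by simpa using hq R)]
    rw [Lagrange.interpolate_apply, Polynomial.eval_finset_sum]
    simp
  rw [Lagrange.interpolate_apply, Polynomial.eval_finset_sum]
  simp only [e, Polynomial.eval_mul, Polynomial.eval_C]
  exact tendsto_finset_sum _ fun i _ => (h i).mul_const _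

lemma taylor_dir {n : ℕ} (θ : EE n) (k : ℕ) : ∀ Ψ : EE n → ℝ, ContDiff ℝ (⊤ : ℕ∞) Ψ →
    (∀ z, 2 < ‖z‖ → Ψ z = 0) →
    ∃ φ : ℕ → EE n → ℝ, (∀ i, Continuous (φ i)) ∧ (∀ i z, 2 < ‖z‖ → φ i z = 0) ∧
    ∃ M, ∀ w (s : ℝ), |Ψ (w - s • θ) - ∑ i ∈ Finset.range k, s ^ i * φ i w| ≤ M * |s| ^ k := by
  induction k with
  | zero =>
    intro Ψ hΨ h0
    refine ⟨fun _ _ => 0, fun _ => continuous_const, fun _ _ _ => rfl, ?_⟩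
    obtain ⟨M, hM0, hM⟩ := bdd_on_ball hΨ.continuous 2
    refine ⟨M, fun w s => ?_⟩
    simp only [Finset.range_zero, Finset.sum_empty, sub_zero, pow_zero, mul_one]
    rcases le_or_gt ‖w - s • θ‖ 2 with h | h
    · exact hM _ h
    · rw [h0 _ h]; simpa using hM0
  | succ k ih =>
    intro Ψ hΨ h0
    have hd : ContDiff ℝ (⊤ : ℕ∞) (fun z => fderiv ℝ Ψ z (-θ)) :=
      (hΨ.fderiv_right (m := (⊤ : ℕ∞)) (by simp)).clm_apply contDiff_const
    obtain ⟨φ, hφc, hφ0, M, hM⟩ := ih _ hd (by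
      intro z hz
      have : Ψ =ᶠ[𝓝 z] fun _ => 0 := by
        filter_upwards [(isOpen_lt continuous_const continuous_norm).mem_nhds hz] with y hy
        exact h0 y hy
      rw [this.fderiv_eq]; simp)
    refine ⟨fun i => match i with | 0 => Ψ | (j+1) => fun w => φ j w / (j + 1), ?_, ?_, M, ?_⟩
    · intro i
      match i with
      | 0 => exact hΨ.continuous
      | (j+1) => exact (hφc j).div_const _
    · intro i z hz
      match i with
      | 0 => exact h0 z hz
      | (j+1) => show φ j z / _ = 0; rw [hφ0 j z hz]; simp
    · intro w s
      have hder : ∀ s : ℝ, HasDerivAt (fun s : ℝ => Ψ (w - s • θ) - ∑ i ∈ Finset.range k, s ^ (i+1) * (φ i w / (i + 1)))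
          (fderiv ℝ Ψ (w - s • θ) (-θ) - ∑ i ∈ Finset.range k, s ^ i * φ i w) s := by
        intro s
        have h1 : HasDerivAt (fun s : ℝ => w - s • θ) (-((1:ℝ) • θ)) s :=
          ((hasDerivAt_id s).smul_const θ).const_sub w
        rw [one_smul] at h1
        have h2 := ((hΨ.differentiable (by simp)) (w - s • θ)).hasFDerivAt.comp_hasDerivAt s h1
        refine HasDerivAt.sub h2 ?_
        refine HasDerivAt.fun_sum fun i _ => ?_
        have h3 := (hasDerivAt_pow (i+1) s).mul_const (φ i w / (i + 1))
        refine h3.congr_deriv (Eq.symm ?_)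
        have : (i:ℝ) + 1 ≠ 0 := by positivity
        rw [Nat.add_sub_cancel]; push_cast; field_simp
      have hM0 : 0 ≤ M := by
        have := (abs_nonneg _).trans (hM w 1); simpa using this
      have := Convex.norm_image_sub_le_of_norm_hasDerivWithin_le (C := M * |s| ^ k)
        (s := Set.uIcc 0 s) (x := 0) (y := s)
        (fun x hx => (hder x).hasDerivWithinAt) ?_ (convex_uIcc _ _) Set.left_mem_uIcc Set.right_mem_uIcc
      · rw [Finset.sum_range_succ']
        simp only [pow_zero, one_mul]
        simp only [Real.norm_eq_abs, sub_zero, zero_smul] at this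
        have e0 : ∑ i ∈ Finset.range k, (0:ℝ) ^ (i+1) * (φ i w / (i + 1)) = 0 :=
          Finset.sum_eq_zero fun i _ => by simp
        rw [e0, sub_zero] at this
        rw [pow_succ, ← mul_assoc]
        convert this using 2
        ring
      · intro x hx
        refine (hM w x).trans ?_
        have : |x| ≤ |s| := by
          have := Set.abs_sub_left_of_mem_uIcc hx
          simpa using this
        gcongr

lemma HH_shift {n m : ℕ} (u : EE n → ℝ) {R : ℝ} (hR : 0 < R) (t : ℝ) (θ : EE n) :
    HH m n u R (t • θ) = ∫ w, PhiK m n (w - (t / R) • θ) * u (R • w) := by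
  unfold HH
  rw [← integral_add_right_eq_self (μ := volume) (fun w => PhiK m n (w - (t / R) • θ) * u (R • w)) ((t / R) • θ)]
  congr 1; funext z
  rw [add_sub_cancel_right, smul_add, smul_smul, mul_div_cancel₀ _ hR.ne', add_comm]

lemma poly_line {n m : ℕ} (hn : n = 2 * m) (hm : 1 ≤ m) {u f : EE n → ℝ}
    (hu : ContDiff ℝ (⊤ : ℕ∞) u) (hf : ∀ x, negLapIter m u x = 2 * f x) (fc : Continuous f)
    (fi : Integrable f) {M : ℝ} (hM0 : 0 ≤ M) (hM : ∀ x, u x ≤ |f x| + ‖x‖ ^ 2 + M)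
    (θ : EE n) (hθ : ‖θ‖ = 1) :
    ∃ P : Polynomial ℝ, ∀ t : ℝ, Cm m n * (u (t • θ) - u 0) - 2 * lpot f (t • θ) = P.eval t := by
  obtain ⟨C, N, hC0, hC⟩ := growth hu hf fc fi hM0 hM
  obtain ⟨φ, hφc, hφ0, D, hD⟩ := taylor_dir θ (N+1) (PhiK m n) (PhiK_cd hm)
    (fun z hz => PhiK_supp hz.le)
  have hD0 : 0 ≤ D := by
    have := (abs_nonneg _).trans (hD 0 1); simpa using this
  have cu := hu.continuous
  set q0 : ℝ → Polynomial ℝ := fun R => ∑ i ∈ Finset.range (N+1),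
    Polynomial.C ((R⁻¹) ^ i * ∫ w, φ i w * u (R • w)) * Polynomial.X ^ i with hq0
  set q : ℝ → Polynomial ℝ := fun R => q0 R - Polynomial.C (HH m n u R 0) with hq
  have hev : ∀ R t, (q R).eval t = (∑ i ∈ Finset.range (N+1), (t / R) ^ i * ∫ w, φ i w * u (R • w))
      - HH m n u R 0 := by
    intro R t
    simp only [hq, hq0, Polynomial.eval_sub, Polynomial.eval_finset_sum, Polynomial.eval_mul,
      Polynomial.eval_C, Polynomial.eval_pow, Polynomial.eval_X]
    congr 1
    refine Finset.sum_congr rfl fun i _ => ?_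
    rw [div_eq_mul_inv, mul_pow]; ring
  refine poly_lim (k := N + 1) q ?_ _ ?_
  · intro R
    refine (Polynomial.degree_sub_le _ _).trans_lt (max_lt ?_ ?_)
    · rw [Polynomial.degree_lt_iff_coeff_zero]
      intro j hj
      simp only [hq0, Polynomial.finset_sum_coeff, Polynomial.coeff_C_mul_X_pow]
      refine Finset.sum_eq_zero fun i hi => ?_
      rw [if_neg]
      have := Finset.mem_range.1 hi
      omega
    · refine Polynomial.degree_C_le.trans_lt ?_
      exact_mod_cast Nat.succ_pos N
  · intro t
    have hl := lim_repr hn hm hu hf fc fi (t • θ)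
    have hz : Tendsto (fun R => (q R).eval t - (HH m n u R (t • θ) - HH m n u R 0)) atTop (𝓝 0) := by
      have hb : Tendsto (fun R : ℝ => D * |t| ^ (N+1) * C * R⁻¹) atTop (𝓝 0) := by
        simpa using tendsto_inv_atTop_zero.const_mul (D * |t| ^ (N+1) * C)
      refine squeeze_zero_norm' ?_ hb
      filter_upwards [eventually_ge_atTop 1, eventually_ge_atTop |t|] with R hR hRt
      have hR0 : 0 < R := by linarith
      have hs : |t / R| ≤ 1 := by
        rw [abs_div, abs_of_pos hR0, div_le_one hR0]; exact hRt
      rw [hev, HH_shift u hR0]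
      have i1 : ∀ i, Integrable (fun w => φ i w * u (R • w)) := by
        intro i
        refine integrable_mul_cs (hφc i) ?_ (by fun_prop)
        refine HasCompactSupport.intro (isCompact_closedBall (0 : EE n) 2) fun y hy => hφ0 i y ?_
        simpa using hy
      have i2 : Integrable (fun w => PhiK m n (w - (t / R) • θ) * u (R • w)) := by
        refine integrable_mul_cs ?_ ?_ (by fun_prop)
        · exact (PhiK_cd hm).continuous.comp (by fun_prop)
        · refine HasCompactSupport.intro (isCompact_closedBall (0 : EE n) 3) fun y hy => PhiK_supp ?_
          have h3 : 3 < ‖y‖ := by simpa using hy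
          have h4 := norm_sub_norm_le y ((t / R) • θ)
          rw [norm_smul, hθ, Real.norm_eq_abs] at h4
          linarith
      have e : (∑ i ∈ Finset.range (N+1), (t / R) ^ i * ∫ w, φ i w * u (R • w))
          = ∫ w, (∑ i ∈ Finset.range (N+1), (t / R) ^ i * φ i w) * u (R • w) := by
        simp only [← integral_const_mul]
        rw [← integral_finsetSum _ (fun i _ => (i1 i).const_mul _)]
        congr 1; funext w; rw [Finset.sum_mul]
        exact Finset.sum_congr rfl fun i _ => by ring
      have i3 : Integrable (fun w => (∑ i ∈ Finset.range (N+1), (t / R) ^ i * φ i w) * u (R • w)) := by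
        have : Integrable (fun w => ∑ i ∈ Finset.range (N+1), (t / R) ^ i * (φ i w * u (R • w))) :=
          integrable_finset_sum _ (fun i _ => (i1 i).const_mul _)
        refine this.congr (Eventually.of_forall fun w => ?_)
        simp only [Finset.sum_mul]
        exact Finset.sum_congr rfl fun i _ => by ring
      have e2 : ∀ a b c : ℝ, a - b - (c - b) = -(c - a) := fun a b c => by ring
      rw [e2, e, norm_neg, ← integral_sub i2 i3]
      have hball : ∀ w, w ∉ closedBall (0 : EE n) 3 →
          PhiK m n (w - (t / R) • θ) * u (R • w) - (∑ i ∈ Finset.range (N+1), (t / R) ^ i * φ i w) * u (R • w) = 0 := by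
        intro w hw
        have h3 : 3 < ‖w‖ := by simpa using hw
        have h4 := norm_sub_norm_le w ((t / R) • θ)
        rw [norm_smul, hθ, Real.norm_eq_abs] at h4
        rw [PhiK_supp (by linarith), Finset.sum_eq_zero (fun i _ => by rw [hφ0 i w (by linarith), mul_zero])]
        ring
      rw [← setIntegral_eq_integral_of_forall_compl_eq_zero hball]
      refine (norm_integral_le_integral_norm _).trans ?_
      have hci : Integrable (fun y : EE n => |u (R • y)|) (volume.restrict (closedBall 0 3)) :=
        ContinuousOn.integrableOn_compact (isCompact_closedBall _ _) (by fun_prop)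
      calc _ ≤ ∫ w in closedBall (0 : EE n) 3, D * |t / R| ^ (N+1) * |u (R • w)| := by
            refine integral_mono (i2.sub i3).norm.integrableOn (hci.const_mul _) fun w => ?_
            show ‖PhiK m n (w - (t / R) • θ) * u (R • w) - _ * u (R • w)‖ ≤ _
            rw [← sub_mul, norm_mul, Real.norm_eq_abs, Real.norm_eq_abs]
            exact mul_le_mul_of_nonneg_right (hD _ _) (abs_nonneg _)
        _ = D * |t / R| ^ (N+1) * ∫ w in closedBall (0 : EE n) 3, |u (R • w)| := integral_const_mul _ _
        _ ≤ D * |t / R| ^ (N+1) * (C * R ^ N) := by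
            gcongr; exact hC R hR
        _ = D * |t| ^ (N+1) * C * R⁻¹ := by
            rw [abs_div, abs_of_pos hR0, div_pow]
            field_simp; ring
    have := hz.add hl
    simpa using this

end

section
set_option linter.all false
open MeasureTheory Real Filter Metric
open scoped ENNReal Topology

lemma exp_jensen {α : Type*} [MeasurableSpace α] (μ : Measure α) {φ g : α → ℝ} (hφ0 : ∀ᵐ a ∂μ, 0 ≤ φ a)
    (hφ : Integrable φ μ) (h1 : ∫ a, φ a ∂μ ≤ 1) (hg : Integrable (fun a => g a * φ a) μ)
    (he : Integrable (fun a => Real.exp (g a) * φ a) μ) :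
    Real.exp (∫ a, g a * φ a ∂μ) ≤ 1 + ∫ a, Real.exp (g a) * φ a ∂μ := by
  set A := ∫ a, g a * φ a ∂μ with hA
  set p := ∫ a, φ a ∂μ with hp
  have hp0 : 0 ≤ p := integral_nonneg_of_ae hφ0
  have hi : Integrable (fun a => Real.exp A * ((1 - A) * φ a + g a * φ a)) μ :=
    ((hφ.const_mul _).add hg).const_mul _
  have h2 : ∫ a, Real.exp A * ((1 - A) * φ a + g a * φ a) ∂μ ≤ ∫ a, Real.exp (g a) * φ a ∂μ := by
    refine integral_mono_ae hi he ?_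
    filter_upwards [hφ0] with a ha
    have h3 : Real.exp A * (1 - A + g a) ≤ Real.exp (g a) := by
      have := Real.add_one_le_exp (g a - A)
      calc _ ≤ Real.exp A * Real.exp (g a - A) := by gcongr; linarith
        _ = _ := by rw [← Real.exp_add]; ring_nf
    calc _ = (Real.exp A * (1 - A + g a)) * φ a := by ring
      _ ≤ _ := mul_le_mul_of_nonneg_right h3 ha
  rw [integral_const_mul, integral_add (hφ.const_mul _) hg, integral_const_mul, ← hp, ← hA] at h2
  have h4 : Real.exp A * (1 - A) ≤ 1 := by
    have := Real.add_one_le_exp (-A)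
    calc _ ≤ Real.exp A * Real.exp (-A) := by gcongr; linarith
      _ = 1 := by rw [← Real.exp_add]; simp
  have h5 : (1 - p) * (Real.exp A * (1 - A)) ≤ 1 := by
    nlinarith
  nlinarith [Real.exp_pos A]

noncomputable def VV {n : ℕ} (f : EE n → ℝ) (s : ℝ) : ℝ := ∫ y, min 0 (Real.log ‖y‖ - s) * f y

lemma VV_int {n : ℕ} (hn : 2 ≤ n) {f : EE n → ℝ} (fc : Continuous f) (fi : Integrable f) (s : ℝ) :
    Integrable (fun y => min 0 (Real.log ‖y‖ - s) * f y) := by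
  obtain ⟨M, hM0, hM⟩ := bdd_on_ball fc 1
  have h0 := ((integrable_indicator_iff measurableSet_ball).2 (log_intOn hn (0 : EE n) 1)).mul_const M
  have hmeas : Measurable (fun y : EE n => min 0 (Real.log ‖y‖ - s) * f y) := by
    have := fc.measurable
    fun_prop
  refine Integrable.mono' (h0.add (fi.abs.const_mul |s|)) hmeas.aestronglyMeasurable ?_
  refine Eventually.of_forall fun y => ?_
  rw [norm_mul, Real.norm_eq_abs, Real.norm_eq_abs]
  simp only [Pi.add_apply]
  by_cases h : y ∈ ball (0 : EE n) 1
  · rw [Set.indicator_of_mem h]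
    have h2 := hM y (by simpa using (mem_ball_zero_iff.1 h).le)
    have h3 : |min 0 (Real.log ‖y‖ - s)| ≤ |Real.log ‖y‖| + |s| := by
      refine le_trans ?_ (abs_sub (Real.log ‖y‖) s)
      rw [abs_of_nonpos (min_le_left _ _), ← max_neg_neg]
      exact max_le (by simp) (neg_le_abs _)
    simp only [zero_sub, norm_neg]
    calc _ ≤ (|Real.log ‖y‖| + |s|) * |f y| := by gcongr
      _ = |Real.log ‖y‖| * |f y| + |s| * |f y| := by ring
      _ ≤ _ := by gcongr
  · rw [Set.indicator_of_notMem h, zero_mul, zero_add]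
    have h2 : 1 ≤ ‖y‖ := by simpa using h
    have h3 := Real.log_nonneg h2
    refine mul_le_mul_of_nonneg_right ?_ (abs_nonneg _)
    rw [abs_of_nonpos (min_le_left _ _), ← max_neg_neg]
    exact max_le (by simp) (by linarith [le_abs_self s])

lemma VV_lip {n : ℕ} (hn : 2 ≤ n) {f : EE n → ℝ} (fc : Continuous f) (fi : Integrable f) (s t : ℝ) :
    |VV f s - VV f t| ≤ |s - t| * ∫ y, |f y| := by
  unfold VV
  rw [← integral_sub (VV_int hn fc fi s) (VV_int hn fc fi t), ← Real.norm_eq_abs, ← integral_const_mul]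
  refine norm_integral_le_of_norm_le (fi.abs.const_mul _) (Eventually.of_forall fun y => ?_)
  rw [← sub_mul, norm_mul, Real.norm_eq_abs, Real.norm_eq_abs]
  refine mul_le_mul_of_nonneg_right ?_ (abs_nonneg _)
  have := abs_min_sub_min_le_max 0 (Real.log ‖y‖ - s) 0 (Real.log ‖y‖ - t)
  refine this.trans ?_
  rw [sub_self, abs_zero]
  refine max_le (abs_nonneg _) ?_
  rw [abs_sub_comm s t]
  ring_nf; exact le_rfl

lemma VV_bd {n : ℕ} (hn : 2 ≤ n) {f : EE n → ℝ} (fc : Continuous f) (fi : Integrable f) (s : ℝ) :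
    |VV f s| ≤ |VV f 0| + |s| * ∫ y, |f y| := by
  have := VV_lip hn fc fi s 0
  rw [sub_zero] at this
  linarith [abs_sub_abs_le_abs_sub (VV f s) (VV f 0)]

lemma VV_cont {n : ℕ} (hn : 2 ≤ n) {f : EE n → ℝ} (fc : Continuous f) (fi : Integrable f) :
    Continuous (VV f) := by
  have : LipschitzWith (Real.toNNReal (∫ y, |f y|)) (VV f) := by
    refine LipschitzWith.of_dist_le_mul fun s t => ?_
    rw [Real.dist_eq, Real.dist_eq, Real.coe_toNNReal _ (integral_nonneg fun y => abs_nonneg (f y)), mul_comm]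
    exact VV_lip hn fc fi s t
  exact this.continuous

/-- kernel -/
noncomputable def kw {n : ℕ} (x y : EE n) : ℝ := max (Real.log ‖x‖) (Real.log ‖y‖) - Real.log ‖x - y‖

noncomputable def ww {n : ℕ} (f : EE n → ℝ) (x : EE n) : ℝ := lpot f x - VV f (Real.log ‖x‖)

lemma kw_id {n : ℕ} {x y : EE n} (hy : y ≠ 0) (hyx : y ≠ x) :
    Real.log (‖y‖ / ‖x - y‖) - min 0 (Real.log ‖y‖ - Real.log ‖x‖) = kw x y := by
  rw [Real.log_div (norm_ne_zero_iff.2 hy) (norm_ne_zero_iff.2 (sub_ne_zero.2 hyx.symm))]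
  unfold kw
  rcases le_total (Real.log ‖x‖) (Real.log ‖y‖) with h | h
  · rw [max_eq_right h, min_eq_left (by linarith)]; ring
  · rw [max_eq_left h, min_eq_right (by linarith)]; ring

lemma kw_int {n : ℕ} (hn : 2 ≤ n) {f : EE n → ℝ} (fc : Continuous f) (fi : Integrable f) (x : EE n) :
    Integrable (fun y => kw x y * f y) ∧ ww f x = ∫ y, kw x y * f y := by
  have h1 := lp_integrable hn fc fi x
  have h2 := VV_int hn fc fi (Real.log ‖x‖)
  have e : (fun y => Real.log (‖y‖ / ‖x - y‖) * f y - min 0 (Real.log ‖y‖ - Real.log ‖x‖) * f y)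
      =ᵐ[volume] fun y => kw x y * f y := by
    filter_upwards [ae_ne_pt hn 0, ae_ne_pt hn x] with y hy hyx
    rw [← sub_mul, kw_id hy hyx]
  refine ⟨(h1.sub h2).congr e, ?_⟩
  unfold ww lpot VV
  rw [← integral_sub h1 h2]
  exact integral_congr_ae e

lemma kw_eq {n : ℕ} {x y : EE n} (hx : x ≠ 0) (hyx : y ≠ x) (hy : y ≠ 0) :
    kw x y = Real.log (max ‖x‖ ‖y‖ / ‖x - y‖) := by
  have h1 := norm_pos_iff.2 hx
  have h2 := norm_pos_iff.2 (sub_ne_zero.2 hyx.symm)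
  have h3 := norm_pos_iff.2 hy
  rw [Real.log_div (by positivity) h2.ne']
  unfold kw
  rcases le_total ‖x‖ ‖y‖ with h | h
  · rw [max_eq_right h, max_eq_right (Real.log_le_log h1 h)]
  · rw [max_eq_left h, max_eq_left (Real.log_le_log h3 h)]

lemma kw_ge {n : ℕ} {x y : EE n} (hx : x ≠ 0) (hyx : y ≠ x) (hy : y ≠ 0) : - Real.log 2 ≤ kw x y := by
  rw [kw_eq hx hyx hy, ← Real.log_inv]
  have h1 := norm_pos_iff.2 hx
  have h2 := norm_pos_iff.2 (sub_ne_zero.2 hyx.symm)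
  apply Real.log_le_log (by norm_num)
  rw [le_div_iff₀ h2]
  have := norm_sub_le x y
  have := le_max_left ‖x‖ ‖y‖
  have := le_max_right ‖x‖ ‖y‖
  linarith

lemma kw_le {n : ℕ} {x y : EE n} (hx : x ≠ 0) (hyx : y ≠ x) (hy : y ≠ 0) (h : 2 * ‖y‖ ≤ ‖x‖) :
    kw x y ≤ Real.log 2 := by
  rw [kw_eq hx hyx hy]
  have h1 := norm_pos_iff.2 hx
  have h2 := norm_pos_iff.2 (sub_ne_zero.2 hyx.symm)
  apply Real.log_le_log (by positivity)
  rw [div_le_iff₀ h2]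
  have h3 := norm_sub_norm_le x y
  refine max_le (by linarith) (by linarith)

/-- far-field hypotheses -/
structure Far {n : ℕ} (f : EE n → ℝ) (κ R1 : ℝ) : Prop where
  one : 1 ≤ R1
  kpos : 0 < κ
  nonneg : ∀ y, R1 ≤ ‖y‖ → 0 ≤ f y
  mass : ∫ y in {y : EE n | R1 ≤ ‖y‖}, κ * f y ≤ 1

lemma meas_far {n : ℕ} (R : ℝ) : MeasurableSet {y : EE n | R ≤ ‖y‖} :=
  measurableSet_le measurable_const measurable_norm

lemma Far.mono {n : ℕ} {f : EE n → ℝ} {κ R1 R2 : ℝ} (h : Far f κ R1) (fi : Integrable f) (h12 : R1 ≤ R2) :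
    Far f κ R2 := by
  refine ⟨h.one.trans h12, h.kpos, fun y hy => h.nonneg y (h12.trans hy), ?_⟩
  refine le_trans ?_ h.mass
  refine setIntegral_mono_set (fi.const_mul κ).integrableOn ?_ ?_
  · filter_upwards [ae_restrict_mem (meas_far R1)] with y hy
    exact mul_nonneg h.kpos.le (h.nonneg y hy)
  · exact Eventually.of_forall fun y hy => h12.trans hy

lemma ww_lower {n : ℕ} (hn : 2 ≤ n) {f : EE n → ℝ} (fc : Continuous f) (fi : Integrable f) {κ R1 : ℝ}
    (h : Far f κ R1) {x : EE n} (hx : 2 * R1 ≤ ‖x‖) : -(Real.log 2 * ∫ y, |f y|) ≤ ww f x := by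
  obtain ⟨h1, h2⟩ := kw_int hn fc fi x
  have hl2 : 0 < Real.log 2 := Real.log_pos (by norm_num)
  rw [h2, ← integral_const_mul, ← integral_neg]
  have hx0 : x ≠ 0 := norm_pos_iff.1 (by linarith [h.one])
  refine integral_mono_ae (fi.abs.const_mul _).neg h1 ?_
  filter_upwards [ae_ne_pt hn 0, ae_ne_pt hn x] with y hy hyx
  have h3 := kw_ge hx0 hyx hy
  rcases le_or_gt R1 ‖y‖ with hy1 | hy1
  · have := h.nonneg y hy1
    rw [abs_of_nonneg this]; nlinarith
  · have h4 := kw_le hx0 hyx hy (by linarith)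
    have h5 : |kw x y * f y| ≤ Real.log 2 * |f y| := by
      rw [abs_mul]; gcongr; exact abs_le.2 ⟨h3, h4⟩
    exact (abs_le.1 h5).1

noncomputable def rat {n : ℕ} (x y : EE n) : ℝ := max ‖x‖ ‖y‖ / ‖x - y‖

lemma rat_nonneg {n : ℕ} (x y : EE n) : 0 ≤ rat x y := by unfold rat; positivity

lemma rat_meas {n : ℕ} : Measurable (fun p : EE n × EE n => rat p.1 p.2) := by
  unfold rat; fun_prop

set_option maxHeartbeats 400000 in
lemma ww_upper {n : ℕ} (hn : 2 ≤ n) {f : EE n → ℝ} (fc : Continuous f) (fi : Integrable f) {κ R1 : ℝ}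
    (h : Far f κ R1) {x : EE n} (hx : 2 * R1 ≤ ‖x‖) :
    ENNReal.ofReal (Real.exp (κ * ww f x)) ≤ ENNReal.ofReal (Real.exp (κ * (Real.log 2 * ∫ y, |f y|))) *
      (2 + ∫⁻ y in {y : EE n | R1 ≤ ‖y‖}, ENNReal.ofReal (rat x y * (κ * f y))) := by
  obtain ⟨h1, h2⟩ := kw_int hn fc fi x
  have hk := h.kpos
  have hx0 : x ≠ 0 := norm_pos_iff.1 (by linarith [h.one])
  have hl2 : 0 < Real.log 2 := Real.log_pos (by norm_num)
  set B := {y : EE n | R1 ≤ ‖y‖} with hB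
  have hBm : MeasurableSet B := meas_far R1
  by_cases htop : ∫⁻ y in B, ENNReal.ofReal (rat x y * (κ * f y)) = ⊤
  · rw [htop]; simp [ENNReal.mul_top, Real.exp_pos]
  have rm : Measurable (fun y => rat x y) := by unfold rat; fun_prop
  have rfm : AEStronglyMeasurable (fun y => rat x y * (κ * f y)) (volume.restrict B) :=
    (rm.mul (fc.measurable.const_mul κ)).aestronglyMeasurable
  have pos : ∀ᵐ y ∂(volume.restrict B), 0 ≤ κ * f y := by
    filter_upwards [ae_restrict_mem hBm] with y hy
    exact mul_nonneg hk.le (h.nonneg y hy)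
  have pos2 : ∀ᵐ y ∂(volume.restrict B), 0 ≤ rat x y * (κ * f y) := by
    filter_upwards [pos] with y hy
    exact mul_nonneg (rat_nonneg x y) hy
  have ri : Integrable (fun y => rat x y * (κ * f y)) (volume.restrict B) :=
    (lintegral_ofReal_ne_top_iff_integrable rfm pos2).1 htop
  have phi : Integrable (fun y => κ * f y) (volume.restrict B) := (fi.const_mul κ).integrableOn
  have hne : ∀ᵐ y ∂(volume.restrict B), y ≠ 0 ∧ y ≠ x :=
    ae_restrict_of_ae ((ae_ne_pt hn 0).and (ae_ne_pt hn x))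
  have km : Measurable (fun y => max 0 (kw x y)) := by unfold kw; fun_prop
  have exple : ∀ y : EE n, y ≠ 0 → y ≠ x → Real.exp (max 0 (kw x y)) ≤ 1 + rat x y := by
    intro y hy hyx
    have p1 : 0 < rat x y := by
      have := norm_pos_iff.2 hx0
      have := norm_pos_iff.2 (sub_ne_zero.2 hyx.symm)
      unfold rat; positivity
    rcases le_total (kw x y) 0 with h3 | h3
    · rw [max_eq_left h3, Real.exp_zero]; linarith
    · rw [max_eq_right h3, kw_eq hx0 hyx hy]
      show Real.exp (Real.log (rat x y)) ≤ _
      rw [Real.exp_log p1]; linarith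
  have hg : Integrable (fun y => max 0 (kw x y) * (κ * f y)) (volume.restrict B) := by
    refine Integrable.mono' ((h1.norm.const_mul κ).integrableOn (s := B))
      (km.mul (fc.measurable.const_mul κ)).aestronglyMeasurable ?_
    refine Eventually.of_forall fun y => ?_
    rw [norm_mul, norm_mul, norm_mul, Real.norm_eq_abs, Real.norm_eq_abs, Real.norm_eq_abs, Real.norm_eq_abs, abs_of_pos hk]
    have : |max 0 (kw x y)| ≤ |kw x y| := by
      rw [abs_of_nonneg (le_max_left _ _)]; exact max_le (abs_nonneg _) (le_abs_self _)
    calc _ ≤ |kw x y| * (κ * |f y|) := by gcongr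
      _ = _ := by ring
  have hei : Integrable (fun y => (1 + rat x y) * (κ * f y)) (volume.restrict B) := by
    refine (phi.add ri).congr (Eventually.of_forall fun y => ?_)
    simp only [Pi.add_apply]; ring
  have he : Integrable (fun y => Real.exp (max 0 (kw x y)) * (κ * f y)) (volume.restrict B) := by
    refine Integrable.mono' hei
      ((Real.measurable_exp.comp km).mul (fc.measurable.const_mul κ)).aestronglyMeasurable ?_
    filter_upwards [pos, hne] with y hy hne
    rw [norm_mul, Real.norm_eq_abs, Real.norm_eq_abs, abs_of_pos (Real.exp_pos _), abs_of_nonneg hy]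
    exact mul_le_mul_of_nonneg_right (exple y hne.1 hne.2) hy
  have hJ := exp_jensen (volume.restrict B) pos phi h.mass hg he
  have hJ2 : ∫ y in B, Real.exp (max 0 (kw x y)) * (κ * f y) ≤ 1 + ∫ y in B, rat x y * (κ * f y) := by
    calc _ ≤ ∫ y in B, (1 + rat x y) * (κ * f y) := by
          refine integral_mono_ae he hei ?_
          filter_upwards [pos, hne] with y hy hne
          exact mul_le_mul_of_nonneg_right (exple y hne.1 hne.2) hy
      _ = (∫ y in B, κ * f y) + ∫ y in B, rat x y * (κ * f y) := by
          rw [← integral_add phi ri]; congr 1; funext y; ring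
      _ ≤ _ := by linarith [h.mass]
  have hw : κ * ww f x ≤ κ * (Real.log 2 * ∫ y, |f y|) + ∫ y in B, max 0 (kw x y) * (κ * f y) := by
    have hc : Integrable (fun y => κ * (kw x y * f y)) := h1.const_mul κ
    rw [h2, ← integral_const_mul, ← integral_add_compl hBm hc]
    have a1 : ∫ y in B, κ * (kw x y * f y) ≤ ∫ y in B, max 0 (kw x y) * (κ * f y) := by
      refine integral_mono_ae hc.integrableOn hg ?_
      filter_upwards [pos] with y hy
      calc κ * (kw x y * f y) = kw x y * (κ * f y) := by ring
        _ ≤ _ := mul_le_mul_of_nonneg_right (le_max_right _ _) hy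
    have a2 : ∫ y in Bᶜ, κ * (kw x y * f y) ≤ κ * (Real.log 2 * ∫ y, |f y|) := by
      have hd : Integrable (fun y => κ * (Real.log 2 * |f y|)) := (fi.abs.const_mul _).const_mul _
      calc _ ≤ ∫ y in Bᶜ, κ * (Real.log 2 * |f y|) := by
            refine integral_mono_ae hc.integrableOn hd.integrableOn ?_
            filter_upwards [ae_restrict_mem hBm.compl, ae_restrict_of_ae ((ae_ne_pt hn 0).and (ae_ne_pt hn x))] with y hy hne
            have hy' : ‖y‖ < R1 := by simpa [hB] using hy
            have h4 := kw_le hx0 hne.2 hne.1 (by linarith)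
            have h3 := kw_ge hx0 hne.2 hne.1
            have h5 : |kw x y * f y| ≤ Real.log 2 * |f y| := by
              rw [abs_mul]; gcongr; exact abs_le.2 ⟨h3, h4⟩
            exact mul_le_mul_of_nonneg_left ((le_abs_self _).trans h5) hk.le
        _ ≤ ∫ y, κ * (Real.log 2 * |f y|) := setIntegral_le_integral hd
            (Eventually.of_forall fun y => by positivity)
        _ = _ := by rw [integral_const_mul, integral_const_mul]
    linarith
  have fin : Real.exp (κ * ww f x) ≤ Real.exp (κ * (Real.log 2 * ∫ y, |f y|)) *
      (2 + ∫ y in B, rat x y * (κ * f y)) := by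
    refine (Real.exp_le_exp.2 hw).trans ?_
    rw [Real.exp_add]
    gcongr
    linarith
  refine (ENNReal.ofReal_le_ofReal fin).trans ?_
  rw [ENNReal.ofReal_mul (Real.exp_pos _).le, ENNReal.ofReal_add (by norm_num) (integral_nonneg_of_ae pos2),
    ofReal_integral_eq_lintegral_ofReal ri pos2]
  simp

end

section
set_option linter.all false
open MeasureTheory Real Filter Metric
open scoped ENNReal Topology

lemma polar {n : ℕ} (hn : 2 ≤ n) {F : EE n → ℝ≥0∞} (hF : Measurable F) :
    ∫⁻ x, F x = ∫⁻ θ, (∫⁻ r in Set.Ioi (0:ℝ), ENNReal.ofReal (r ^ (n - 1)) * F (r • (θ : EE n))) ∂(sphereMeasure n) := by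
  have : Nonempty (Fin n) := ⟨⟨0, by omega⟩⟩
  have hms : MeasurableSet ({0}ᶜ : Set (EE n)) := (measurableSet_singleton _).compl
  have mp := (volume : Measure (EE n)).measurePreserving_homeomorphUnitSphereProd
  have hfr : Module.finrank ℝ (EE n) = n := by simp
  rw [hfr] at mp
  have h1 : ∫⁻ x, F x = ∫⁻ x : ({0}ᶜ : Set (EE n)), F x ∂((volume : Measure (EE n)).comap Subtype.val) := by
    rw [lintegral_subtype_comap hms, restrict_compl_singleton]
  have h2 := mp.lintegral_comp_emb (Homeomorph.measurableEmbedding _)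
    (fun p => F ((homeomorphUnitSphereProd (EE n)).symm p : EE n))
  simp only [Homeomorph.symm_apply_apply] at h2
  have hFm : Measurable (fun p : sphere (0:EE n) 1 × Set.Ioi (0:ℝ) => F ((homeomorphUnitSphereProd (EE n)).symm p : EE n)) :=
    hF.comp (measurable_subtype_coe.comp (homeomorphUnitSphereProd (EE n)).symm.measurable)
  rw [h1, h2, lintegral_prod _ hFm.aemeasurable]
  refine lintegral_congr fun θ => ?_
  simp only [homeomorphUnitSphereProd_symm_apply_coe]
  have hFm2 : Measurable (fun r : Set.Ioi (0:ℝ) => F ((r:ℝ) • (θ : EE n))) := by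
    refine hF.comp ?_
    fun_prop
  rw [Measure.volumeIoiPow, lintegral_withDensity_eq_lintegral_mul _ (by fun_prop) hFm2]
  exact lintegral_subtype_comap measurableSet_Ioi (fun r : ℝ => ENNReal.ofReal (r ^ (n - 1)) * F (r • (θ : EE n)))

lemma polar_ae {n : ℕ} (hn : 2 ≤ n) {F : EE n → ℝ≥0∞} (hF : Measurable F) (h : ∫⁻ x, F x ≠ ⊤) :
    ∀ᵐ θ : sphere (0:EE n) 1 ∂(sphereMeasure n), ∫⁻ r in Set.Ioi (0:ℝ), ENNReal.ofReal (r ^ (n - 1)) * F (r • (θ : EE n)) < ⊤ := by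
  rw [polar hn hF] at h
  refine ae_lt_top ?_ h
  have : Measurable (fun p : sphere (0:EE n) 1 × ℝ => ENNReal.ofReal (p.2 ^ (n - 1)) * F (p.2 • (p.1 : EE n))) := by
    refine Measurable.mul (by fun_prop) (hF.comp ?_)
    fun_prop
  exact this.lintegral_prod_right'

lemma polar_ae_neg {n : ℕ} (hn : 2 ≤ n) {F : EE n → ℝ≥0∞} (hF : Measurable F) (h : ∫⁻ x, F x ≠ ⊤) :
    ∀ᵐ θ : sphere (0:EE n) 1 ∂(sphereMeasure n), ∫⁻ r in Set.Ioi (0:ℝ), ENNReal.ofReal (r ^ (n - 1)) * F (r • (-(θ : EE n))) < ⊤ := by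
  have := polar_ae hn (F := fun x => F (-x)) (hF.comp measurable_neg) (by
    rwa [lintegral_neg_eq_self (fun x => F x)])
  simpa only [smul_neg] using this

lemma scale_inv {n : ℕ} (hn : 2 ≤ n) : ∃ K : ℝ≥0∞, K ≠ ⊤ ∧ ∀ (ρ : ℝ) (y : EE n), 0 < ρ →
    ENNReal.ofReal ρ * ∫⁻ x in ball y ρ, ENNReal.ofReal ‖x - y‖⁻¹ ≤ K * volume (ball y ρ) := by
  have : Nonempty (Fin n) := ⟨⟨0, by omega⟩⟩
  set I1 := ∫⁻ x in ball (0 : EE n) 1, ENNReal.ofReal ‖x‖⁻¹ with hI1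
  have hI : I1 ≠ ⊤ := by
    rw [hI1, lintegral_ofReal_ne_top_iff_integrable]
    · exact inv_norm_intOn hn 1
    · exact Measurable.aestronglyMeasurable (by fun_prop)
    · exact Eventually.of_forall fun x => by positivity
  have hv0 : volume (ball (0 : EE n) 1) ≠ 0 := (measure_ball_pos _ _ one_pos).ne'
  have hvt : volume (ball (0 : EE n) 1) ≠ ⊤ := measure_ball_lt_top.ne
  refine ⟨I1 / volume (ball (0 : EE n) 1), ENNReal.div_ne_top hI hv0, fun ρ y hρ => ?_⟩
  have hfr : Module.finrank ℝ (EE n) = n := by simp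
  set G : EE n → ℝ≥0∞ := (ball (0 : EE n) ρ).indicator (fun x => ENNReal.ofReal ‖x‖⁻¹) with hG
  have hGm : Measurable G := Measurable.indicator (by fun_prop) measurableSet_ball
  have e1 : ∫⁻ x in ball y ρ, ENNReal.ofReal ‖x - y‖⁻¹ = ∫⁻ x, G x := by
    rw [← lintegral_sub_right_eq_self G y, ← lintegral_indicator measurableSet_ball]
    refine lintegral_congr fun x => ?_
    simp only [hG, Set.indicator, mem_ball, dist_eq_norm, sub_zero]
  have e2 : ENNReal.ofReal |(ρ ^ n)⁻¹| * ∫⁻ x, G x = ∫⁻ x, G (ρ • x) := by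
    have := Measure.map_addHaar_smul (volume : Measure (EE n)) hρ.ne'
    rw [hfr] at this
    rw [← lintegral_map hGm (by fun_prop : Measurable fun x : EE n => ρ • x), this, lintegral_smul_measure, smul_eq_mul]
  have e3 : ∫⁻ x, G (ρ • x) = ENNReal.ofReal ρ⁻¹ * I1 := by
    rw [hI1, ← lintegral_indicator measurableSet_ball, ← lintegral_const_mul _ (Measurable.indicator (by fun_prop) measurableSet_ball)]
    refine lintegral_congr fun x => ?_
    have : ρ * ‖x‖ < ρ ↔ ‖x‖ < 1 := by
      constructor
      · intro h; by_contra h'; push Not at h'; nlinarith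
      · intro h; nlinarith
    simp only [hG, Set.indicator, mem_ball, dist_eq_norm, sub_zero, norm_smul, Real.norm_eq_abs, abs_of_pos hρ, this]
    split_ifs
    · rw [mul_inv, ENNReal.ofReal_mul (by positivity)]
    · simp
  have hp : 0 < ρ ^ n := by positivity
  have e4 : ∫⁻ x, G x = ENNReal.ofReal (ρ ^ n) * (ENNReal.ofReal ρ⁻¹ * I1) := by
    rw [← e3, ← e2, ← mul_assoc, ← ENNReal.ofReal_mul hp.le, abs_of_pos (by positivity), mul_inv_cancel₀ hp.ne']
    simp
  have e5 : volume (ball y ρ) = ENNReal.ofReal (ρ ^ n) * volume (ball (0 : EE n) 1) := by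
    rw [Measure.addHaar_ball volume y hρ.le, hfr]
  rw [e1, e4, e5]
  refine le_of_eq ?_
  have e6 : ENNReal.ofReal ρ * ENNReal.ofReal ρ⁻¹ = 1 := by
    rw [← ENNReal.ofReal_mul hρ.le, mul_inv_cancel₀ hρ.ne']; simp
  calc _ = (ENNReal.ofReal ρ * ENNReal.ofReal ρ⁻¹) * (ENNReal.ofReal (ρ ^ n) * I1) := by ring
    _ = ENNReal.ofReal (ρ ^ n) * (I1 / volume (ball (0 : EE n) 1) * volume (ball (0 : EE n) 1)) := by
      rw [e6, one_mul, ENNReal.div_mul_cancel hv0 hvt]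
    _ = _ := by ring

end

section
set_option linter.all false
open MeasureTheory Real Filter Metric
open scoped ENNReal Topology

lemma rat_cases {n : ℕ} {x y : EE n} (hy : 0 < ‖y‖) : rat x y ≤ 4 ∨
    (x ∈ ball y (‖y‖/3) ∧ ‖x‖ ≤ 4/3*‖y‖ ∧ rat x y ≤ 4 * (‖y‖/3 * ‖x - y‖⁻¹)) := by
  have hm : 0 < max ‖x‖ ‖y‖ := lt_max_of_lt_right hy
  by_cases h : max ‖x‖ ‖y‖ ≤ 4 * ‖x - y‖
  · left
    unfold rat
    exact div_le_of_le_mul₀ (norm_nonneg _) (by norm_num) h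
  · right
    push Not at h
    have h1 : ‖x‖ ≤ ‖x - y‖ + ‖y‖ := by simpa using norm_add_le (x - y) y
    have h2 : ‖x‖ ≤ 4/3*‖y‖ := by
      rcases max_cases ‖x‖ ‖y‖ with ⟨h3, h4⟩ | ⟨h3, h4⟩ <;> rw [h3] at h <;> linarith
    have h5 : max ‖x‖ ‖y‖ ≤ 4/3*‖y‖ := max_le h2 (by linarith)
    refine ⟨?_, h2, ?_⟩
    · rw [mem_ball, dist_eq_norm]; linarith
    · unfold rat
      rw [div_eq_mul_inv, ← mul_assoc]
      exact mul_le_mul_of_nonneg_right (by linarith) (by positivity)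

lemma inner_bd {n : ℕ} {R1 : ℝ} (hR : 1 ≤ R1) {W : ℝ → ℝ≥0∞} (hW : Measurable W) {D : ℝ≥0∞}
    (hdb : ∀ r s, R1 ≤ r → r/2 ≤ s → s ≤ 2*r → W s ≤ D * W r) {K : ℝ≥0∞}
    (hK : ∀ (ρ : ℝ) (y : EE n), 0 < ρ →
    ENNReal.ofReal ρ * ∫⁻ x in ball y ρ, ENNReal.ofReal ‖x - y‖⁻¹ ≤ K * volume (ball y ρ))
    {y : EE n} (hy : R1 ≤ ‖y‖) :
    ∫⁻ x in {x : EE n | 2 * R1 ≤ ‖x‖}, W ‖x‖ * ENNReal.ofReal (rat x y) ≤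
      (4 + 4 * D * K * D) * ∫⁻ x in {x : EE n | R1 ≤ ‖x‖}, W ‖x‖ := by
  have hy0 : 0 < ‖y‖ := by linarith
  have hWm : Measurable (fun x : EE n => W ‖x‖) := hW.comp measurable_norm
  set J := ∫⁻ x in {x : EE n | R1 ≤ ‖x‖}, W ‖x‖ with hJ
  have hsub : {x : EE n | 2 * R1 ≤ ‖x‖} ⊆ {x : EE n | R1 ≤ ‖x‖} := fun x hx => by
    simp only [Set.mem_setOf_eq] at hx ⊢; linarith
  have h4 : ∫⁻ x in {x : EE n | 2 * R1 ≤ ‖x‖}, 4 * W ‖x‖ ≤ 4 * J := by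
    rw [lintegral_const_mul _ hWm]
    gcongr
    exact lintegral_mono_set hsub
  by_cases hyy : ‖y‖ < 3/2 * R1
  · calc _ ≤ ∫⁻ x in {x : EE n | 2 * R1 ≤ ‖x‖}, 4 * W ‖x‖ := by
          refine setLIntegral_mono (hWm.const_mul _) fun x hx => ?_
          simp only [Set.mem_setOf_eq] at hx
          rw [mul_comm]
          gcongr
          rcases rat_cases (x := x) hy0 with h | h
          · simpa using ENNReal.ofReal_le_ofReal h
          · exfalso; linarith [h.2.1]
      _ ≤ 4 * J := h4
      _ ≤ _ := by gcongr; exact le_self_add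
  push Not at hyy
  set ρ := ‖y‖/3 with hρ
  have hρ0 : 0 < ρ := by positivity
  have hbx : ∀ x ∈ ball y ρ, 2/3*‖y‖ ≤ ‖x‖ ∧ ‖x‖ ≤ 4/3*‖y‖ := by
    intro x hx
    rw [mem_ball, dist_eq_norm] at hx
    have h1 : ‖x‖ ≤ ‖x - y‖ + ‖y‖ := by simpa using norm_add_le (x - y) y
    have h2 : ‖y‖ ≤ ‖x - y‖ + ‖x‖ := by
      have := norm_add_le (y - x) x
      rw [norm_sub_rev] at this; simpa using this
    constructor <;> linarith
  have hgm : Measurable (fun x : EE n => ENNReal.ofReal ‖x - y‖⁻¹) := by fun_prop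
  have hbm : ∫⁻ x in ball y ρ, D * W ‖y‖ * (4 * (ENNReal.ofReal ρ * ENNReal.ofReal ‖x - y‖⁻¹)) ≤ 4 * D * K * D * J := by
    rw [lintegral_const_mul _ ((hgm.const_mul _).const_mul _), lintegral_const_mul _ (hgm.const_mul _), lintegral_const_mul _ hgm]
    calc _ ≤ D * W ‖y‖ * (4 * (K * volume (ball y ρ))) := by gcongr _ * (_ * ?_); exact hK ρ y hρ0
      _ = 4 * D * K * (W ‖y‖ * volume (ball y ρ)) := by ring
      _ = 4 * D * K * ∫⁻ x in ball y ρ, W ‖y‖ := by rw [setLIntegral_const]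
      _ ≤ 4 * D * K * ∫⁻ x in ball y ρ, D * W ‖x‖ := by
          gcongr 4 * D * K * ?_
          refine setLIntegral_mono (hWm.const_mul _) fun x hx => ?_
          have := hbx x hx
          exact hdb _ _ (by linarith) (by linarith) (by linarith)
      _ ≤ 4 * D * K * (D * J) := by
          rw [lintegral_const_mul _ hWm]
          gcongr 4 * D * K * (D * ?_)
          refine lintegral_mono_set fun x hx => ?_
          have := hbx x hx
          simp only [Set.mem_setOf_eq]; linarith
      _ = _ := by ring
  have hind : Measurable ((ball y ρ).indicator (fun x => D * W ‖y‖ * (4 * (ENNReal.ofReal ρ * ENNReal.ofReal ‖x - y‖⁻¹)))) :=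
    Measurable.indicator (((hgm.const_mul _).const_mul _).const_mul _) measurableSet_ball
  calc _ ≤ ∫⁻ x in {x : EE n | 2 * R1 ≤ ‖x‖}, (4 * W ‖x‖ + (ball y ρ).indicator (fun x => D * W ‖y‖ * (4 * (ENNReal.ofReal ρ * ENNReal.ofReal ‖x - y‖⁻¹))) x) := by
        refine setLIntegral_mono ((hWm.const_mul _).add hind) fun x hx => ?_
        rcases rat_cases (x := x) hy0 with h | ⟨h1, h2, h3⟩
        · refine le_trans ?_ le_self_add
          rw [mul_comm]
          gcongr
          simpa using ENNReal.ofReal_le_ofReal h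
        · refine le_trans ?_ le_add_self
          rw [Set.indicator_of_mem h1]
          have := hbx x h1
          refine mul_le_mul' (hdb _ _ hy (by linarith) (by linarith)) ?_
          refine (ENNReal.ofReal_le_ofReal h3).trans ?_
          rw [ENNReal.ofReal_mul (by norm_num), ENNReal.ofReal_mul hρ0.le]
          simp
    _ ≤ 4 * J + 4 * D * K * D * J := by
        rw [lintegral_add_left (hWm.const_mul _)]
        refine add_le_add h4 (le_trans (setLIntegral_le_lintegral _ _) ?_)
        rw [lintegral_indicator measurableSet_ball]
        exact hbm
    _ = _ := by ring

lemma lpot_meas {n : ℕ} {f : EE n → ℝ} (fc : Continuous f) : Measurable (lpot f) := by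
  unfold lpot
  have : StronglyMeasurable (fun p : EE n × EE n => Real.log (‖p.2‖ / ‖p.1 - p.2‖) * f p.2) := by
    refine Measurable.stronglyMeasurable ?_
    exact Measurable.mul (by fun_prop) (fc.measurable.comp measurable_snd)
  exact this.integral_prod_right.measurable

lemma ww_meas {n : ℕ} (hn : 2 ≤ n) {f : EE n → ℝ} (fc : Continuous f) (fi : Integrable f) : Measurable (ww f) := by
  unfold ww
  exact (lpot_meas fc).sub ((VV_cont hn fc fi).measurable.comp (by fun_prop))

lemma tonelli {n : ℕ} (hn : 2 ≤ n) {f : EE n → ℝ} (fc : Continuous f) (fi : Integrable f) {κ R1 : ℝ}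
    (h : Far f κ R1) {W : ℝ → ℝ≥0∞} (hW : Measurable W) {D : ℝ≥0∞} (hD : D ≠ ⊤)
    (hdb : ∀ r s, R1 ≤ r → r/2 ≤ s → s ≤ 2*r → W s ≤ D * W r)
    (hJ : ∫⁻ x in {x : EE n | R1 ≤ ‖x‖}, W ‖x‖ ≠ ⊤) :
    ∫⁻ x in {x : EE n | 2 * R1 ≤ ‖x‖}, W ‖x‖ * ENNReal.ofReal (Real.exp (κ * ww f x)) ≠ ⊤ := by
  obtain ⟨K, hKt, hK⟩ := scale_inv (n := n) hn
  have hWm : Measurable (fun x : EE n => W ‖x‖) := hW.comp measurable_norm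
  set J := ∫⁻ x in {x : EE n | R1 ≤ ‖x‖}, W ‖x‖ with hJd
  set C := ENNReal.ofReal (Real.exp (κ * (Real.log 2 * ∫ y, |f y|))) with hC
  have hsub : {x : EE n | 2 * R1 ≤ ‖x‖} ⊆ {x : EE n | R1 ≤ ‖x‖} := fun x hx => by
    have := h.one
    simp only [Set.mem_setOf_eq] at hx ⊢; linarith
  have hm2 : Measurable (fun p : EE n × EE n => W ‖p.1‖ * ENNReal.ofReal (rat p.1 p.2 * (κ * f p.2))) := by
    refine (hWm.comp measurable_fst).mul (ENNReal.measurable_ofReal.comp ?_)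
    exact rat_meas.mul ((fc.measurable.comp measurable_snd).const_mul κ)
  have hm3 : ∀ x : EE n, Measurable (fun y : EE n => ENNReal.ofReal (rat x y * (κ * f y))) := by
    intro x
    refine ENNReal.measurable_ofReal.comp (Measurable.mul (by unfold rat; fun_prop) (fc.measurable.const_mul κ))
  have hm4 : ∀ y : EE n, Measurable (fun x : EE n => W ‖x‖ * ENNReal.ofReal (rat x y)) := by
    intro x
    refine hWm.mul (ENNReal.measurable_ofReal.comp (by unfold rat; fun_prop))
  have hmass : ∫⁻ y in {y : EE n | R1 ≤ ‖y‖}, ENNReal.ofReal (κ * f y) ≤ 1 := by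
    rw [← ofReal_integral_eq_lintegral_ofReal (fi.const_mul κ).integrableOn]
    · simpa using ENNReal.ofReal_le_ofReal h.mass
    · filter_upwards [ae_restrict_mem (meas_far R1)] with y hy
      exact mul_nonneg h.kpos.le (h.nonneg y hy)
  have hm5 : Measurable (fun y : EE n => ENNReal.ofReal (κ * f y)) :=
    ENNReal.measurable_ofReal.comp (fc.measurable.const_mul κ)
  have sw : ∫⁻ x in {x : EE n | 2 * R1 ≤ ‖x‖}, ∫⁻ y in {y : EE n | R1 ≤ ‖y‖}, W ‖x‖ * ENNReal.ofReal (rat x y * (κ * f y))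
      ≤ (4 + 4 * D * K * D) * J := by
    rw [lintegral_lintegral_swap hm2.aemeasurable]
    calc _ ≤ ∫⁻ y in {y : EE n | R1 ≤ ‖y‖}, ((4 + 4 * D * K * D) * J) * ENNReal.ofReal (κ * f y) := by
          refine setLIntegral_mono ((ENNReal.measurable_ofReal.comp (fc.measurable.const_mul κ)).const_mul _) fun y hy => ?_
          calc _ = ∫⁻ x in {x : EE n | 2 * R1 ≤ ‖x‖}, (W ‖x‖ * ENNReal.ofReal (rat x y)) * ENNReal.ofReal (κ * f y) := by
                refine lintegral_congr fun x => ?_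
                rw [ENNReal.ofReal_mul (rat_nonneg _ _), mul_assoc]
            _ = (∫⁻ x in {x : EE n | 2 * R1 ≤ ‖x‖}, (W ‖x‖ * ENNReal.ofReal (rat x y))) * ENNReal.ofReal (κ * f y) := by
                rw [lintegral_mul_const _ (hm4 y)]
            _ ≤ _ := by
                gcongr
                exact inner_bd h.one hW hdb hK hy
      _ ≤ _ := by
          rw [lintegral_const_mul _ hm5]
          calc _ ≤ ((4 + 4 * D * K * D) * J) * 1 := by gcongr
            _ = _ := mul_one _
  have key : ∫⁻ x in {x : EE n | 2 * R1 ≤ ‖x‖}, W ‖x‖ * ENNReal.ofReal (Real.exp (κ * ww f x)) ≤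
      C * (2 * J + (4 + 4 * D * K * D) * J) := by
    have hmi : Measurable (fun x : EE n => ∫⁻ y in {y : EE n | R1 ≤ ‖y‖}, W ‖x‖ * ENNReal.ofReal (rat x y * (κ * f y))) :=
      hm2.lintegral_prod_right'
    have hma : Measurable (fun x : EE n => 2 * W ‖x‖ + ∫⁻ y in {y : EE n | R1 ≤ ‖y‖}, W ‖x‖ * ENNReal.ofReal (rat x y * (κ * f y))) :=
      (hWm.const_mul _).add hmi
    calc _ ≤ ∫⁻ x in {x : EE n | 2 * R1 ≤ ‖x‖}, C * (2 * W ‖x‖ + ∫⁻ y in {y : EE n | R1 ≤ ‖y‖}, W ‖x‖ * ENNReal.ofReal (rat x y * (κ * f y))) := by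
          refine setLIntegral_mono (((hWm.const_mul _).add hmi).const_mul _) fun x hx => ?_
          rw [lintegral_const_mul _ (hm3 x)]
          calc _ ≤ W ‖x‖ * (C * (2 + ∫⁻ y in {y : EE n | R1 ≤ ‖y‖}, ENNReal.ofReal (rat x y * (κ * f y)))) := by
                gcongr
                exact ww_upper hn fc fi h hx
            _ = _ := by ring
      _ ≤ _ := by
          rw [lintegral_const_mul _ hma, lintegral_add_left (hWm.const_mul _), lintegral_const_mul _ hWm]
          gcongr
          exact lintegral_mono_set hsub
  refine ne_top_of_le_ne_top ?_ key
  finiteness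

end

section
set_option linter.all false
open MeasureTheory Real Filter Metric
open scoped ENNReal Topology

lemma ray_aux {n : ℕ} {g : EE n → ℝ} {A : ℝ} (hA : 0 < A) {θ : EE n} (hθ : ‖θ‖ = 1) :
    ∫⁻ r in Set.Ici A, ENNReal.ofReal (r ^ (n - 1) * g (r • θ)) =
    ∫⁻ r in Set.Ioi (0:ℝ), ENNReal.ofReal (r ^ (n - 1)) *
      ({x : EE n | A ≤ ‖x‖}.indicator (fun x => ENNReal.ofReal (g x))) (r • θ) := by
  have e : Set.Ici A = Set.Ici A ∩ Set.Ioi (0:ℝ) := by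
    ext r; simp only [Set.mem_Ici, Set.mem_inter_iff, Set.mem_Ioi]
    exact ⟨fun h => ⟨h, by linarith⟩, fun h => h.1⟩
  rw [e, ← Measure.restrict_restrict measurableSet_Ici, ← lintegral_indicator measurableSet_Ici]
  refine setLIntegral_congr_fun measurableSet_Ioi fun r hr => ?_
  have hr0 : (0:ℝ) < r := hr
  by_cases h : A ≤ r
  · rw [Set.indicator_of_mem (show r ∈ Set.Ici A from h), Set.indicator_of_mem, ENNReal.ofReal_mul (by positivity)]
    simp only [Set.mem_setOf_eq, norm_smul, hθ, Real.norm_eq_abs, abs_of_pos hr0, mul_one]; exact h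
  · rw [Set.indicator_of_notMem (show r ∉ Set.Ici A from h), Set.indicator_of_notMem, mul_zero]
    simp only [Set.mem_setOf_eq, norm_smul, hθ, Real.norm_eq_abs, abs_of_pos hr0, mul_one]; exact h

lemma ray {n : ℕ} (hn : 2 ≤ n) {g : EE n → ℝ} (hg : Measurable g) {A : ℝ} (hA : 0 < A)
    (h : ∫⁻ x in {x : EE n | A ≤ ‖x‖}, ENNReal.ofReal (g x) ≠ ⊤) :
    ∀ᵐ θ : sphere (0:EE n) 1 ∂(sphereMeasure n),
      ∫⁻ r in Set.Ici A, ENNReal.ofReal (r ^ (n - 1) * g (r • (θ : EE n))) < ⊤ ∧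
      ∫⁻ r in Set.Ici A, ENNReal.ofReal (r ^ (n - 1) * g (r • (-(θ : EE n)))) < ⊤ := by
  set F := {x : EE n | A ≤ ‖x‖}.indicator (fun x => ENNReal.ofReal (g x)) with hF
  have hFm : Measurable F := Measurable.indicator (by fun_prop) (meas_far A)
  rw [← lintegral_indicator (meas_far A)] at h
  filter_upwards [polar_ae hn hFm h, polar_ae_neg hn hFm h] with θ h1 h2
  have hθ : ‖(θ : EE n)‖ = 1 := by simpa using θ.2
  rw [ray_aux hA hθ, ray_aux hA (by rwa [norm_neg])]
  exact ⟨h1, h2⟩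

lemma rad_fin {n : ℕ} (hn : 2 ≤ n) {W : ℝ → ℝ} (hW : Measurable W) {A : ℝ} (hA : 0 < A)
    (h : ∫⁻ r in Set.Ici A, ENNReal.ofReal (r ^ (n - 1) * W r) ≠ ⊤) :
    ∫⁻ x in {x : EE n | A ≤ ‖x‖}, ENNReal.ofReal (W ‖x‖) ≠ ⊤ := by
  have hWm : Measurable (fun x : EE n => W ‖x‖) := hW.comp measurable_norm
  rw [← lintegral_indicator (meas_far A), polar hn (Measurable.indicator (by fun_prop) (meas_far A))]
  have : ∀ θ : sphere (0:EE n) 1, (∫⁻ r in Set.Ioi (0:ℝ), ENNReal.ofReal (r ^ (n - 1)) *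
      ({x : EE n | A ≤ ‖x‖}.indicator (fun x => ENNReal.ofReal (W ‖x‖))) (r • (θ : EE n))) =
      ∫⁻ r in Set.Ici A, ENNReal.ofReal (r ^ (n - 1) * W r) := by
    intro θ
    have hθ : ‖(θ : EE n)‖ = 1 := by simpa using θ.2
    rw [← ray_aux (g := fun x => W ‖x‖) hA hθ]
    refine setLIntegral_congr_fun measurableSet_Ici fun r hr => ?_
    have : (0:ℝ) < r := lt_of_lt_of_le hA hr
    simp only [norm_smul, hθ, Real.norm_eq_abs, abs_of_pos this, mul_one]
  simp only [this, lintegral_const]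
  exact ENNReal.mul_ne_top h (measure_ne_top _ _)

lemma weighted {n : ℕ} (hn : 2 ≤ n) {f : EE n → ℝ} (fc : Continuous f) (fi : Integrable f) {κ R1 : ℝ}
    (h : Far f κ R1) (k : ℕ) {l : ℝ} (hl : 0 ≤ l)
    (hJ : ∫⁻ r in Set.Ici R1, ENNReal.ofReal (r ^ (n - 1) * ((r ^ k)⁻¹ * Real.exp (l * VV f (Real.log r)))) ≠ ⊤) :
    ∀ᵐ θ : sphere (0:EE n) 1 ∂(sphereMeasure n),
      ∫⁻ r in Set.Ici (2 * R1), ENNReal.ofReal (r ^ (n - 1) * ((r ^ k)⁻¹ * Real.exp (l * VV f (Real.log r)) * Real.exp (κ * ww f (r • (θ : EE n))))) < ⊤ ∧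
      ∫⁻ r in Set.Ici (2 * R1), ENNReal.ofReal (r ^ (n - 1) * ((r ^ k)⁻¹ * Real.exp (l * VV f (Real.log r)) * Real.exp (κ * ww f (r • (-(θ : EE n)))))) < ⊤ := by
  have hR := h.one
  set W : ℝ → ℝ := fun r => (r ^ k)⁻¹ * Real.exp (l * VV f (Real.log r)) with hW
  have hVm : Measurable (fun r => VV f (Real.log r)) := (VV_cont hn fc fi).measurable.comp Real.measurable_log
  have hWm : Measurable W := by
    refine Measurable.mul (by fun_prop) (Real.measurable_exp.comp (hVm.const_mul l))
  have hI : 0 ≤ ∫ y, |f y| := integral_nonneg fun y => abs_nonneg _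
  have J := rad_fin hn hWm (by linarith : 0 < R1) hJ
  have T := tonelli hn fc fi h (W := fun r => ENNReal.ofReal (W r)) (by fun_prop)
    (D := ENNReal.ofReal (2 ^ k * Real.exp (l * (Real.log 2 * ∫ y, |f y|)))) ENNReal.ofReal_ne_top ?_ J
  · have hg : Measurable (fun x : EE n => W ‖x‖ * Real.exp (κ * ww f x)) :=
      (hWm.comp measurable_norm).mul (Real.measurable_exp.comp ((ww_meas hn fc fi).const_mul κ))
    have T2 : ∫⁻ x in {x : EE n | 2 * R1 ≤ ‖x‖}, ENNReal.ofReal (W ‖x‖ * Real.exp (κ * ww f x)) ≠ ⊤ := by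
      refine ne_of_eq_of_ne ?_ T
      refine lintegral_congr fun x => ?_
      rw [ENNReal.ofReal_mul (by simp only [hW]; positivity)]
    filter_upwards [ray hn hg (by linarith : 0 < 2 * R1) T2] with θ hh
    have hθ : ‖(θ : EE n)‖ = 1 := by simpa using θ.2
    refine ⟨lt_of_eq_of_lt ?_ hh.1, lt_of_eq_of_lt ?_ hh.2⟩
    all_goals
      refine setLIntegral_congr_fun measurableSet_Ici fun r hr => ?_
      have hr' : 2 * R1 ≤ r := hr
      have : (0:ℝ) < r := by linarith
      simp only [norm_smul, norm_neg, hθ, Real.norm_eq_abs, abs_of_pos this, mul_one, hW]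
  · intro r s hr h1 h2
    have hr0 : 0 < r := by linarith
    have hs0 : 0 < s := by linarith
    rw [← ENNReal.ofReal_mul (by positivity)]
    refine ENNReal.ofReal_le_ofReal ?_
    have a1 : (s ^ k)⁻¹ ≤ 2 ^ k * (r ^ k)⁻¹ := by
      rw [← inv_pow, ← inv_pow, ← mul_pow]
      refine pow_le_pow_left₀ (by positivity) ?_ k
      rw [inv_le_iff_one_le_mul₀ hs0]
      have : 2 * r⁻¹ * s = (2 * s) / r := by ring
      rw [this, one_le_div hr0]; linarith
    have a2 : |Real.log s - Real.log r| ≤ Real.log 2 := by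
      rw [← Real.log_div hs0.ne' hr0.ne', abs_le, ← Real.log_inv]
      constructor
      · refine Real.log_le_log (by norm_num) ?_
        rw [le_div_iff₀ hr0]; linarith
      · refine Real.log_le_log (by positivity) ?_
        rw [div_le_iff₀ hr0]; linarith
    have a3 := (VV_lip hn fc fi (Real.log s) (Real.log r)).trans (mul_le_mul_of_nonneg_right a2 hI)
    have a4 : l * VV f (Real.log s) ≤ l * (Real.log 2 * ∫ y, |f y|) + l * VV f (Real.log r) := by
      rw [← mul_add]
      refine mul_le_mul_of_nonneg_left ?_ hl
      linarith [(abs_le.1 a3).2]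
    calc W s ≤ (2 ^ k * (r ^ k)⁻¹) * (Real.exp (l * (Real.log 2 * ∫ y, |f y|)) * Real.exp (l * VV f (Real.log r))) := by
          simp only [hW]
          rw [← Real.exp_add]
          gcongr
      _ = _ := by simp only [hW]; ring

/-- polynomial alternative -/
lemma poly_alt (P : Polynomial ℝ) (h0 : P.eval 0 = 0) (hP : P ≠ 0) : ∃ c > (0:ℝ),
    (∀ᶠ t in atTop, c * t ^ 2 ≤ P.eval t) ∨ (∀ᶠ t in atTop, P.eval t ≤ - (c * t)) ∨
    (∀ᶠ t in atTop, P.eval (-t) ≤ - (c * t)) := by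
  have hd : 1 ≤ P.natDegree := by
    by_contra hh
    have h1 : P.natDegree = 0 := by omega
    rw [Polynomial.eq_C_of_natDegree_eq_zero h1] at h0 hP
    simp at h0
    simp [h0] at hP
  set a := P.leadingCoeff with ha
  have ha0 : a ≠ 0 := Polynomial.leadingCoeff_ne_zero.2 hP
  have hA : Tendsto (fun t => P.eval t / t ^ P.natDegree) atTop (𝓝 a) :=
    by
      have := Polynomial.isEquivalent_atTop_lead P
      have hne : ∀ᶠ t : ℝ in atTop, a * t ^ P.natDegree ≠ 0 := by
        filter_upwards [eventually_gt_atTop 0] with t ht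
        positivity
      have h2 := (Asymptotics.isEquivalent_iff_tendsto_one hne).1 this
      have h3 := h2.mul_const a
      rw [one_mul] at h3
      refine h3.congr' ?_
      filter_upwards [eventually_gt_atTop 0] with t ht
      simp only [Pi.div_apply]
      field_simp
  rcases lt_or_gt_of_ne ha0 with hneg | hpos
  · refine ⟨-a/2, by linarith, Or.inr (Or.inl ?_)⟩
    filter_upwards [hA.eventually (gt_mem_nhds (show a < a/2 by linarith)), eventually_ge_atTop 1] with t h1 ht
    have hp : 0 < t ^ P.natDegree := by positivity
    rw [div_lt_iff₀ hp] at h1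
    have : t ≤ t ^ P.natDegree := le_self_pow₀ ht (by omega)
    nlinarith
  · by_cases h2 : 2 ≤ P.natDegree
    · refine ⟨a/2, by linarith, Or.inl ?_⟩
      filter_upwards [hA.eventually (lt_mem_nhds (show a/2 < a by linarith)), eventually_ge_atTop 1] with t h1 ht
      have hp : 0 < t ^ P.natDegree := by positivity
      rw [lt_div_iff₀ hp] at h1
      have : t ^ 2 ≤ t ^ P.natDegree := pow_le_pow_right₀ ht h2
      nlinarith
    · have hd1 : P.natDegree = 1 := by omega
      refine ⟨a, hpos, Or.inr (Or.inr ?_)⟩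
      refine Eventually.of_forall fun t => ?_
      have e := Polynomial.eq_X_add_C_of_natDegree_le_one hd1.le
      have ea : a = P.coeff 1 := by rw [ha, Polynomial.leadingCoeff, hd1]
      have e0 : P.coeff 0 = 0 := by rw [Polynomial.coeff_zero_eq_eval_zero, h0]
      rw [e, e0, ea]
      simp

end

section
set_option linter.all false
open MeasureTheory Real Filter Metric
open scoped ENNReal Topology

lemma fin_near {h : ℝ → ℝ} (hc : Continuous h) {A : ℝ}
    (hA : ∫⁻ r in Set.Ici A, ENNReal.ofReal (h r) ≠ ⊤) (h0 : ∀ r, 0 ≤ h r) :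
    ∫⁻ r in Set.Ioi (0:ℝ), ENNReal.ofReal (h r) ≠ ⊤ := by
  have hsub : Set.Ioi (0:ℝ) ⊆ Set.Icc 0 A ∪ Set.Ici A := by
    intro r hr
    have : (0:ℝ) < r := hr
    by_cases hh : r ≤ A
    · left; exact ⟨this.le, hh⟩
    · right; exact (not_le.1 hh).le
  have h1 : ∫⁻ r in Set.Icc 0 A, ENNReal.ofReal (h r) ≠ ⊤ := by
    rw [lintegral_ofReal_ne_top_iff_integrable]
    · exact hc.continuousOn.integrableOn_compact isCompact_Icc
    · exact hc.aestronglyMeasurable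
    · exact Eventually.of_forall h0
  refine ne_top_of_le_ne_top (ENNReal.add_ne_top.2 ⟨h1, hA⟩)
    ((lintegral_mono_set hsub).trans (lintegral_union_le _ _ _))

lemma log_lin (a b : ℝ) {c : ℝ} (hc : 0 < c) : ∀ᶠ t : ℝ in atTop, a + b * Real.log t ≤ c * t := by
  have h1 := (Real.isLittleO_log_id_atTop.const_mul_left b).bound (show 0 < c/2 by positivity)
  filter_upwards [h1, eventually_ge_atTop (max 1 (2 * a / c))] with t h1 ht
  have ht1 : 1 ≤ t := (le_max_left _ _).trans ht
  have ht2 : 2 * a / c ≤ t := (le_max_right _ _).trans ht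
  rw [div_le_iff₀ hc] at ht2
  simp only [id, Real.norm_eq_abs, abs_of_pos (by linarith : 0 < t)] at h1
  have := (abs_le.1 h1).2
  linarith

lemma dir_fin {n : ℕ} (hn : 2 ≤ n) {f : EE n → ℝ} (fc : Continuous f) (fi : Integrable f) {κ R1 : ℝ}
    (h : Far f κ R1) {u : EE n → ℝ} (hu : Continuous u) {θ : EE n} {u0 c : ℝ} (hc : 0 < c)
    (hub : ∀ᶠ t : ℝ in atTop, u (t • θ) ≤ u0 + κ * (VV f (Real.log t) + ww f (t • θ)) - c * t)
    (ha : ∫⁻ r in Set.Ici (2 * R1), ENNReal.ofReal ((r ^ 2)⁻¹ * Real.exp (κ * ww f (r • θ))) < ⊤) :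
    ∫⁻ r in Set.Ioi (0:ℝ), ENNReal.ofReal (Real.exp (u (r • θ))) ≠ ⊤ := by
  set I := ∫ y, |f y| with hI
  have hk := h.kpos
  have ev := (hub.and (log_lin (u0 + κ * |VV f 0|) (κ * I + 2) hc)).and (eventually_ge_atTop (max 1 (2 * R1)))
  obtain ⟨A, hA⟩ := eventually_atTop.1 ev
  refine fin_near (h := fun r => Real.exp (u (r • θ))) (by fun_prop) (A := max A (2 * R1)) ?_ fun r => (Real.exp_pos _).le
  refine ne_top_of_le_ne_top ha.ne ?_
  calc _ ≤ ∫⁻ r in Set.Ici (max A (2 * R1)), ENNReal.ofReal ((r ^ 2)⁻¹ * Real.exp (κ * ww f (r • θ))) := by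
        refine setLIntegral_mono_ae' measurableSet_Ici (Eventually.of_forall fun r hr => ENNReal.ofReal_le_ofReal ?_)
        obtain ⟨⟨h1, h2⟩, h3⟩ := hA r ((le_max_left _ _).trans hr)
        have hr1 : 1 ≤ r := (le_max_left _ _).trans h3
        have hr0 : 0 < r := by linarith
        have hl : 0 ≤ Real.log r := Real.log_nonneg hr1
        have h4 := (abs_le.1 (VV_bd hn fc fi (Real.log r))).2
        rw [abs_of_nonneg hl] at h4
        have e : (r ^ 2)⁻¹ = Real.exp (-(2 * Real.log r)) := by
          rw [Real.exp_neg, two_mul, Real.exp_add, Real.exp_log hr0, sq]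
        rw [e, ← Real.exp_add]
        refine Real.exp_le_exp.2 ?_
        have h5 := mul_le_mul_of_nonneg_left h4 hk.le
        rw [← hI] at h5
        nlinarith
    _ ≤ _ := lintegral_mono_set (Set.Ici_subset_Ici.2 (le_max_right _ _))

lemma quad_inf {n : ℕ} (hn : 2 ≤ n) {f : EE n → ℝ} (fc : Continuous f) (fi : Integrable f) {κ R1 : ℝ}
    (h : Far f κ R1) {u : EE n → ℝ} {θ : EE n} (hθ : ‖θ‖ = 1) {u0 c : ℝ} (hc : 0 < c)
    (hub : ∀ᶠ t : ℝ in atTop, u0 + κ * (VV f (Real.log t) + ww f (t • θ)) + c * t ^ 2 ≤ u (t • θ))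
    (hb : ∀ k : ℕ, ∃ A : ℝ, ∫⁻ r in Set.Ici A, ENNReal.ofReal (r ^ (n - 1) * Real.exp (n * u (r • θ) - (1 / ((k:ℝ) + 1)) * r ^ 2)) < ⊤) :
    False := by
  set I := ∫ y, |f y| with hI
  have hk := h.kpos
  have hR := h.one
  obtain ⟨k, hkc⟩ := exists_nat_one_div_lt (show 0 < c/2 by positivity)
  obtain ⟨A, hA⟩ := hb k
  have ev := (hub.and (log_lin (-u0 + κ * |VV f 0| + κ * (Real.log 2 * I)) (κ * I) (show 0 < c/2 by positivity))).and (eventually_ge_atTop (max 1 (2 * R1)))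
  obtain ⟨B, hB⟩ := eventually_atTop.1 ev
  have : ∫⁻ r in Set.Ici (max A B), (1:ℝ≥0∞) < ⊤ := by
    refine lt_of_le_of_lt ?_ hA
    refine le_trans ?_ (lintegral_mono_set (Set.Ici_subset_Ici.2 (le_max_left A B)))
    refine setLIntegral_mono_ae' measurableSet_Ici (Eventually.of_forall fun r hr => ?_)
    obtain ⟨⟨h1, h2⟩, h3⟩ := hB r ((le_max_right _ _).trans hr)
    have hr1 : 1 ≤ r := (le_max_left _ _).trans h3
    have hr0 : 0 < r := by linarith
    have hl : 0 ≤ Real.log r := Real.log_nonneg hr1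
    have h4 := (abs_le.1 (VV_bd hn fc fi (Real.log r))).1
    rw [abs_of_nonneg hl] at h4
    have h5 := ww_lower hn fc fi h (x := r • θ) (by
      rw [norm_smul, hθ, Real.norm_eq_abs, abs_of_pos hr0, mul_one]; exact (le_max_right _ _).trans h3)
    rw [← hI] at h4 h5
    have h6 := mul_le_mul_of_nonneg_left (add_le_add h4 h5) hk.le
    have h7 : c/2 * r^2 ≤ u (r • θ) := by
      have : r ≤ r ^ 2 := by nlinarith
      nlinarith
    have h8 : (0:ℝ) ≤ c/2 * r^2 := by positivity
    have hn1 : (1:ℝ) ≤ n := by exact_mod_cast (by omega : 1 ≤ n)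
    have h9 : 0 ≤ n * u (r • θ) - (1 / ((k:ℝ) + 1)) * r ^ 2 := by
      have : (1 / ((k:ℝ) + 1)) * r ^ 2 ≤ c/2 * r^2 := by gcongr
      nlinarith
    have h10 : (1:ℝ) ≤ r ^ (n - 1) * Real.exp (n * u (r • θ) - (1 / ((k:ℝ) + 1)) * r ^ 2) := by
      have := one_le_pow₀ hr1 (n := n - 1)
      have := Real.one_le_exp h9
      nlinarith
    simpa using ENNReal.ofReal_le_ofReal h10
  simp at this

lemma poly_zero {n : ℕ} (hn : 2 ≤ n) {f : EE n → ℝ} (fc : Continuous f) (fi : Integrable f) {κ R1 : ℝ}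
    (h : Far f κ R1) {u : EE n → ℝ} (hu : Continuous u) {θ : EE n} (hθ : ‖θ‖ = 1) {u0 : ℝ} (P : Polynomial ℝ)
    (hP0 : P.eval 0 = 0)
    (hrep : ∀ t : ℝ, u (t • θ) = u0 + κ * lpot f (t • θ) + P.eval t)
    (ha : ∫⁻ r in Set.Ici (2 * R1), ENNReal.ofReal ((r ^ 2)⁻¹ * Real.exp (κ * ww f (r • θ))) < ⊤)
    (ha' : ∫⁻ r in Set.Ici (2 * R1), ENNReal.ofReal ((r ^ 2)⁻¹ * Real.exp (κ * ww f (r • (-θ)))) < ⊤)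
    (hb : ∀ k : ℕ, ∃ A : ℝ, ∫⁻ r in Set.Ici A, ENNReal.ofReal (r ^ (n - 1) * Real.exp (n * u (r • θ) - (1 / ((k:ℝ) + 1)) * r ^ 2)) < ⊤)
    (hcomplete : ∀ θ : EE n, ‖θ‖ = 1 →
      ∫⁻ r in Set.Ioi (0 : ℝ), ENNReal.ofReal (Real.exp (u (r • θ))) = ⊤) : P = 0 := by
  by_contra hP
  have hl : ∀ (θ' : EE n), ‖θ'‖ = 1 → ∀ t : ℝ, 0 < t → lpot f (t • θ') = VV f (Real.log t) + ww f (t • θ') := by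
    intro θ' h' t ht
    unfold ww
    rw [norm_smul, h', Real.norm_eq_abs, abs_of_pos ht, mul_one]; ring
  have hθ' : ‖-θ‖ = 1 := by rwa [norm_neg]
  obtain ⟨c, hc, h1 | h1 | h1⟩ := poly_alt P hP0 hP
  · refine quad_inf hn fc fi h (u0 := u0) hθ hc ?_ hb
    filter_upwards [h1, eventually_gt_atTop 0] with t h1 ht
    rw [hrep, hl θ hθ t ht]; linarith
  · refine dir_fin hn fc fi h hu (u0 := u0) hc ?_ ha (hcomplete θ hθ)
    filter_upwards [h1, eventually_gt_atTop 0] with t h1 ht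
    rw [hrep, hl θ hθ t ht]; linarith
  · refine dir_fin hn fc fi h hu (u0 := u0) hc ?_ ha' (hcomplete _ hθ')
    filter_upwards [h1, eventually_gt_atTop 0] with t h1 ht
    have e : t • (-θ) = (-t) • θ := by simp
    rw [← hl (-θ) hθ' t ht, e, hrep]; linarith

end

section
set_option linter.all false
open MeasureTheory Real Filter Metric
open scoped ENNReal Topology

lemma far_exists {n : ℕ} {f : EE n → ℝ} (fi : Integrable f) {κ R0 : ℝ} (hk : 0 < κ)
    (h0 : ∀ y, R0 ≤ ‖y‖ → 0 ≤ f y) : ∃ R1, Far f κ R1 := by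
  have fk : Integrable (fun y => κ * f y) := fi.const_mul κ
  have ht := tendsto_setIntegral_of_antitone (μ := (volume : Measure (EE n))) (f := fun y => κ * f y)
    (s := fun k : ℕ => {y : EE n | (k:ℝ) ≤ ‖y‖}) (fun k => meas_far _)
    (fun a b hab y hy => by
      simp only [Set.mem_setOf_eq] at hy ⊢
      exact le_trans (by exact_mod_cast hab) hy) ⟨0, fk.integrableOn⟩
  have he : (⋂ k : ℕ, {y : EE n | (k:ℝ) ≤ ‖y‖}) = ∅ := by
    ext y
    simp only [Set.mem_iInter, Set.mem_setOf_eq, Set.mem_empty_iff_false, iff_false, not_forall, not_le]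
    exact exists_nat_gt ‖y‖
  rw [he] at ht
  simp only [Measure.restrict_empty, integral_zero_measure] at ht
  have e1 := ht.eventually (gt_mem_nhds (show (0:ℝ) < 1 by norm_num))
  obtain ⟨k, hk1, hk2⟩ := (e1.and (eventually_ge_atTop (max 1 ⌈R0⌉₊))).exists
  refine ⟨k, ?_, hk, fun y hy => h0 y ?_, hk1.le⟩
  · exact_mod_cast (le_max_left _ _).trans hk2
  · refine le_trans (Nat.le_ceil R0) (le_trans ?_ hy)
    exact_mod_cast (le_max_right _ _).trans hk2

lemma inv_sq_fin {A : ℝ} (hA : 0 < A) : ∫⁻ r in Set.Ici A, ENNReal.ofReal ((r ^ 2)⁻¹) ≠ ⊤ := by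
  rw [Measure.restrict_congr_set Ioi_ae_eq_Ici.symm, lintegral_ofReal_ne_top_iff_integrable]
  · have := integrableOn_Ioi_rpow_of_lt (show (-2:ℝ) < -1 by norm_num) hA
    refine this.congr_fun (fun r hr => ?_) measurableSet_Ioi
    have : 0 < r := lt_trans hA hr
    simp only [Real.rpow_neg this.le]
    norm_num
  · exact Measurable.aestronglyMeasurable (by fun_prop)
  · exact Eventually.of_forall fun r => by positivity

lemma lpot_zero {n : ℕ} (f : EE n → ℝ) : lpot f 0 = 0 := by
  unfold lpot
  have : ∀ y : EE n, Real.log (‖y‖ / ‖0 - y‖) * f y = 0 := by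
    intro y
    rw [zero_sub, norm_neg]
    by_cases h : ‖y‖ = 0
    · simp [h]
    · simp [div_self h]
  simp [this]

lemma u_bd {n : ℕ} (hn : 1 ≤ n) {u Q : EE n → ℝ} (hu : Continuous u)
    (hQ : ∀ δ > (0 : ℝ), ∃ Rδ : ℝ, ∀ x : EE n, Rδ ≤ ‖x‖ → Real.exp (-δ * ‖x‖ ^ 2) ≤ Q x) :
    ∃ M, 0 ≤ M ∧ ∀ x, u x ≤ |Q x * Real.exp (n * u x)| + ‖x‖ ^ 2 + M := by
  obtain ⟨R, hR⟩ := hQ 1 one_pos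
  obtain ⟨M, hM0, hM⟩ := bdd_on_ball hu R
  refine ⟨M, hM0, fun x => ?_⟩
  have ha := abs_nonneg (Q x * Real.exp (n * u x))
  have hx2 : 0 ≤ ‖x‖ ^ 2 := by positivity
  by_cases h : ‖x‖ ≤ R
  · have := (abs_le.1 (hM x h)).2
    linarith
  · push Not at h
    by_cases hu0 : u x ≤ 0
    · linarith
    push Not at hu0
    have h1 : Real.exp (n * u x - ‖x‖^2) ≤ Q x * Real.exp (n * u x) := by
      have := mul_le_mul_of_nonneg_right (hR x h.le) (Real.exp_pos (n * u x)).le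
      rw [← Real.exp_add] at this
      refine le_trans (le_of_eq ?_) this
      congr 1; ring
    have h2 := Real.add_one_le_exp (n * u x - ‖x‖^2)
    have h3 := le_abs_self (Q x * Real.exp (n * u x))
    have hn1 : (1:ℝ) ≤ n := by exact_mod_cast hn
    nlinarith

lemma part_b {n : ℕ} (hn : 2 ≤ n) {u Q : EE n → ℝ} (hu : Continuous u)
    (hf : Integrable (fun y => Q y * Real.exp (n * u y)))
    (hQ : ∀ δ > (0 : ℝ), ∃ Rδ : ℝ, ∀ x : EE n, Rδ ≤ ‖x‖ → Real.exp (-δ * ‖x‖ ^ 2) ≤ Q x) :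
    ∀ᵐ θ : sphere (0:EE n) 1 ∂(sphereMeasure n), ∀ k : ℕ, ∃ A : ℝ, ∫⁻ r in Set.Ici A,
      ENNReal.ofReal (r ^ (n - 1) * Real.exp (n * u (r • (θ : EE n)) - (1 / ((k:ℝ) + 1)) * r ^ 2)) < ⊤ := by
  refine ae_all_iff.2 fun k => ?_
  set δ : ℝ := 1 / ((k:ℝ) + 1) with hδ
  have hδ0 : 0 < δ := by positivity
  obtain ⟨R, hR⟩ := hQ δ hδ0
  have hg : Measurable (fun x : EE n => Real.exp (n * u x - δ * ‖x‖^2)) := by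
    refine Continuous.measurable ?_; fun_prop
  have hfin : ∫⁻ x in {x : EE n | max 1 R ≤ ‖x‖}, ENNReal.ofReal (Real.exp (n * u x - δ * ‖x‖^2)) ≠ ⊤ := by
    have h1 : ∫⁻ x, ENNReal.ofReal ‖Q x * Real.exp (n * u x)‖ ≠ ⊤ := by
      rw [lintegral_ofReal_ne_top_iff_integrable hf.norm.aestronglyMeasurable (Eventually.of_forall fun x => norm_nonneg _)]
      exact hf.norm
    refine ne_top_of_le_ne_top h1 (le_trans ?_ (setLIntegral_le_lintegral {x : EE n | max 1 R ≤ ‖x‖} _))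
    refine setLIntegral_mono_ae' (meas_far _) (Eventually.of_forall fun x hx => ENNReal.ofReal_le_ofReal ?_)
    have h2 := hR x ((le_max_right _ _).trans hx)
    have h3 := mul_le_mul_of_nonneg_right h2 (Real.exp_pos (n * u x)).le
    rw [← Real.exp_add] at h3
    refine le_trans (le_of_eq ?_) (h3.trans (le_abs_self _))
    congr 1; ring
  filter_upwards [ray hn hg (lt_of_lt_of_le one_pos (le_max_left 1 R)) hfin] with θ hh
  have hθ : ‖(θ : EE n)‖ = 1 := by simpa using θ.2
  refine ⟨max 1 R, lt_of_eq_of_lt ?_ hh.1⟩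
  refine setLIntegral_congr_fun measurableSet_Ici fun r hr => ?_
  have : (0:ℝ) < r := lt_of_lt_of_le one_pos ((le_max_left 1 R).trans hr)
  simp only [norm_smul, hθ, Real.norm_eq_abs, abs_of_pos this, mul_one]

lemma part_a {n : ℕ} (hn : 2 ≤ n) {f : EE n → ℝ} (fc : Continuous f) (fi : Integrable f) {κ R1 : ℝ}
    (h : Far f κ R1) : ∀ᵐ θ : sphere (0:EE n) 1 ∂(sphereMeasure n),
    ∫⁻ r in Set.Ici (2 * R1), ENNReal.ofReal ((r ^ 2)⁻¹ * Real.exp (κ * ww f (r • (θ : EE n)))) < ⊤ ∧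
    ∫⁻ r in Set.Ici (2 * R1), ENNReal.ofReal ((r ^ 2)⁻¹ * Real.exp (κ * ww f (r • (-(θ : EE n))))) < ⊤ := by
  have hR := h.one
  have key : ∀ r : ℝ, 0 < r → r ^ (n - 1) * (r ^ (n + 1))⁻¹ = (r ^ 2)⁻¹ := by
    intro r hr
    have : n + 1 = (n - 1) + 2 := by omega
    rw [this, pow_add]
    field_simp
  have w := weighted hn fc fi h (n + 1) (l := 0) le_rfl (by
    refine ne_of_eq_of_ne ?_ (inv_sq_fin (by linarith : 0 < R1))
    refine setLIntegral_congr_fun measurableSet_Ici fun r hr => ?_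
    have hr' : R1 ≤ r := hr
    simp only [zero_mul, Real.exp_zero, mul_one]
    rw [key r (by linarith)])
  filter_upwards [w] with θ hh
  refine ⟨lt_of_eq_of_lt ?_ hh.1, lt_of_eq_of_lt ?_ hh.2⟩
  all_goals
    refine setLIntegral_congr_fun measurableSet_Ici fun r hr => ?_
    have hr' : 2 * R1 ≤ r := hr
    simp only [zero_mul, Real.exp_zero, mul_one]
    rw [← mul_assoc, key r (by linarith)]

lemma part_i {m n : ℕ} (hm : 2 ≤ m) (hn : n = 2 * m)
    (u Q : EE n → ℝ) (hu : ContDiff ℝ (⊤ : ℕ∞) u)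
    (hPDE : ∀ x, negLapIter m u x = 2 * Q x * Real.exp (n * u x))
    (hf : Integrable (fun y => Q y * Real.exp (n * u y)))
    (hQ : ∀ δ > (0 : ℝ), ∃ Rδ : ℝ, ∀ x : EE n, Rδ ≤ ‖x‖ → Real.exp (-δ * ‖x‖ ^ 2) ≤ Q x)
    (hcomplete : ∀ θ : EE n, ‖θ‖ = 1 →
      ∫⁻ r in Set.Ioi (0 : ℝ), ENNReal.ofReal (Real.exp (u (r • θ))) = ⊤) :
    ∫⁻ r in Set.Ioi (0 : ℝ), ENNReal.ofReal (Real.exp (sphereAvg n u r)) = ⊤ := by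
  have hn2 : 2 ≤ n := by omega
  have uc : Continuous u := hu.continuous
  set f : EE n → ℝ := fun y => Q y * Real.exp (n * u y) with hfd
  have hff : ∀ x, negLapIter m u x = 2 * f x := fun x => by rw [hPDE]; simp only [hfd]; ring
  have fc : Continuous f := by
    have : f = fun x => negLapIter m u x / 2 := by funext x; rw [hff]; ring
    rw [this]
    exact (contDiff_negLapIter hu m).continuous.div_const 2
  obtain ⟨M, hM0, hM⟩ := u_bd (by omega) uc hQ
  have hC := Cm_pos hn (by omega : 1 ≤ m)
  set κ : ℝ := 2 / Cm m n with hκ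
  have hk : 0 < κ := by positivity
  obtain ⟨R0, hR0⟩ := hQ 1 one_pos
  obtain ⟨R1, hfar⟩ := far_exists hf (R0 := R0) hk (fun y hy =>
    mul_nonneg ((Real.exp_pos _).le.trans (hR0 y hy)) (Real.exp_pos _).le)
  have hR := hfar.one
  have hrepr : ∀ᵐ θ : sphere (0:EE n) 1 ∂(sphereMeasure n), ∀ t : ℝ,
      u (t • (θ : EE n)) = u 0 + κ * lpot f (t • (θ : EE n)) := by
    filter_upwards [part_a hn2 fc hf hfar, part_b hn2 uc hf hQ] with θ ha hb
    have hθ : ‖(θ : EE n)‖ = 1 := by simpa using θ.2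
    obtain ⟨P, hP⟩ := poly_line hn (by omega) hu hff fc hf hM0 hM θ hθ
    have hrep : ∀ t : ℝ, u (t • (θ : EE n)) = u 0 + κ * lpot f (t • (θ : EE n)) + (Polynomial.C (Cm m n)⁻¹ * P).eval t := by
      intro t
      rw [Polynomial.eval_mul, Polynomial.eval_C, ← hP t, hκ]
      field_simp
      ring
    have h0 : (Polynomial.C (Cm m n)⁻¹ * P).eval 0 = 0 := by
      have := hrep 0
      rw [zero_smul, lpot_zero] at this
      linarith
    have hz := poly_zero hn2 fc hf hfar uc hθ _ h0 hrep ha.1 ha.2 hb hcomplete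
    intro t
    have := hrep t
    rw [hz] at this
    simpa using this
  have hsplit : ∀ θ : EE n, ‖θ‖ = 1 → ∀ t : ℝ, 0 < t → lpot f (t • θ) = VV f (Real.log t) + ww f (t • θ) := by
    intro θ' h' t ht
    unfold ww
    rw [norm_smul, h', Real.norm_eq_abs, abs_of_pos ht, mul_one]; ring
  set b : ℝ := u 0 - κ * (Real.log 2 * ∫ y, |f y|) with hb
  have hω := omegaN_pos (n := n) (by omega)
  have havg : ∀ r, 2 * R1 ≤ r → b + κ * VV f (Real.log r) ≤ sphereAvg n u r := by
    intro r hr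
    have hr0 : 0 < r := by linarith
    unfold sphereAvg
    rw [le_div_iff₀ hω]
    have huint : Integrable (fun θ : sphere (0:EE n) 1 => u (r • (θ : EE n))) (sphereMeasure n) :=
      cont_int_compact _ (by fun_prop)
    have e : (b + κ * VV f (Real.log r)) * omegaN n = ∫ θ : sphere (0:EE n) 1, (b + κ * VV f (Real.log r)) ∂(sphereMeasure n) := by
      rw [integral_const, smul_eq_mul, mul_comm]; rfl
    rw [e]
    refine integral_mono_ae (integrable_const _) huint ?_
    filter_upwards [hrepr] with θ hθr
    have hθ : ‖(θ : EE n)‖ = 1 := by simpa using θ.2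
    rw [hθr r, hsplit θ hθ r hr0]
    have h5 := ww_lower hn2 fc hf hfar (x := r • (θ : EE n)) (by
      rw [norm_smul, hθ, Real.norm_eq_abs, abs_of_pos hr0, mul_one]; exact hr)
    have := mul_le_mul_of_nonneg_left h5 hk.le
    rw [hb]; linarith
  by_contra hfin
  have kk : ∀ r : ℝ, 0 < r → ∀ z : ℝ, r ^ (n - 1) * ((r ^ (n - 1))⁻¹ * z) = z := by
    intro r hr z
    rw [← mul_assoc, mul_inv_cancel₀ (by positivity), one_mul]
  have hJ : ∫⁻ r in Set.Ici (2 * R1), ENNReal.ofReal (r ^ (n - 1) * ((r ^ (n - 1))⁻¹ * Real.exp (κ * VV f (Real.log r)))) ≠ ⊤ := by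
    refine ne_top_of_le_ne_top (ENNReal.mul_ne_top (ENNReal.ofReal_ne_top (r := Real.exp (-b))) hfin) ?_
    rw [← lintegral_const_mul' _ _ ENNReal.ofReal_ne_top]
    have hss : Set.Ici (2 * R1) ⊆ Set.Ioi (0:ℝ) := fun r hr => by
      have : 2 * R1 ≤ r := hr
      show (0:ℝ) < r
      linarith
    refine le_trans ?_ (lintegral_mono_set hss)
    refine setLIntegral_mono_ae' measurableSet_Ici (Eventually.of_forall fun r hr => ?_)
    have hr' : 2 * R1 ≤ r := hr
    rw [← ENNReal.ofReal_mul (Real.exp_pos _).le, kk r (by linarith), ← Real.exp_add]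
    refine ENNReal.ofReal_le_ofReal (Real.exp_le_exp.2 ?_)
    linarith [havg r hr']
  have hw := weighted hn2 fc hf (hfar.mono hf (by linarith : R1 ≤ 2 * R1)) (n - 1) hk.le hJ
  have hne : NeZero (sphereMeasure n) := ⟨fun h => by
    have : omegaN n = 0 := by unfold omegaN; rw [h]; simp
    linarith⟩
  obtain ⟨θ, hθ1, hθ2⟩ := (hw.and hrepr).exists
  have hθ : ‖(θ : EE n)‖ = 1 := by simpa using θ.2
  refine fin_near (h := fun r => Real.exp (u (r • (θ : EE n)))) (by fun_prop) (A := 2 * (2 * R1)) ?_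
    (fun r => (Real.exp_pos _).le) (hcomplete θ hθ)
  refine ne_top_of_le_ne_top (ENNReal.mul_ne_top (ENNReal.ofReal_ne_top (r := Real.exp (u 0))) hθ1.1.ne) ?_
  rw [← lintegral_const_mul' _ _ ENNReal.ofReal_ne_top]
  refine setLIntegral_mono_ae' measurableSet_Ici (Eventually.of_forall fun r hr => ?_)
  have hr' : 2 * (2 * R1) ≤ r := hr
  have hr0 : 0 < r := by linarith
  rw [← ENNReal.ofReal_mul (Real.exp_pos _).le, mul_assoc, kk r hr0, ← Real.exp_add, ← Real.exp_add]
  refine ENNReal.ofReal_le_ofReal (Real.exp_le_exp.2 ?_)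
  rw [hθ2 r, hsplit θ hθ r hr0]
  exact le_of_eq (by ring)

end

/-- The spherical average `ū` of `u` inherits completeness, the decay lower bound for its
`Q`-curvature `Q̄`, integrability of `Q̄ e^{n ū}`, and has the same total `Q`-curvature. -/
theorem stmt12 (m n : ℕ) (hm : 2 ≤ m) (hn : n = 2 * m)
    (u Q : EuclideanSpace ℝ (Fin n) → ℝ) (hu : ContDiff ℝ (⊤ : ℕ∞) u)
    (hPDE : ∀ x, negLapIter m u x = 2 * Q x * Real.exp (n * u x))
    (hf : MeasureTheory.Integrable (fun y => Q y * Real.exp (n * u y)))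
    (hQ : ∀ δ > (0 : ℝ), ∃ Rδ : ℝ, ∀ x : EuclideanSpace ℝ (Fin n), Rδ ≤ ‖x‖ →
      Real.exp (-δ * ‖x‖ ^ 2) ≤ Q x)
    (hcomplete : ∀ θ : EuclideanSpace ℝ (Fin n), ‖θ‖ = 1 →
      ∫⁻ r in Set.Ioi (0 : ℝ), ENNReal.ofReal (Real.exp (u (r • θ))) = ⊤)
    (ubar : EuclideanSpace ℝ (Fin n) → ℝ) (hubar : ∀ x, ubar x = sphereAvg n u ‖x‖)
    (Qbar : EuclideanSpace ℝ (Fin n) → ℝ)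
    (hQbar : ∀ x, Qbar x = 1 / 2 * Real.exp (-(n : ℝ) * ubar x) * negLapIter m ubar x) :
    (∫⁻ r in Set.Ioi (0 : ℝ), ENNReal.ofReal (Real.exp (sphereAvg n u r)) = ⊤) ∧
    (∀ δ > (0 : ℝ), ∃ C₀ > (0 : ℝ), ∃ R : ℝ, ∀ x : EuclideanSpace ℝ (Fin n), R ≤ ‖x‖ →
      C₀ * Real.exp (-δ * ‖x‖ ^ 2) ≤ Qbar x) ∧
    MeasureTheory.Integrable (fun x => Qbar x * Real.exp (n * ubar x)) ∧
    (∫ x, Qbar x * Real.exp (n * ubar x)) = ∫ x, Q x * Real.exp (n * u x) := by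
  exact ⟨part_i hm hn u Q hu hPDE hf hQ hcomplete,
    parts_ii_iii m n hm hn u Q hu hPDE hf hQ ubar hubar Qbar hQbar⟩
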